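/- arXiv:1901.01510 — 2 statements merged into one kernel-verified Lean document; each statement's English description precedes it below -/
import Mathlib

section
/- Let p ∈ [1,∞] and q⃗ = (q₁,q₂,q₃) with q_j > 1 for each j and 2/p + 1/q̄ = 2, where 1/q̄ := 1/q₁+1/q₂+1/q₃. There exists a constant C, depending only on p and q⃗ and independent of μ and ρ, such that for every suitable weak solution (u,Π) of the 3D Navier-Stokes equations on Q(ρ) and all 0 < √6 μ ≤ ρ: E₃(μ) ≤ C (ρ/μ)² E_{p,q⃗}(ρ) · E_*(ρ)^{1 − 1/p} · E(ρ)^{1/p} + C (μ/ρ) E₃(ρ). -/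
open MeasureTheory ENNReal Set Metric Filter

noncomputable section

/-- Euclidean 3-space. -/
abbrev E3 : Type := EuclideanSpace ℝ (Fin 3)

/-- The point (x₁,x₂,x₃) of ℝ³. -/
def pt3 (x1 x2 x3 : ℝ) : E3 := (WithLp.equiv 2 (Fin 3 → ℝ)).symm ![x1, x2, x3]

/-- Anisotropic Lebesgue (quasi-)norm `‖f‖_{L^{q⃗}(Ω)}` with finite exponents:
iterated L^{q₁}, L^{q₂}, L^{q₃} norms in x₁, x₂, x₃ of f extended by 0 outside Ω. -/
def anisoNorm (q1 q2 q3 : ℝ) (Ω : Set E3) (f : E3 → ℝ) : ℝ≥0∞ :=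
  (∫⁻ x3 : ℝ, (∫⁻ x2 : ℝ, (∫⁻ x1 : ℝ,
      (ENNReal.ofReal |Ω.indicator f (pt3 x1 x2 x3)|) ^ q1) ^ (q2 / q1)) ^ (q3 / q2)) ^ (1 / q3)

/-- Mixed norm `‖f‖_{L^p_t L^{q⃗}_x(Q(r))}`, time exponent `p ∈ [1,∞]`,
where `Q(r) = B(r) × (−r²,0)`. -/
def mixedNorm (p : ℝ≥0∞) (q1 q2 q3 r : ℝ) (f : E3 → ℝ → ℝ) : ℝ≥0∞ :=
  if p = ∞ then
    essSup (fun t => anisoNorm q1 q2 q3 (ball (0 : E3) r) (fun x => f x t))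
      (volume.restrict (Ioo (-(r^2)) 0))
  else
    (∫⁻ t in Ioo (-(r^2)) 0,
        (anisoNorm q1 q2 q3 (ball (0 : E3) r) (fun x => f x t)) ^ p.toReal) ^ (1 / p.toReal)

/-- Partial derivative in the i-th coordinate direction. -/
def pd (i : Fin 3) (f : E3 → ℝ) (x : E3) : ℝ := fderiv ℝ f x (EuclideanSpace.single i 1)

/-- Laplacian. -/
def lap (f : E3 → ℝ) (x : E3) : ℝ := ∑ i : Fin 3, pd i (fun y => pd i f y) x

/-- Scalar test functions compactly supported in `Q(R) = B(R) × (−R²,0)`. -/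
def IsTest (R : ℝ) (φ : E3 → ℝ → ℝ) : Prop :=
  ContDiff ℝ (⊤ : ℕ∞) (fun z : E3 × ℝ => φ z.1 z.2) ∧
  HasCompactSupport (fun z : E3 × ℝ => φ z.1 z.2) ∧
  tsupport (fun z : E3 × ℝ => φ z.1 z.2) ⊆ (ball (0 : E3) R) ×ˢ (Ioo (-(R^2)) 0)

/-- Vector test functions compactly supported in `Q(R) = B(R) × (−R²,0)`. -/
def IsTestV (R : ℝ) (w : E3 → ℝ → E3) : Prop :=
  ContDiff ℝ (⊤ : ℕ∞) (fun z : E3 × ℝ => w z.1 z.2) ∧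
  HasCompactSupport (fun z : E3 × ℝ => w z.1 z.2) ∧
  tsupport (fun z : E3 × ℝ => w z.1 z.2) ⊆ (ball (0 : E3) R) ×ˢ (Ioo (-(R^2)) 0)

/-- A suitable weak solution `(u, P)` of the 3D Navier–Stokes equations on
`Q(R) = B(R) × (−R²,0)`: `u ∈ L^∞_t L²_x` with a distributional spatial gradient
`gu ∈ L²(Q(R))`, pressure `P ∈ L^{3/2}(Q(R))`, the equations hold in the sense of
distributions, and the local energy inequality holds. -/
structure SuitableWeakSolution (R : ℝ) (u : E3 → ℝ → E3) (P : E3 → ℝ → ℝ) where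
  /-- the distributional spatial gradient: `gu x t i j = ∂ⱼuᵢ(x,t)` -/
  gu : E3 → ℝ → Fin 3 → Fin 3 → ℝ
  meas_u : Measurable (Function.uncurry u)
  meas_gu : Measurable (Function.uncurry gu)
  meas_press : Measurable (Function.uncurry P)
  /-- `u ∈ L^∞(−R²,0; L²(B(R)))` -/
  bdd_L2 : essSup (fun t => ∫⁻ x in ball (0 : E3) R, ((‖u x t‖₊ : ℝ≥0∞)) ^ 2)
      (volume.restrict (Ioo (-(R^2)) 0)) < ∞
  /-- `∇u ∈ L²(Q(R))` -/
  grad_L2 : (∫⁻ t in Ioo (-(R^2)) 0, ∫⁻ x in ball (0 : E3) R,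
      ENNReal.ofReal (∑ i : Fin 3, ∑ j : Fin 3, (gu x t i j) ^ 2)) < ∞
  /-- `P ∈ L^{3/2}(Q(R))` -/
  press_L32 : (∫⁻ t in Ioo (-(R^2)) 0, ∫⁻ x in ball (0 : E3) R,
      (ENNReal.ofReal |P x t|) ^ (3/2 : ℝ)) < ∞
  /-- `gu` is the distributional spatial gradient of `u` on `Q(R)` -/
  is_grad : ∀ φ : E3 → ℝ → ℝ, IsTest R φ → ∀ i j : Fin 3,
      (∫ t in Ioo (-(R^2)) 0, ∫ x in ball (0 : E3) R, u x t i * pd j (fun y => φ y t) x)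
        = - ∫ t in Ioo (-(R^2)) 0, ∫ x in ball (0 : E3) R, gu x t i j * φ x t
  /-- `∂ₜu − Δu + (u·∇)u + ∇P = 0` in the sense of distributions on `Q(R)` -/
  weak_NS : ∀ w : E3 → ℝ → E3, IsTestV R w →
      (∫ t in Ioo (-(R^2)) 0, ∫ x in ball (0 : E3) R,
        (-(∑ i : Fin 3, u x t i * deriv (fun s => w x s i) t)
          - (∑ i : Fin 3, u x t i * lap (fun y => w y t i) x)
          - (∑ i : Fin 3, ∑ j : Fin 3, u x t i * u x t j * pd i (fun y => w y t j) x)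
          - P x t * (∑ j : Fin 3, pd j (fun y => w y t j) x))) = 0
  /-- `div u = 0` in the sense of distributions on `Q(R)` -/
  weak_div : ∀ ψ : E3 → ℝ → ℝ, IsTest R ψ →
      (∫ t in Ioo (-(R^2)) 0, ∫ x in ball (0 : E3) R,
        ∑ i : Fin 3, u x t i * pd i (fun y => ψ y t) x) = 0
  /-- the local energy inequality -/
  local_energy : ∀ φ : E3 → ℝ → ℝ, IsTest R φ → (∀ x t, 0 ≤ φ x t) →
      ∀ᵐ t ∂(volume.restrict (Ioo (-(R^2)) 0)),
        (∫ x in ball (0 : E3) R, ‖u x t‖ ^ 2 * φ x t)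
          + 2 * ∫ s in Ioo (-(R^2)) t, ∫ x in ball (0 : E3) R,
              (∑ i : Fin 3, ∑ j : Fin 3, (gu x s i j) ^ 2) * φ x s
        ≤ (∫ s in Ioo (-(R^2)) t, ∫ x in ball (0 : E3) R,
              ‖u x s‖ ^ 2 * (deriv (fun τ => φ x τ) s + lap (fun y => φ y s) x))
          + ∫ s in Ioo (-(R^2)) t, ∫ x in ball (0 : E3) R,
              (∑ i : Fin 3, u x s i * pd i (fun y => φ y s) x) * (‖u x s‖ ^ 2 + 2 * P x s)

/-- `(0,0)` is a regular point of `u`: `u` is essentially bounded on some `Q(r)`, `r > 0`. -/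
def RegularPoint (u : E3 → ℝ → E3) : Prop :=
  ∃ r > (0 : ℝ), ∃ M : ℝ,
    ∀ᵐ z : E3 × ℝ ∂(volume.restrict ((ball (0 : E3) r) ×ˢ (Ioo (-(r^2)) 0))),
      ‖u z.1 z.2‖ ≤ M

/-- `E(r) = sup_{−r²≤t<0} r⁻¹ ∫_{B(r)} |u|² dx` (essential supremum in time). -/
def energyE (r : ℝ) (u : E3 → ℝ → E3) : ℝ≥0∞ :=
  essSup (fun t => (ENNReal.ofReal r)⁻¹ *
      ∫⁻ x in ball (0 : E3) r, ((‖u x t‖₊ : ℝ≥0∞)) ^ 2)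
    (volume.restrict (Ioo (-(r^2)) 0))

/-- `E_*(r) = r⁻¹ ∬_{Q(r)} |∇u|² dx dt`. -/
def energyEstar (r : ℝ) (gu : E3 → ℝ → Fin 3 → Fin 3 → ℝ) : ℝ≥0∞ :=
  (ENNReal.ofReal r)⁻¹ * ∫⁻ t in Ioo (-(r^2)) 0, ∫⁻ x in ball (0 : E3) r,
      ENNReal.ofReal (∑ i : Fin 3, ∑ j : Fin 3, (gu x t i j) ^ 2)

/-- `E₃(r) = r⁻² ∬_{Q(r)} |u|³ dx dt`. -/
def energyE3 (r : ℝ) (u : E3 → ℝ → E3) : ℝ≥0∞ :=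
  ((ENNReal.ofReal r) ^ 2)⁻¹ * ∫⁻ t in Ioo (-(r^2)) 0, ∫⁻ x in ball (0 : E3) r,
      ((‖u x t‖₊ : ℝ≥0∞)) ^ 3

/-- `E_{p,q⃗}(r) = r⁻¹ ‖u − ū_r‖_{L^p_t L^{q⃗}_x(Q(r))}`. -/
def energyEpq (p : ℝ≥0∞) (q1 q2 q3 r : ℝ) (u : E3 → ℝ → E3) : ℝ≥0∞ :=
  (ENNReal.ofReal r)⁻¹ *
    mixedNorm p q1 q2 q3 r (fun x t => ‖u x t - ⨍ y in ball (0 : E3) r, u y t‖)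

/-- `D_{3/2}(r) = r⁻² ∬_{Q(r)} |Π − Π̄_r|^{3/2} dx dt`. -/
def energyD32 (r : ℝ) (P : E3 → ℝ → ℝ) : ℝ≥0∞ :=
  ((ENNReal.ofReal r) ^ 2)⁻¹ * ∫⁻ t in Ioo (-(r^2)) 0, ∫⁻ x in ball (0 : E3) r,
      (ENNReal.ofReal |P x t - ⨍ y in ball (0 : E3) r, P y t|) ^ (3/2 : ℝ)

/-! ### Mixed norms and Hölder -/

/-- One-variable `L^{1/a}` norm. -/
def nP (a : ℝ) (f : ℝ → ℝ≥0∞) : ℝ≥0∞ := (∫⁻ x, f x ^ (1 / a)) ^ a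

/-- Mixed norm with reciprocals as exponents. -/
def nN (a1 a2 a3 : ℝ) (F : ℝ → ℝ → ℝ → ℝ≥0∞) : ℝ≥0∞ :=
  nP a3 (fun x3 => nP a2 (fun x2 => nP a1 (fun x1 => F x1 x2 x3)))

lemma nP_mono {a : ℝ} (ha : 0 < a) {f g : ℝ → ℝ≥0∞} (h : ∀ x, f x ≤ g x) : nP a f ≤ nP a g := by
  unfold nP
  exact ENNReal.rpow_le_rpow (lintegral_mono fun x => ENNReal.rpow_le_rpow (h x) (by positivity))
    ha.le

lemma nN_mono {a1 a2 a3 : ℝ} (h1 : 0 < a1) (h2 : 0 < a2) (h3 : 0 < a3)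
    {F G : ℝ → ℝ → ℝ → ℝ≥0∞} (h : ∀ x y z, F x y z ≤ G x y z) :
    nN a1 a2 a3 F ≤ nN a1 a2 a3 G :=
  nP_mono h3 fun _ => nP_mono h2 fun _ => nP_mono h1 fun _ => h _ _ _

lemma nP_holder {a ν : ℝ} (ha : 0 < a) (hν : 0 ≤ ν) {f m : ℝ → ℝ≥0∞}
    (hf : Measurable f) (hm : Measurable m) :
    nP (a + ν) (fun x => f x * m x ^ ν) ≤ nP a f * (∫⁻ x, m x) ^ ν := by
  unfold nP
  have hs : 0 < a + ν := by linarith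
  have h := ENNReal.lintegral_mul_norm_pow_le (μ := volume) (f := fun x => f x ^ (1 / a)) (g := m)
    (hf.pow_const _).aemeasurable hm.aemeasurable (p := a / (a + ν)) (q := ν / (a + ν))
    (by positivity) (by positivity) (by field_simp)
  have e : ∀ x, (f x * m x ^ ν) ^ (1 / (a + ν))
      = (f x ^ (1 / a)) ^ (a / (a + ν)) * m x ^ (ν / (a + ν)) := by
    intro x
    rw [ENNReal.mul_rpow_of_nonneg _ _ (by positivity), ← ENNReal.rpow_mul, ← ENNReal.rpow_mul]
    congr 2
    · field_simp
    · field_simp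
  simp_rw [e]
  refine (ENNReal.rpow_le_rpow h hs.le).trans ?_
  rw [ENNReal.mul_rpow_of_nonneg _ _ hs.le, ← ENNReal.rpow_mul, ← ENNReal.rpow_mul]
  apply le_of_eq
  congr 2
  · field_simp
  · field_simp

lemma nP_mul_const {a : ℝ} (ha : 0 < a) {f : ℝ → ℝ≥0∞} (hf : Measurable f) (c : ℝ≥0∞) :
    nP a (fun x => f x * c) = nP a f * c := by
  unfold nP
  simp_rw [ENNReal.mul_rpow_of_nonneg _ c (show 0 ≤ 1 / a by positivity)]
  rw [lintegral_mul_const _ (hf.pow_const _), ENNReal.mul_rpow_of_nonneg _ _ ha.le,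
    ← ENNReal.rpow_mul]
  simp [ha.ne']

/-- Joint measurability of a function of three variables. -/
def M3 (F : ℝ → ℝ → ℝ → ℝ≥0∞) : Prop := Measurable (fun p : ℝ × ℝ × ℝ => F p.1 p.2.1 p.2.2)

lemma M3.x1 {F : ℝ → ℝ → ℝ → ℝ≥0∞} (h : M3 F) (x2 x3 : ℝ) : Measurable (fun x1 => F x1 x2 x3) :=
  h.comp (g := fun p : ℝ × ℝ × ℝ => F p.1 p.2.1 p.2.2) (f := fun x => (x, x2, x3)) (by fun_prop)

lemma meas_nP {α : Type*} [MeasurableSpace α] {F : α → ℝ → ℝ≥0∞} (a : ℝ)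
    (h : Measurable (fun p : α × ℝ => F p.1 p.2)) : Measurable (fun x => nP a (F x)) := by
  unfold nP
  exact ((h.pow_const _).lintegral_prod_right').pow_const _

lemma M3.p1 {F : ℝ → ℝ → ℝ → ℝ≥0∞} (h : M3 F) (a : ℝ) :
    Measurable (fun p : ℝ × ℝ => nP a (fun x1 => F x1 p.1 p.2)) := by
  apply meas_nP (F := fun (p : ℝ × ℝ) x1 => F x1 p.1 p.2)
  exact h.comp (g := fun p : ℝ × ℝ × ℝ => F p.1 p.2.1 p.2.2)
    (f := fun q : (ℝ × ℝ) × ℝ => (q.2, q.1.1, q.1.2)) (by fun_prop)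

lemma M3.p1' {F : ℝ → ℝ → ℝ → ℝ≥0∞} (h : M3 F) (a x3 : ℝ) :
    Measurable (fun x2 : ℝ => nP a (fun x1 => F x1 x2 x3)) :=
  (h.p1 a).comp (g := fun p : ℝ × ℝ => nP a (fun x1 => F x1 p.1 p.2))
    (f := fun x => (x, x3)) (by fun_prop)

lemma M3.p2 {F : ℝ → ℝ → ℝ → ℝ≥0∞} (h : M3 F) (a b : ℝ) :
    Measurable (fun x3 : ℝ => nP b (fun x2 => nP a (fun x1 => F x1 x2 x3))) := by
  apply meas_nP (F := fun x3 x2 => nP a (fun x1 => F x1 x2 x3))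
  exact (h.p1 a).comp (g := fun p : ℝ × ℝ => nP a (fun x1 => F x1 p.1 p.2))
    (f := fun q : ℝ × ℝ => (q.2, q.1)) (by fun_prop)

lemma nP_holder' {a v l : ℝ} (ha : 0 < a) (hv : 0 < v) (hl : 0 ≤ l) {f g : ℝ → ℝ≥0∞}
    (hf : Measurable f) (hg : Measurable g) :
    nP (a + l * v) (fun x => f x * g x ^ l) ≤ nP a f * nP v g ^ l := by
  have h := nP_holder ha (mul_nonneg hl hv.le) hf (hg.pow_const (1 / v))
  have e : ∀ x, (g x ^ (1 / v)) ^ (l * v) = g x ^ l := by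
    intro x; rw [← ENNReal.rpow_mul]; congr 1; field_simp
  simp_rw [e] at h
  refine h.trans (le_of_eq ?_)
  unfold nP
  rw [← ENNReal.rpow_mul]
  congr 2
  ring

lemma nN_holder {a1 a2 a3 v1 v2 v3 l : ℝ} (ha1 : 0 < a1) (ha2 : 0 < a2) (ha3 : 0 < a3)
    (hv1 : 0 < v1) (hv2 : 0 < v2) (hv3 : 0 < v3) (hl : 0 ≤ l) {F G : ℝ → ℝ → ℝ → ℝ≥0∞}
    (hF : M3 F) (hG : M3 G) :
    nN (a1 + l * v1) (a2 + l * v2) (a3 + l * v3) (fun x y z => F x y z * G x y z ^ l)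
      ≤ nN a1 a2 a3 F * nN v1 v2 v3 G ^ l := by
  unfold nN
  have p3 : 0 < a3 + l * v3 := by positivity
  have p2 : 0 < a2 + l * v2 := by positivity
  refine le_trans (nP_mono p3 fun x3 => ?_) (nP_holder' ha3 hv3 hl (hF.p2 a1 a2) (hG.p2 v1 v2))
  refine le_trans (nP_mono p2 fun x2 => ?_)
    (nP_holder' ha2 hv2 hl (hF.p1' a1 x3) (hG.p1' v1 x3))
  exact nP_holder' ha1 hv1 hl (hF.x1 x2 x3) (hG.x1 x2 x3)

lemma nN_holder_m1 {a1 a2 a3 l : ℝ} (ha1 : 0 < a1) (ha2 : 0 < a2) (ha3 : 0 < a3)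
    (hl : 0 ≤ l) {F : ℝ → ℝ → ℝ → ℝ≥0∞} {m : ℝ → ℝ → ℝ≥0∞}
    (hF : M3 F) (hm : Measurable (fun p : ℝ × ℝ => m p.1 p.2)) :
    nN a1 (a2 + l) (a3 + l) (fun x y z => F x y z * m y z ^ l)
      ≤ nN a1 a2 a3 F * (∫⁻ z, ∫⁻ y, m y z) ^ l := by
  unfold nN
  have p3 : 0 < a3 + l := by positivity
  have hm' : Measurable (fun p : ℝ × ℝ => m p.2 p.1) :=
    hm.comp (g := fun p : ℝ × ℝ => m p.1 p.2) (f := fun p : ℝ × ℝ => (p.2, p.1)) (by fun_prop)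
  have hm1 : Measurable (fun z => ∫⁻ y, m y z) := hm'.lintegral_prod_right'
  refine le_trans (nP_mono p3 fun x3 => ?_) (nP_holder ha3 hl (hF.p2 a1 a2) hm1)
  simp_rw [nP_mul_const ha1 (hF.x1 _ x3)]
  exact nP_holder ha2 hl (hF.p1' a1 x3) (hm.of_uncurry_right (y := x3))

lemma nN_holder_m2 {a1 a2 a3 l : ℝ} (ha1 : 0 < a1) (ha2 : 0 < a2) (ha3 : 0 < a3)
    (hl : 0 ≤ l) {F : ℝ → ℝ → ℝ → ℝ≥0∞} {m : ℝ → ℝ → ℝ≥0∞}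
    (hF : M3 F) (hm : Measurable (fun p : ℝ × ℝ => m p.1 p.2)) :
    nN (a1 + l) a2 (a3 + l) (fun x y z => F x y z * m x z ^ l)
      ≤ nN a1 a2 a3 F * (∫⁻ z, ∫⁻ x, m x z) ^ l := by
  unfold nN
  have p3 : 0 < a3 + l := by positivity
  have hm' : Measurable (fun p : ℝ × ℝ => m p.2 p.1) :=
    hm.comp (g := fun p : ℝ × ℝ => m p.1 p.2) (f := fun p : ℝ × ℝ => (p.2, p.1)) (by fun_prop)
  have hm1 : Measurable (fun z => ∫⁻ y, m y z) := hm'.lintegral_prod_right'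
  refine le_trans (nP_mono p3 fun x3 => ?_) (nP_holder ha3 hl (hF.p2 a1 a2) hm1)
  rw [← nP_mul_const ha2 (hF.p1' a1 x3)]
  refine nP_mono ha2 fun x2 => ?_
  exact nP_holder ha1 hl (hF.x1 x2 x3) (hm.of_uncurry_right (y := x3))

lemma nN_holder_m3 {a1 a2 a3 l : ℝ} (ha1 : 0 < a1) (ha2 : 0 < a2) (ha3 : 0 < a3)
    (hl : 0 ≤ l) {F : ℝ → ℝ → ℝ → ℝ≥0∞} {m : ℝ → ℝ → ℝ≥0∞}
    (hF : M3 F) (hm : Measurable (fun p : ℝ × ℝ => m p.1 p.2)) :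
    nN (a1 + l) (a2 + l) a3 (fun x y z => F x y z * m x y ^ l)
      ≤ nN a1 a2 a3 F * (∫⁻ y, ∫⁻ x, m x y) ^ l := by
  unfold nN
  have p2 : 0 < a2 + l := by positivity
  have hm' : Measurable (fun p : ℝ × ℝ => m p.2 p.1) :=
    hm.comp (g := fun p : ℝ × ℝ => m p.1 p.2) (f := fun p : ℝ × ℝ => (p.2, p.1)) (by fun_prop)
  have hm1 : Measurable (fun z => ∫⁻ y, m y z) := hm'.lintegral_prod_right'
  rw [← nP_mul_const ha3 (hF.p2 a1 a2)]
  refine nP_mono ha3 fun x3 => ?_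
  refine le_trans (nP_mono p2 fun x2 => ?_) (nP_holder ha2 hl (hF.p1' a1 x3) hm1)
  exact nP_holder ha1 hl (hF.x1 x2 x3) (hm.of_uncurry_right (y := x2))

/-- Minkowski's integral inequality. -/
lemma minkowski {α β : Type*} [MeasurableSpace α] [MeasurableSpace β] (μ : Measure α)
    (ν : Measure β) [SigmaFinite μ] [SigmaFinite ν] {F : α → β → ℝ≥0∞}
    (hF : Measurable (fun p : α × β => F p.1 p.2)) {m : ℝ} (hm : 1 ≤ m) :
    ∫⁻ y, (∫⁻ x, F x y ∂μ) ^ m ∂ν ≤ (∫⁻ x, (∫⁻ y, F x y ^ m ∂ν) ^ (1 / m) ∂μ) ^ m := by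
  classical
  have hm0 : 0 < m := by linarith
  rcases hm.eq_or_lt with rfl | hm1
  · simp only [ENNReal.rpow_one, div_one]
    rw [lintegral_lintegral_swap]
    exact (hF.comp measurable_swap).aemeasurable
  have hF' : Measurable (fun p : β × α => F p.2 p.1) := hF.comp measurable_swap
  set Φ : β → ℝ≥0∞ := fun y => ∫⁻ x, F x y ∂μ with hΦ
  have mΦ : Measurable Φ := hF'.lintegral_prod_right'
  set R : ℝ≥0∞ := ∫⁻ x, (∫⁻ y, F x y ^ m ∂ν) ^ (1 / m) ∂μ with hR
  set S := spanningSets ν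
  set Ψ : ℕ → β → ℝ≥0∞ := fun n => (S n).indicator (fun y => min (Φ y) n) with hΨ
  have mΨ : ∀ n, Measurable (Ψ n) := fun n =>
    (mΦ.min measurable_const).indicator (measurableSet_spanningSets ν n)
  have key : ∀ n, ∫⁻ y, Ψ n y ^ m ∂ν ≤ R ^ m := by
    intro n
    set T := ∫⁻ y, Ψ n y ^ m ∂ν with hT
    have Tfin : T ≠ ∞ := by
      have : T ≤ ∫⁻ y, (S n).indicator (fun _ => (n : ℝ≥0∞) ^ m) y ∂ν := by
        refine lintegral_mono fun y => ?_
        simp only [hΨ, Set.indicator_apply]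
        split_ifs
        · exact ENNReal.rpow_le_rpow (min_le_right _ _) hm0.le
        · simp [hm0]
      refine ne_top_of_le_ne_top ?_ this
      rw [lintegral_indicator (measurableSet_spanningSets ν n), lintegral_const]
      refine ENNReal.mul_ne_top ?_ ?_
      · exact ENNReal.rpow_ne_top_of_nonneg hm0.le (by simp)
      · simpa using (measure_spanningSets_lt_top ν n).ne
    have hle : ∀ y, Ψ n y ≤ Φ y := by
      intro y
      simp only [hΨ, Set.indicator_apply]
      split_ifs
      · exact min_le_left _ _
      · simp
    have h1 : T ≤ R * T ^ (1 - 1 / m) := by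
      calc T = ∫⁻ y, Ψ n y * Ψ n y ^ (m - 1) ∂ν := by
            refine lintegral_congr fun y => ?_
            have : Ψ n y ≠ ∞ := by
              simp only [hΨ, Set.indicator_apply]
              split_ifs
              · exact ne_top_of_le_ne_top (by simp) (min_le_right _ _)
              · simp
            rcases eq_or_ne (Ψ n y) 0 with h0 | h0
            · simp [h0, hm0]
            · rw [ENNReal.rpow_sub _ _ h0 this, ENNReal.rpow_one, ENNReal.mul_div_cancel h0 this]
        _ ≤ ∫⁻ y, Φ y * Ψ n y ^ (m - 1) ∂ν := lintegral_mono fun y => by gcongr; exact hle y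
        _ = ∫⁻ y, ∫⁻ x, F x y * Ψ n y ^ (m - 1) ∂μ ∂ν := by
            refine lintegral_congr fun y => ?_
            rw [lintegral_mul_const]
            exact hF.of_uncurry_right
        _ = ∫⁻ x, ∫⁻ y, F x y * Ψ n y ^ (m - 1) ∂ν ∂μ := by
            rw [lintegral_lintegral_swap]
            refine Measurable.aemeasurable ?_
            exact hF'.mul (((mΨ n).comp measurable_fst).pow_const _)
        _ ≤ ∫⁻ x, (∫⁻ y, F x y ^ m ∂ν) ^ (1 / m) * T ^ (1 - 1 / m) ∂μ := by
            refine lintegral_mono fun x => ?_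
            have := ENNReal.lintegral_mul_norm_pow_le (μ := ν) (f := fun y => F x y ^ m)
              (g := fun y => Ψ n y ^ m) ((hF.of_uncurry_left (x := x)).pow_const _).aemeasurable
              ((mΨ n).pow_const _).aemeasurable (p := 1 / m) (q := 1 - 1 / m) (by positivity)
              (by rw [sub_nonneg, div_le_one hm0]; exact hm) (by ring)
            refine le_trans (le_of_eq ?_) this
            refine lintegral_congr fun y => ?_
            rw [← ENNReal.rpow_mul, ← ENNReal.rpow_mul]
            have e1 : m * (1 / m) = 1 := by field_simp
            have e2 : m * (1 - 1 / m) = m - 1 := by field_simp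
            rw [e1, e2, ENNReal.rpow_one]
        _ = R * T ^ (1 - 1 / m) := by
            rw [lintegral_mul_const]
            exact ((hF.pow_const _).lintegral_prod_right').pow_const _
    rcases eq_or_ne T 0 with h0 | h0
    · rw [h0]; simp
    · have h2 : T ^ (1 / m) ≤ R := by
        rw [ENNReal.rpow_sub _ _ h0 Tfin, ENNReal.rpow_one, ← mul_div_assoc] at h1
        have a0 : T ^ (1 / m) ≠ 0 := by simp [h0, hm0.le, Tfin]
        have at' : T ^ (1 / m) ≠ ∞ := ENNReal.rpow_ne_top_of_nonneg (by positivity) Tfin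
        rw [ENNReal.le_div_iff_mul_le (Or.inl a0) (Or.inl at'), mul_comm R] at h1
        exact (ENNReal.mul_le_mul_iff_right h0 Tfin).1 h1
      have := ENNReal.rpow_le_rpow h2 hm0.le
      rwa [← ENNReal.rpow_mul, one_div_mul_cancel hm0.ne', ENNReal.rpow_one] at this
  have hsup : ∀ y, Φ y ^ m = ⨆ n, Ψ n y ^ m := by
    intro y
    have mono : Monotone (fun n => Ψ n y) := by
      intro n k hnk
      simp only [hΨ, Set.indicator_apply]
      split_ifs with h1 h2
      · exact min_le_min le_rfl (by exact_mod_cast hnk)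
      · exact absurd (monotone_spanningSets ν hnk h1) h2
      · simp
      · simp
    have e : Φ y = ⨆ n, Ψ n y := by
      apply le_antisymm
      · obtain ⟨k, hk⟩ : ∃ k, y ∈ S k := by
          have : y ∈ ⋃ i, S i := by rw [iUnion_spanningSets]; trivial
          simpa using this
        apply le_of_forall_lt
        intro c hc
        obtain ⟨j, hj⟩ := ENNReal.exists_nat_gt (ne_top_of_lt hc)
        refine lt_of_lt_of_le ?_ (le_iSup _ (max j k))
        have hy : y ∈ S (max j k) := monotone_spanningSets ν (le_max_right j k) hk
        simp only [hΨ, Set.indicator_of_mem hy]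
        refine lt_min hc (hj.trans_le ?_)
        exact_mod_cast le_max_left j k
      · refine iSup_le fun n => ?_
        simp only [hΨ, Set.indicator_apply]
        split_ifs
        · exact min_le_left _ _
        · simp
    rw [e]
    exact (ENNReal.monotone_rpow_of_nonneg hm0.le).map_iSup_of_continuousAt
      (ENNReal.continuous_rpow_const.continuousAt) (by simp [hm0])
  calc ∫⁻ y, Φ y ^ m ∂ν = ∫⁻ y, ⨆ n, Ψ n y ^ m ∂ν := lintegral_congr hsup
    _ = ⨆ n, ∫⁻ y, Ψ n y ^ m ∂ν := by
        rw [lintegral_iSup (fun n => (mΨ n).pow_const _)]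
        intro n k hnk y
        refine ENNReal.rpow_le_rpow ?_ hm0.le
        simp only [hΨ, Set.indicator_apply]
        split_ifs with h1 h2
        · exact min_le_min le_rfl (by exact_mod_cast hnk)
        · exact absurd (monotone_spanningSets ν hnk h1) h2
        · simp
        · simp
    _ ≤ R ^ m := iSup_le key

/-! ### Abstract anisotropic Gagliardo-Nirenberg inequality -/

lemma M3.swap13 {F : ℝ → ℝ → ℝ → ℝ≥0∞} (h : M3 F) : M3 (fun x y z => F z y x) :=
  h.comp (g := fun p : ℝ × ℝ × ℝ => F p.1 p.2.1 p.2.2)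
    (f := fun q : ℝ × ℝ × ℝ => (q.2.2, q.2.1, q.1)) (by fun_prop)

lemma M3.swap23 {F : ℝ → ℝ → ℝ → ℝ≥0∞} (h : M3 F) : M3 (fun x y z => F x z y) :=
  h.comp (g := fun p : ℝ × ℝ × ℝ => F p.1 p.2.1 p.2.2)
    (f := fun q : ℝ × ℝ × ℝ => (q.1, q.2.2, q.2.1)) (by fun_prop)

lemma M3.slice3 {F : ℝ → ℝ → ℝ → ℝ≥0∞} (h : M3 F) (z : ℝ) :
    Measurable (fun p : ℝ × ℝ => F p.1 p.2 z) :=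
  h.comp (g := fun p : ℝ × ℝ × ℝ => F p.1 p.2.1 p.2.2)
    (f := fun q : ℝ × ℝ => (q.1, q.2, z)) (by fun_prop)

lemma M3.int1 {F : ℝ → ℝ → ℝ → ℝ≥0∞} (h : M3 F) :
    Measurable (fun p : ℝ × ℝ => ∫⁻ x, F x p.1 p.2) := by
  apply Measurable.lintegral_prod_right' (f := fun q : (ℝ × ℝ) × ℝ => F q.2 q.1.1 q.1.2)
  exact h.comp (g := fun p : ℝ × ℝ × ℝ => F p.1 p.2.1 p.2.2)
    (f := fun q : (ℝ × ℝ) × ℝ => (q.2, q.1.1, q.1.2)) (by fun_prop)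

lemma M3.int12 {F : ℝ → ℝ → ℝ → ℝ≥0∞} (h : M3 F) :
    Measurable (fun z : ℝ => ∫⁻ y, ∫⁻ x, F x y z) := by
  apply Measurable.lintegral_prod_right' (f := fun q : ℝ × ℝ => ∫⁻ x, F x q.2 q.1)
  exact h.int1.comp (g := fun p : ℝ × ℝ => ∫⁻ x, F x p.1 p.2)
    (f := fun q : ℝ × ℝ => (q.2, q.1)) (by fun_prop)

/-- triple integral -/
def I3 (F : ℝ → ℝ → ℝ → ℝ≥0∞) : ℝ≥0∞ := ∫⁻ z, ∫⁻ y, ∫⁻ x, F x y z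

lemma swap2 {F : ℝ → ℝ → ℝ≥0∞} (h : Measurable (fun p : ℝ × ℝ => F p.1 p.2)) :
    ∫⁻ y, ∫⁻ x, F x y = ∫⁻ x, ∫⁻ y, F x y := by
  rw [lintegral_lintegral_swap]
  exact (h.comp measurable_swap).aemeasurable

lemma I3_swap12 {F : ℝ → ℝ → ℝ → ℝ≥0∞} (h : M3 F) : I3 (fun x y z => F y x z) = I3 F := by
  unfold I3
  refine lintegral_congr fun z => ?_
  exact (swap2 (h.slice3 z)).symm

lemma I3_swap23 {F : ℝ → ℝ → ℝ → ℝ≥0∞} (h : M3 F) : I3 (fun x y z => F x z y) = I3 F := by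
  unfold I3
  exact (swap2 (F := fun y z => ∫⁻ x, F x y z) h.int1).symm

lemma I3_swap13 {F : ℝ → ℝ → ℝ → ℝ≥0∞} (h : M3 F) : I3 (fun x y z => F z y x) = I3 F := by
  have h1 : M3 (fun x y z => F y x z) := h.swap13.swap23.swap13
  have h2 : M3 (fun x y z => F z x y) := h1.swap23
  calc I3 (fun x y z => F z y x) = I3 (fun x y z => F z x y) := I3_swap12 h2
    _ = I3 (fun x y z => F y x z) := I3_swap23 h1
    _ = I3 F := I3_swap12 h

/-- line inequality in the first variable -/
def L1 (F D : ℝ → ℝ → ℝ → ℝ≥0∞) : Prop :=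
  ∀ (k : ℕ) (x y z : ℝ), F x y z ^ (k + 1) ≤ (k + 1) * ∫⁻ x', F x' y z ^ k * D x' y z
def L2 (F D : ℝ → ℝ → ℝ → ℝ≥0∞) : Prop :=
  ∀ (k : ℕ) (x y z : ℝ), F x y z ^ (k + 1) ≤ (k + 1) * ∫⁻ y', F x y' z ^ k * D x y' z
def L3 (F D : ℝ → ℝ → ℝ → ℝ≥0∞) : Prop :=
  ∀ (k : ℕ) (x y z : ℝ), F x y z ^ (k + 1) ≤ (k + 1) * ∫⁻ z', F x y z' ^ k * D x y z'

lemma cs {α : Type*} [MeasurableSpace α] (μ : Measure α) {f g : α → ℝ≥0∞} (hf : Measurable f)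
    (hg : Measurable g) : (∫⁻ x, f x * g x ∂μ) ^ 2 ≤ (∫⁻ x, f x ^ 2 ∂μ) * ∫⁻ x, g x ^ 2 ∂μ := by
  have h := ENNReal.lintegral_mul_norm_pow_le (μ := μ) (f := fun x => f x ^ 2)
    (g := fun x => g x ^ 2) (hf.pow_const _).aemeasurable (hg.pow_const _).aemeasurable
    (p := 1 / 2) (q := 1 / 2) (by norm_num) (by norm_num) (by norm_num)
  have e : ∀ a : ℝ≥0∞, (a ^ 2) ^ (1 / 2 : ℝ) = a := by
    intro a
    rw [← ENNReal.rpow_natCast, ← ENNReal.rpow_mul]; norm_num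
  have e' : ∀ a : ℝ≥0∞, (a ^ (1 / 2 : ℝ)) ^ 2 = a := by
    intro a
    rw [← ENNReal.rpow_natCast, ← ENNReal.rpow_mul]; norm_num
  simp_rw [e] at h
  calc _ ≤ _ := pow_le_pow_left₀ (by simp) h 2
    _ = _ := by rw [mul_pow, e', e']

lemma two_dim {F D : ℝ → ℝ → ℝ → ℝ≥0∞} (hF : M3 F) (hD : M3 D) (h1 : L1 F D) (h2 : L2 F D)
    (k : ℕ) (z : ℝ) :
    ∫⁻ y, ∫⁻ x, F x y z ^ (2 * (k + 1)) ≤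
      (k + 1) ^ 2 * (∫⁻ y, ∫⁻ x, F x y z ^ (2 * k)) * ∫⁻ y, ∫⁻ x, D x y z ^ 2 := by
  have mFz := hF.slice3 z
  have mDz := hD.slice3 z
  have mG : Measurable (fun p : ℝ × ℝ => F p.1 p.2 z ^ k * D p.1 p.2 z) := (mFz.pow_const k).mul mDz
  have mG' : Measurable (fun p : ℝ × ℝ => F p.2 p.1 z ^ k * D p.2 p.1 z) := mG.comp measurable_swap
  set G : ℝ → ℝ → ℝ≥0∞ := fun x y => F x y z ^ k * D x y z with hG
  have mA : Measurable (fun y => ∫⁻ x, G x y) := mG'.lintegral_prod_right'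
  have mB : Measurable (fun x => ∫⁻ y, G x y) := mG.lintegral_prod_right'
  have s1 : ∫⁻ y, ∫⁻ x, F x y z ^ (2 * (k + 1)) ≤
      ∫⁻ y, ∫⁻ x, ((k + 1) * ∫⁻ x', G x' y) * ((k + 1) * ∫⁻ y', G x y') := by
    refine lintegral_mono fun y => lintegral_mono fun x => ?_
    rw [two_mul, pow_add]
    exact mul_le_mul' (h1 k x y z) (h2 k x y z)
  have s2 : ∫⁻ y, ∫⁻ x, ((k + 1 : ℝ≥0∞) * ∫⁻ x', G x' y) * ((k + 1) * ∫⁻ y', G x y')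
      = ((k + 1) * ∫⁻ y, ∫⁻ x, G x y) ^ 2 := by
    have : ∀ y, ∫⁻ x, ((k + 1 : ℝ≥0∞) * ∫⁻ x', G x' y) * ((k + 1) * ∫⁻ y', G x y')
       = ((k + 1 : ℝ≥0∞) * ∫⁻ x', G x' y) * ((k + 1) * ∫⁻ x, ∫⁻ y', G x y') := by
      intro y
      rw [lintegral_const_mul _ (mB.const_mul _), lintegral_const_mul _ mB]
    simp_rw [this]
    rw [lintegral_mul_const _ (mA.const_mul _), lintegral_const_mul _ mA, ← swap2 (F := G) mG, sq]
  rw [s2] at s1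
  refine s1.trans ?_
  rw [mul_pow, mul_assoc]
  gcongr
  have e : ∀ f : ℝ → ℝ → ℝ≥0∞, Measurable (fun p : ℝ × ℝ => f p.1 p.2) →
      ∫⁻ y, ∫⁻ x, f x y = ∫⁻ p : ℝ × ℝ, f p.1 p.2 := by
    intro f hf
    rw [swap2 hf]
    exact (lintegral_prod _ hf.aemeasurable).symm
  rw [e _ mG, e _ (mFz.pow_const _), e _ (mDz.pow_const _)]
  refine (cs volume (mFz.pow_const k) mDz).trans (le_of_eq ?_)
  simp_rw [← pow_mul, mul_comm k 2]

lemma M3.pow {F : ℝ → ℝ → ℝ → ℝ≥0∞} (h : M3 F) (n : ℕ) : M3 (fun x y z => F x y z ^ n) :=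
  Measurable.pow_const h n

lemma vert_pt (k : ℕ) : ∃ c : NNReal, ∀ F D : ℝ → ℝ → ℝ → ℝ≥0∞, M3 F → M3 D → L1 F D → L2 F D →
    ∀ z, ∫⁻ y, ∫⁻ x, F x y z ^ (2 * (k + 3)) ≤
      c * (∫⁻ y, ∫⁻ x, F x y z ^ 6) * (∫⁻ y, ∫⁻ x, D x y z ^ 2) ^ k := by
  induction k with
  | zero => exact ⟨1, fun F D _ _ _ _ z => by simp⟩
  | succ k ih =>
    obtain ⟨c, hc⟩ := ih
    refine ⟨(k + 3 + 1) ^ 2 * c, fun F D hF hD h1 h2 z => ?_⟩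
    refine (two_dim hF hD h1 h2 (k + 3) z).trans ?_
    have := hc F D hF hD h1 h2 z
    calc _ ≤ ((k + 3 : ℕ) + 1 : ℝ≥0∞) ^ 2 * (c * (∫⁻ y, ∫⁻ x, F x y z ^ 6) *
          (∫⁻ y, ∫⁻ x, D x y z ^ 2) ^ k) * (∫⁻ y, ∫⁻ x, D x y z ^ 2) := by gcongr
      _ = _ := by push_cast; ring

lemma vert (K : NNReal) (k : ℕ) : ∃ c : NNReal, ∀ F D : ℝ → ℝ → ℝ → ℝ≥0∞, M3 F → M3 D →
    L1 F D → L2 F D → I3 (fun x y z => F x y z ^ 6) ≤ K * I3 (fun x y z => D x y z ^ 2) ^ 3 →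
    (∫⁻ z, (∫⁻ y, ∫⁻ x, F x y z ^ (2 * (k + 3))) ^ (1 / ((k : ℝ) + 1))) ^
      (((k : ℝ) + 1) / (k + 3)) ≤ c * I3 (fun x y z => D x y z ^ 2) := by
  obtain ⟨c, hc⟩ := vert_pt k
  refine ⟨(c * K) ^ (1 / ((k : ℝ) + 3)), fun F D hF hD h1 h2 hS => ?_⟩
  set T := I3 (fun x y z => D x y z ^ 2) with hT
  have k1 : (0 : ℝ) < k + 1 := by positivity
  have k3 : (0 : ℝ) < k + 3 := by positivity
  have st : ∫⁻ z, (∫⁻ y, ∫⁻ x, F x y z ^ (2 * (k + 3))) ^ (1 / ((k : ℝ) + 1)) ≤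
      ((c : ℝ≥0∞) * I3 (fun x y z => F x y z ^ 6)) ^ (1 / ((k : ℝ) + 1)) * T ^ (k / ((k : ℝ) + 1)) := by
    have h := ENNReal.lintegral_mul_norm_pow_le (μ := volume)
      (f := fun z => c * (∫⁻ y, ∫⁻ x, F x y z ^ 6))
      (g := fun z => (∫⁻ y, ∫⁻ x, D x y z ^ 2)) ((hF.pow 6).int12.const_mul _).aemeasurable
      (hD.pow 2).int12.aemeasurable
      (p := 1 / ((k : ℝ) + 1)) (q := k / ((k : ℝ) + 1)) (by positivity) (by positivity)
      (by field_simp; ring)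
    rw [lintegral_const_mul _ (hF.pow 6).int12] at h
    refine le_trans (lintegral_mono fun z => ?_) h
    refine (ENNReal.rpow_le_rpow (hc F D hF hD h1 h2 z) (by positivity)).trans (le_of_eq ?_)
    rw [ENNReal.mul_rpow_of_nonneg _ _ (by positivity), ← ENNReal.rpow_natCast,
      ← ENNReal.rpow_mul]
    congr 2
    ring
  have st2 := st.trans (mul_le_mul' (ENNReal.rpow_le_rpow (mul_le_mul' le_rfl hS)
    (by positivity : 0 ≤ 1 / ((k : ℝ) + 1))) le_rfl)
  refine (ENNReal.rpow_le_rpow st2 (by positivity)).trans (le_of_eq ?_)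
  rw [← mul_assoc, ENNReal.mul_rpow_of_nonneg _ _ (by positivity), ENNReal.mul_rpow_of_nonneg _ _ (by positivity),
    ENNReal.mul_rpow_of_nonneg _ _ (by positivity), mul_assoc, ← ENNReal.rpow_natCast,
    ← ENNReal.rpow_mul, ← ENNReal.rpow_mul, ← ENNReal.rpow_mul, ← ENNReal.rpow_mul,
    ← ENNReal.rpow_add_of_nonneg _ _ (by positivity) (by positivity)]
  congr 1
  · rw [ENNReal.coe_rpow_of_nonneg _ (by positivity)]
    push_cast
    congr 1
    field_simp
  · have : ((3 : ℕ) : ℝ) * (1 / ((k : ℝ) + 1)) * (((k : ℝ) + 1) / (k + 3)) +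
        k / ((k : ℝ) + 1) * (((k : ℝ) + 1) / (k + 3)) = 1 := by
      push_cast; field_simp; ring
    rw [mul_assoc] at this
    rw [show ((3 : ℕ) : ℝ) * (1 / ((k : ℝ) + 1) * (((k : ℝ) + 1) / (k + 3))) +
        k / ((k : ℝ) + 1) * (((k : ℝ) + 1) / (k + 3)) = 1 from this, ENNReal.rpow_one]

lemma rp1 (a : ℝ≥0∞) (x y z : ℝ) (h : x * y = z) : (a ^ x) ^ y = a ^ z := by
  rw [← ENNReal.rpow_mul, h]

lemma nN_v3 (F : ℝ → ℝ → ℝ → ℝ≥0∞) (k : ℕ) :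
    nN (1 / (k + 3)) (1 / (k + 3)) ((k + 1) / (k + 3)) (fun x y z => F x y z ^ 2) =
    (∫⁻ z, (∫⁻ y, ∫⁻ x, F x y z ^ (2 * (k + 3))) ^ (1 / ((k : ℝ) + 1))) ^
      (((k : ℝ) + 1) / (k + 3)) := by
  unfold nN nP
  have k1 : (0 : ℝ) < k + 1 := by positivity
  have k3 : (0 : ℝ) < k + 3 := by positivity
  have e1 : ∀ a : ℝ≥0∞, (a ^ 2) ^ (1 / (1 / ((k : ℝ) + 3))) = a ^ (2 * (k + 3)) := by
    intro a
    rw [pow_mul, ← ENNReal.rpow_natCast (a ^ 2) (k + 3)]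
    congr 1
    push_cast
    field_simp
  have e2 : ∀ a : ℝ≥0∞, (a ^ (1 / ((k : ℝ) + 3))) ^ (1 / (1 / ((k : ℝ) + 3))) = a := by
    intro a
    rw [rp1 _ _ _ 1 (by field_simp), ENNReal.rpow_one]
  have e3 : ∀ a : ℝ≥0∞, (a ^ (1 / ((k : ℝ) + 3))) ^ (1 / (((k : ℝ) + 1) / (k + 3))) =
      a ^ (1 / ((k : ℝ) + 1)) := by
    intro a
    rw [rp1 _ _ _ (1 / ((k : ℝ) + 1)) (by field_simp)]
  simp_rw [e1, e2, e3]

lemma nN_v1 {F : ℝ → ℝ → ℝ → ℝ≥0∞} (hF : M3 F) (k : ℕ) :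
    nN ((k + 1) / (k + 3)) (1 / (k + 3)) (1 / (k + 3)) (fun x y z => F x y z ^ 2) ≤
    (∫⁻ x, (∫⁻ y, ∫⁻ z, F x y z ^ (2 * (k + 3))) ^ (1 / ((k : ℝ) + 1))) ^
      (((k : ℝ) + 1) / (k + 3)) := by
  unfold nN nP
  have k1 : (0 : ℝ) < k + 1 := by positivity
  have k3 : (0 : ℝ) < k + 3 := by positivity
  have e2 : ∀ a : ℝ≥0∞, (a ^ (1 / ((k : ℝ) + 3))) ^ (1 / (1 / ((k : ℝ) + 3))) = a := by
    intro a
    rw [rp1 _ _ _ 1 (by field_simp), ENNReal.rpow_one]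
  have e3 : ∀ a : ℝ≥0∞, (a ^ (((k : ℝ) + 1) / (k + 3))) ^ (1 / (1 / ((k : ℝ) + 3))) =
      a ^ ((k : ℝ) + 1) := by
    intro a
    rw [rp1 _ _ _ ((k : ℝ) + 1) (by field_simp)]
  simp_rw [e2, e3]
  set G : ℝ → ℝ → ℝ → ℝ≥0∞ := fun x y z => (F x y z ^ 2) ^ (1 / (((k : ℝ) + 1) / (k + 3))) with hG
  have mG : M3 G := (hF.pow 2).pow_const _
  have mG2 : Measurable (fun p : ℝ × (ℝ × ℝ) => G p.1 p.2.1 p.2.2) := mG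
  have h := minkowski (volume : Measure ℝ) (volume : Measure (ℝ × ℝ))
    (F := fun x p => G x p.1 p.2) mG2 (m := (k : ℝ) + 1) (by simp)
  have e4 : ∫⁻ z, ∫⁻ y, (∫⁻ x, G x y z) ^ ((k : ℝ) + 1) =
      ∫⁻ p : ℝ × ℝ, (∫⁻ x, G x p.1 p.2) ^ ((k : ℝ) + 1) := by
    have mm : Measurable (fun p : ℝ × ℝ => (∫⁻ x, G x p.1 p.2) ^ ((k : ℝ) + 1)) :=
      mG.int1.pow_const _
    rw [swap2 (F := fun y z => (∫⁻ x, G x y z) ^ ((k : ℝ) + 1)) mm]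
    exact (lintegral_prod _ mm.aemeasurable).symm
  rw [e4]
  refine (ENNReal.rpow_le_rpow h (by positivity)).trans (le_of_eq ?_)
  rw [rp1 _ _ _ (((k : ℝ) + 1) / (k + 3)) (by field_simp)]
  congr 1
  refine lintegral_congr fun x => ?_
  congr 1
  have e5 : ∀ y z, G x y z ^ ((k : ℝ) + 1) = F x y z ^ (2 * (k + 3)) := by
    intro y z
    rw [hG]
    simp only
    rw [rp1 _ _ _ ((k + 3 : ℕ) : ℝ) (by push_cast; field_simp), ENNReal.rpow_natCast, ← pow_mul]
  simp_rw [e5]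
  exact lintegral_prod (fun p : ℝ × ℝ => F x p.1 p.2 ^ (2 * (k + 3)))
    ((hF.comp (g := fun p : ℝ × ℝ × ℝ => F p.1 p.2.1 p.2.2)
      (f := fun p : ℝ × ℝ => (x, p.1, p.2)) (by fun_prop)).pow_const _).aemeasurable

lemma nN_v2 {F : ℝ → ℝ → ℝ → ℝ≥0∞} (hF : M3 F) (k : ℕ) :
    nN (1 / (k + 3)) ((k + 1) / (k + 3)) (1 / (k + 3)) (fun x y z => F x y z ^ 2) ≤
    (∫⁻ y, (∫⁻ z, ∫⁻ x, F x y z ^ (2 * (k + 3))) ^ (1 / ((k : ℝ) + 1))) ^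
      (((k : ℝ) + 1) / (k + 3)) := by
  unfold nN nP
  have k1 : (0 : ℝ) < k + 1 := by positivity
  have k3 : (0 : ℝ) < k + 3 := by positivity
  have e1 : ∀ a : ℝ≥0∞, (a ^ 2) ^ (1 / (1 / ((k : ℝ) + 3))) = a ^ (2 * (k + 3)) := by
    intro a
    rw [pow_mul, ← ENNReal.rpow_natCast (a ^ 2) (k + 3)]
    congr 1
    push_cast
    field_simp
  have e2 : ∀ a : ℝ≥0∞, (a ^ (1 / ((k : ℝ) + 3))) ^ (1 / (((k : ℝ) + 1) / (k + 3))) =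
      a ^ (1 / ((k : ℝ) + 1)) := by
    intro a
    rw [rp1 _ _ _ (1 / ((k : ℝ) + 1)) (by field_simp)]
  have e3 : ∀ a : ℝ≥0∞, (a ^ (((k : ℝ) + 1) / (k + 3))) ^ (1 / (1 / ((k : ℝ) + 3))) =
      a ^ ((k : ℝ) + 1) := by
    intro a
    rw [rp1 _ _ _ ((k : ℝ) + 1) (by field_simp)]
  simp_rw [e1, e2, e3]
  have mG : Measurable (fun p : ℝ × ℝ =>
      (∫⁻ x, F x p.1 p.2 ^ (2 * (k + 3))) ^ (1 / ((k : ℝ) + 1))) :=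
    (hF.pow (2 * (k + 3))).int1.pow_const _
  have h := minkowski (volume : Measure ℝ) (volume : Measure ℝ)
    (F := fun y z => (∫⁻ x, F x y z ^ (2 * (k + 3))) ^ (1 / ((k : ℝ) + 1))) mG
    (m := (k : ℝ) + 1) (by simp)
  refine (ENNReal.rpow_le_rpow h (by positivity)).trans (le_of_eq ?_)
  rw [rp1 _ _ _ (((k : ℝ) + 1) / (k + 3)) (by field_simp)]
  have e5 : ∀ a : ℝ≥0∞, (a ^ (1 / ((k : ℝ) + 1))) ^ ((k : ℝ) + 1) = a := by
    intro a
    rw [rp1 _ _ _ 1 (by field_simp), ENNReal.rpow_one]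
  simp_rw [e5]

/-- The hypotheses on (|f|, |∇f|) for the abstract inequality. -/
structure GN (K : NNReal) (F D : ℝ → ℝ → ℝ → ℝ≥0∞) : Prop where
  mF : M3 F
  mD : M3 D
  l1 : L1 F D
  l2 : L2 F D
  l3 : L3 F D
  sob : I3 (fun x y z => F x y z ^ 6) ≤ K * I3 (fun x y z => D x y z ^ 2) ^ 3

lemma verts (K : NNReal) (k : ℕ) : ∃ c : NNReal, ∀ F D : ℝ → ℝ → ℝ → ℝ≥0∞, GN K F D →
    nN ((k + 1) / (k + 3)) (1 / (k + 3)) (1 / (k + 3)) (fun x y z => F x y z ^ 2) ≤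
      c * I3 (fun x y z => D x y z ^ 2) ∧
    nN (1 / (k + 3)) ((k + 1) / (k + 3)) (1 / (k + 3)) (fun x y z => F x y z ^ 2) ≤
      c * I3 (fun x y z => D x y z ^ 2) ∧
    nN (1 / (k + 3)) (1 / (k + 3)) ((k + 1) / (k + 3)) (fun x y z => F x y z ^ 2) ≤
      c * I3 (fun x y z => D x y z ^ 2) := by
  obtain ⟨c, hc⟩ := vert K k
  refine ⟨c, fun F D h => ⟨?_, ?_, ?_⟩⟩
  · refine (nN_v1 h.mF k).trans ?_
    have := hc (fun x y z => F z y x) (fun x y z => D z y x) h.mF.swap13 h.mD.swap13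
      (fun k x y z => h.l3 k z y x) (fun k x y z => h.l2 k z y x) (by
        have e1 := I3_swap13 (h.mF.pow 6)
        have e2 := I3_swap13 (h.mD.pow 2)
        rw [e1, e2]; exact h.sob)
    have e2 := I3_swap13 (h.mD.pow 2)
    rw [e2] at this
    exact this
  · refine (nN_v2 h.mF k).trans ?_
    have := hc (fun x y z => F x z y) (fun x y z => D x z y) h.mF.swap23 h.mD.swap23
      (fun k x y z => h.l1 k x z y) (fun k x y z => h.l3 k x z y) (by
        have e1 := I3_swap23 (h.mF.pow 6)
        have e2 := I3_swap23 (h.mD.pow 2)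
        rw [e1, e2]; exact h.sob)
    have e2 := I3_swap23 (h.mD.pow 2)
    rw [e2] at this
    exact this
  · rw [nN_v3]
    exact hc F D h.mF h.mD h.l1 h.l2 h.sob

lemma dec0 {y1 y2 y3 : ℝ} (h1 : 0 < y1) (h2 : 0 < y2) (h3 : 0 < y3) (g1 : y1 < 1) (g2 : y2 < 1)
    (g3 : y3 < 1) (hs : y1 + y2 + y3 ≤ 2) : ∃ W1 W2 W3 n0 n1 n2 n3 : ℝ, 0 < W1 ∧ 0 < W2 ∧ 0 < W3 ∧
    0 ≤ n0 ∧ 0 ≤ n1 ∧ 0 ≤ n2 ∧ 0 ≤ n3 ∧ W1 + W2 + W3 + n0 + n1 + n2 + n3 = 1 ∧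
    y1 = W2 + W3 + n1 ∧ y2 = W1 + W3 + n2 ∧ y3 = W1 + W2 + n3 := by
  rcases le_or_gt (y1 + y2 + y3) 1 with h | h
  · obtain ⟨k, hk, k1, k2, k3⟩ : ∃ k, 0 < k ∧ k ≤ y1 ∧ k ≤ y2 ∧ k ≤ y3 :=
      ⟨min y1 (min y2 y3), by simp [*], by simp, by simp, by simp⟩
    exact ⟨k / 3, k / 3, k / 3, 1 + k - (y1 + y2 + y3), y1 - 2 * k / 3, y2 - 2 * k / 3,
      y3 - 2 * k / 3, by linarith, by linarith, by linarith, by linarith, by linarith, by linarith,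
      by linarith, by ring, by ring, by ring, by ring⟩
  · set k := y1 + y2 + y3 - 1 with hk
    obtain ⟨m1, e1⟩ : ∃ m, m = max 0 (k - y1) := ⟨_, rfl⟩
    obtain ⟨m2, e2⟩ : ∃ m, m = max 0 (k - y2) := ⟨_, rfl⟩
    obtain ⟨m3, e3⟩ : ∃ m, m = max 0 (k - y3) := ⟨_, rfl⟩
    have a : ∀ i : ℕ, 0 < m1 + (k - (m1 + m2 + m3)) / 3 ∧ 0 < m2 + (k - (m1 + m2 + m3)) / 3 ∧
        0 < m3 + (k - (m1 + m2 + m3)) / 3 ∧ 0 ≤ k - (m1 + m2 + m3) ∧ i = i := by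
      intro i
      rcases max_cases 0 (k - y1) with ⟨c1, d1⟩ | ⟨c1, d1⟩ <;>
      rcases max_cases 0 (k - y2) with ⟨c2, d2⟩ | ⟨c2, d2⟩ <;>
      rcases max_cases 0 (k - y3) with ⟨c3, d3⟩ | ⟨c3, d3⟩ <;>
      rw [← e1] at c1 <;> rw [← e2] at c2 <;> rw [← e3] at c3 <;>
      refine ⟨?_, ?_, ?_, ?_, rfl⟩ <;> linarith
    obtain ⟨a1, a2, a3, a4, -⟩ := a 0
    have b1 : k - y1 ≤ m1 := e1 ▸ le_max_right _ _
    have b2 : k - y2 ≤ m2 := e2 ▸ le_max_right _ _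
    have b3 : k - y3 ≤ m3 := e3 ▸ le_max_right _ _
    refine ⟨_, _, _, 0, y1 - k + (m1 + (k - (m1 + m2 + m3)) / 3),
      y2 - k + (m2 + (k - (m1 + m2 + m3)) / 3),
      y3 - k + (m3 + (k - (m1 + m2 + m3)) / 3), a1, a2, a3, le_rfl, ?_, ?_, ?_, ?_, ?_, ?_, ?_⟩ <;>
      linarith

lemma dec1 {y1 y2 y3 : ℝ} (h1 : 0 < y1) (h2 : 0 < y2) (h3 : 0 < y3) (g1 : y1 < 1) (g2 : y2 < 1)
    (g3 : y3 < 1) (hs : y1 + y2 + y3 ≤ 2) : ∃ (k : ℕ) (l1 l2 l3 n0 n1 n2 n3 : ℝ),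
    0 < l1 ∧ 0 < l2 ∧ 0 < l3 ∧
    0 ≤ n0 ∧ 0 ≤ n1 ∧ 0 ≤ n2 ∧ 0 ≤ n3 ∧ l1 + l2 + l3 + n0 + n1 + n2 + n3 = 1 ∧
    1 - y1 = l1 * ((k + 1) / (k + 3)) + l2 * (1 / (k + 3)) + l3 * (1 / (k + 3)) + n2 + n3 + n0 ∧
    1 - y2 = l1 * (1 / (k + 3)) + l2 * ((k + 1) / (k + 3)) + l3 * (1 / (k + 3)) + n1 + n3 + n0 ∧
    1 - y3 = l1 * (1 / (k + 3)) + l2 * (1 / (k + 3)) + l3 * ((k + 1) / (k + 3)) + n1 + n2 + n0 := by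
  obtain ⟨W1, W2, W3, n0, n1, n2, n3, w1, w2, w3, a0, a1, a2, a3, e0, e1, e2, e3⟩ :=
    dec0 h1 h2 h3 g1 g2 g3 hs
  obtain ⟨w, hw, v1, v2, v3⟩ : ∃ k, 0 < k ∧ k ≤ W1 ∧ k ≤ W2 ∧ k ≤ W3 :=
      ⟨min W1 (min W2 W3), by simp [*], by simp, by simp, by simp⟩
  obtain ⟨j, hj⟩ := exists_nat_gt ((W1 + W2 + W3) / w)
  rw [div_lt_iff₀ hw] at hj
  have hj0 : (0 : ℝ) < j := by
    by_contra h
    nlinarith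
  have f1 : W1 + W2 + W3 < (j + 3) * W1 := by nlinarith
  have f2 : W1 + W2 + W3 < (j + 3) * W2 := by nlinarith
  have f3 : W1 + W2 + W3 < (j + 3) * W3 := by nlinarith
  refine ⟨j, ((j + 3) * W1 - (W1 + W2 + W3)) / j, ((j + 3) * W2 - (W1 + W2 + W3)) / j,
    ((j + 3) * W3 - (W1 + W2 + W3)) / j, n0, n1, n2, n3, div_pos (by linarith) hj0,
    div_pos (by linarith) hj0, div_pos (by linarith) hj0, a0, a1, a2, a3, ?_, ?_, ?_, ?_⟩
  · field_simp
    linear_combination (j : ℝ) * e0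
  · rw [show 1 - y1 = W1 + n2 + n3 + n0 by linarith]; field_simp; ring
  · rw [show 1 - y2 = W2 + n1 + n3 + n0 by linarith]; field_simp; ring
  · rw [show 1 - y3 = W3 + n1 + n2 + n0 by linarith]; field_simp; ring

lemma nN_rpow {a1 a2 a3 l : ℝ} (h1 : 0 < a1) (h2 : 0 < a2) (h3 : 0 < a3) (hl : 0 < l)
    (F : ℝ → ℝ → ℝ → ℝ≥0∞) :
    nN (l * a1) (l * a2) (l * a3) (fun x y z => F x y z ^ l) = nN a1 a2 a3 F ^ l := by
  have e : ∀ a : ℝ, 0 < a → ∀ f : ℝ → ℝ≥0∞, nP (l * a) (fun x => f x ^ l) = nP a f ^ l := by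
    intro a ha f
    unfold nP
    rw [rp1 _ a l (l * a) (by ring)]
    congr 1
    refine lintegral_congr fun x => ?_
    exact rp1 _ _ _ _ (by field_simp)
  unfold nN
  simp_rw [e _ h1, e _ h2, e _ h3]

lemma nN_one (F : ℝ → ℝ → ℝ → ℝ≥0∞) : nN 1 1 1 F = I3 F := by
  simp [nN, nP, I3]

lemma I3_cs {F D : ℝ → ℝ → ℝ → ℝ≥0∞} (hF : M3 F) (hD : M3 D) :
    I3 (fun x y z => F x y z * D x y z) ≤
      I3 (fun x y z => F x y z ^ 2) ^ (1 / 2 : ℝ) * I3 (fun x y z => D x y z ^ 2) ^ (1 / 2 : ℝ) := by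
  have e : ∀ G : ℝ → ℝ → ℝ → ℝ≥0∞, M3 G → I3 G = ∫⁻ p : ℝ × ℝ × ℝ, G p.1 p.2.1 p.2.2 := by
    intro G hG
    rw [← I3_swap13 hG]
    rw [Measure.volume_eq_prod, lintegral_prod _ hG.aemeasurable]
    unfold I3
    refine lintegral_congr fun z => ?_
    have mz : Measurable (fun p : ℝ × ℝ => G z p.1 p.2) :=
      hG.comp (g := fun p : ℝ × ℝ × ℝ => G p.1 p.2.1 p.2.2)
        (f := fun p : ℝ × ℝ => (z, p.1, p.2)) (by fun_prop)
    exact (lintegral_prod (fun p : ℝ × ℝ => G z p.1 p.2) mz.aemeasurable).symm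
  have hFD : M3 (fun x y z => F x y z * D x y z) := hF.mul hD
  rw [e _ hFD, e _ (hF.pow 2), e _ (hD.pow 2)]
  have := cs volume hF hD
  rw [← ENNReal.mul_rpow_of_nonneg _ _ (by norm_num)]
  refine le_trans (le_of_eq ?_) (ENNReal.rpow_le_rpow this (by norm_num : (0 : ℝ) ≤ 1 / 2))
  rw [← ENNReal.rpow_natCast, ← ENNReal.rpow_mul]; norm_num

lemma GN_main (K : NNReal) {y1 y2 y3 : ℝ} (h1 : 0 < y1) (h2 : 0 < y2) (h3 : 0 < y3) (g1 : y1 < 1)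
    (g2 : y2 < 1) (g3 : y3 < 1) (hs : y1 + y2 + y3 ≤ 2) :
    ∃ c : NNReal, ∀ F D : ℝ → ℝ → ℝ → ℝ≥0∞, GN K F D →
      nN (1 - y1) (1 - y2) (1 - y3) (fun x y z => F x y z ^ 2) ≤
        c * (I3 fun x y z => D x y z ^ 2) ^ ((y1 + y2 + y3) / 2) *
          (I3 fun x y z => F x y z ^ 2) ^ (1 - (y1 + y2 + y3) / 2) := by
  obtain ⟨k, l1, l2, l3, n0, n1, n2, n3, l1p, l2p, l3p, a0, a1, a2, a3, e0, e1, e2, e3⟩ :=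
    dec1 h1 h2 h3 g1 g2 g3 hs
  obtain ⟨c, hc⟩ := verts K k
  refine ⟨c ^ l1 * c ^ l2 * c ^ l3 * 2 ^ n1 * 2 ^ n2 * 2 ^ n3, fun F D h => ?_⟩
  obtain ⟨v1, v2, v3⟩ := hc F D h
  set T := I3 fun x y z => D x y z ^ 2 with hT
  set U := I3 fun x y z => F x y z ^ 2 with hU
  have p1 : (0 : ℝ) < 1 / (k + 3) := by positivity
  have p2 : (0 : ℝ) < (k + 1) / (k + 3) := by positivity
  have mF2 := h.mF.pow 2
  have mFD : M3 (fun x y z => F x y z * D x y z) := h.mF.mul h.mD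
  have mA1 : M3 (fun x y z => (F x y z ^ 2) ^ l1) := Measurable.pow_const mF2 _
  have mm1 : Measurable (fun p : ℝ × ℝ => 2 * ∫⁻ x, F x p.1 p.2 * D x p.1 p.2) :=
    mFD.int1.const_mul _
  have mm2 : Measurable (fun p : ℝ × ℝ => 2 * ∫⁻ y, F p.1 y p.2 * D p.1 y p.2) :=
    (mFD.swap13.swap23.swap13).int1.const_mul _
  have mm3 : Measurable (fun p : ℝ × ℝ => 2 * ∫⁻ z, F p.1 p.2 z * D p.1 p.2 z) :=
    ((mFD.swap13.swap23).int1.const_mul 2)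
  have mA2 : M3 (fun x y z => (F x y z ^ 2) ^ l1 * (F x y z ^ 2) ^ l2) :=
    mA1.mul (Measurable.pow_const mF2 _)
  have mA3 : M3 (fun x y z => (F x y z ^ 2) ^ l1 * (F x y z ^ 2) ^ l2 * (F x y z ^ 2) ^ l3) :=
    mA2.mul (Measurable.pow_const mF2 _)
  have mA4 : M3 (fun x y z => (F x y z ^ 2) ^ l1 * (F x y z ^ 2) ^ l2 * (F x y z ^ 2) ^ l3 *
      (2 * ∫⁻ x, F x y z * D x y z) ^ n1) :=
    mA3.mul (Measurable.pow_const (mm1.comp measurable_snd) _)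
  have mA5 : M3 (fun x y z => (F x y z ^ 2) ^ l1 * (F x y z ^ 2) ^ l2 * (F x y z ^ 2) ^ l3 *
      (2 * ∫⁻ x, F x y z * D x y z) ^ n1 * (2 * ∫⁻ y, F x y z * D x y z) ^ n2) :=
    mA4.mul (Measurable.pow_const (mm2.comp (f := fun p : ℝ × ℝ × ℝ => (p.1, p.2.2))
      (by fun_prop)) _)
  have mA6 : M3 (fun x y z => (F x y z ^ 2) ^ l1 * (F x y z ^ 2) ^ l2 * (F x y z ^ 2) ^ l3 *
      (2 * ∫⁻ x, F x y z * D x y z) ^ n1 * (2 * ∫⁻ y, F x y z * D x y z) ^ n2 *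
      (2 * ∫⁻ z, F x y z * D x y z) ^ n3) :=
    mA5.mul (Measurable.pow_const (mm3.comp (f := fun p : ℝ × ℝ × ℝ => (p.1, p.2.1))
      (by fun_prop)) _)
  -- Holder steps
  have s1 := nN_rpow p2 p1 p1 l1p (fun x y z => F x y z ^ 2)
  have s2 := nN_holder (a1 := l1 * ((k + 1) / (k + 3))) (a2 := l1 * (1 / (k + 3)))
    (a3 := l1 * (1 / (k + 3))) (by positivity) (by positivity) (by positivity) p1 p2 p1 l2p.le
    mA1 mF2
  have s3 := nN_holder (by positivity) (by positivity) (by positivity) p1 p1 p2 l3p.le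
    mA2 mF2 (a1 := l1 * ((k + 1) / (k + 3)) + l2 * (1 / (k + 3)))
    (a2 := l1 * (1 / (k + 3)) + l2 * ((k + 1) / (k + 3)))
    (a3 := l1 * (1 / (k + 3)) + l2 * (1 / (k + 3)))
  have s4 := nN_holder_m1 (by positivity) (by positivity) (by positivity) a1 mA3 mm1
    (a1 := l1 * ((k + 1) / (k + 3)) + l2 * (1 / (k + 3)) + l3 * (1 / (k + 3)))
    (a2 := l1 * (1 / (k + 3)) + l2 * ((k + 1) / (k + 3)) + l3 * (1 / (k + 3)))
    (a3 := l1 * (1 / (k + 3)) + l2 * (1 / (k + 3)) + l3 * ((k + 1) / (k + 3)))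
    (m := fun y z => 2 * ∫⁻ x, F x y z * D x y z)
  have s5 := nN_holder_m2 (by positivity) (by positivity) (by positivity) a2 mA4 mm2
    (a1 := l1 * ((k + 1) / (k + 3)) + l2 * (1 / (k + 3)) + l3 * (1 / (k + 3)))
    (a2 := l1 * (1 / (k + 3)) + l2 * ((k + 1) / (k + 3)) + l3 * (1 / (k + 3)) + n1)
    (a3 := l1 * (1 / (k + 3)) + l2 * (1 / (k + 3)) + l3 * ((k + 1) / (k + 3)) + n1)
    (m := fun x z => 2 * ∫⁻ y, F x y z * D x y z)
  have s6 := nN_holder_m3 (by positivity) (by positivity) (by positivity) a3 mA5 mm3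
    (a1 := l1 * ((k + 1) / (k + 3)) + l2 * (1 / (k + 3)) + l3 * (1 / (k + 3)) + n2)
    (a2 := l1 * (1 / (k + 3)) + l2 * ((k + 1) / (k + 3)) + l3 * (1 / (k + 3)) + n1)
    (a3 := l1 * (1 / (k + 3)) + l2 * (1 / (k + 3)) + l3 * ((k + 1) / (k + 3)) + n1 + n2)
    (m := fun x y => 2 * ∫⁻ z, F x y z * D x y z)
  have s7 := nN_holder (by positivity) (by positivity) (by positivity) one_pos one_pos one_pos
    a0 mA6 mF2
    (a1 := l1 * ((k + 1) / (k + 3)) + l2 * (1 / (k + 3)) + l3 * (1 / (k + 3)) + n2 + n3)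
    (a2 := l1 * (1 / (k + 3)) + l2 * ((k + 1) / (k + 3)) + l3 * (1 / (k + 3)) + n1 + n3)
    (a3 := l1 * (1 / (k + 3)) + l2 * (1 / (k + 3)) + l3 * ((k + 1) / (k + 3)) + n1 + n2)
  rw [mul_one, ← e1, ← e2, ← e3] at s7
  have pt : ∀ x y z, F x y z ^ 2 ≤
      (F x y z ^ 2) ^ l1 * (F x y z ^ 2) ^ l2 * (F x y z ^ 2) ^ l3 *
      (2 * ∫⁻ x, F x y z * D x y z) ^ n1 * (2 * ∫⁻ y, F x y z * D x y z) ^ n2 *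
      (2 * ∫⁻ z, F x y z * D x y z) ^ n3 * (F x y z ^ 2) ^ n0 := by
    intro x y z
    have b1 : F x y z ^ 2 ≤ 2 * ∫⁻ x, F x y z * D x y z := by
      have := h.l1 1 x y z
      norm_num at this; exact this
    have b2 : F x y z ^ 2 ≤ 2 * ∫⁻ y, F x y z * D x y z := by
      have := h.l2 1 x y z
      norm_num at this; exact this
    have b3 : F x y z ^ 2 ≤ 2 * ∫⁻ z, F x y z * D x y z := by
      have := h.l3 1 x y z
      norm_num at this; exact this
    calc F x y z ^ 2 = (F x y z ^ 2) ^ l1 * (F x y z ^ 2) ^ l2 * (F x y z ^ 2) ^ l3 *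
      (F x y z ^ 2) ^ n1 * (F x y z ^ 2) ^ n2 * (F x y z ^ 2) ^ n3 * (F x y z ^ 2) ^ n0 := by
          rw [← ENNReal.rpow_add_of_nonneg _ _ (by positivity) (by positivity),
            ← ENNReal.rpow_add_of_nonneg _ _ (by positivity) (by positivity),
            ← ENNReal.rpow_add_of_nonneg _ _ (by positivity) (by positivity),
            ← ENNReal.rpow_add_of_nonneg _ _ (by positivity) (by positivity),
            ← ENNReal.rpow_add_of_nonneg _ _ (by positivity) (by positivity),
            ← ENNReal.rpow_add_of_nonneg _ _ (by positivity) (by positivity),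
            show l1 + l2 + l3 + n1 + n2 + n3 + n0 = 1 by linarith, ENNReal.rpow_one]
      _ ≤ _ := by gcongr
  have S := I3_cs h.mF h.mD
  have m1b : ∫⁻ z, ∫⁻ y, 2 * ∫⁻ x, F x y z * D x y z ≤ 2 * (U ^ (1 / 2 : ℝ) * T ^ (1 / 2 : ℝ)) := by
    refine le_trans (le_of_eq ?_) (mul_le_mul' le_rfl S)
    simp_rw [lintegral_const_mul' 2 _ (by norm_num : (2 : ℝ≥0∞) ≠ ∞)]
    rfl
  have m2b : ∫⁻ z, ∫⁻ x, 2 * ∫⁻ y, F x y z * D x y z ≤ 2 * (U ^ (1 / 2 : ℝ) * T ^ (1 / 2 : ℝ)) := by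
    refine le_trans (le_of_eq ?_) (mul_le_mul' le_rfl S)
    rw [← I3_swap12 mFD]
    simp_rw [lintegral_const_mul' 2 _ (by norm_num : (2 : ℝ≥0∞) ≠ ∞)]
    rfl
  have m3b : ∫⁻ y, ∫⁻ x, 2 * ∫⁻ z, F x y z * D x y z ≤ 2 * (U ^ (1 / 2 : ℝ) * T ^ (1 / 2 : ℝ)) := by
    refine le_trans (le_of_eq ?_) (mul_le_mul' le_rfl S)
    have e13 : I3 (fun x y z => F y z x * D y z x) = I3 (fun x y z => F x y z * D x y z) :=
      (I3_swap23 mFD.swap13).trans (I3_swap13 mFD)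
    rw [← e13]
    simp_rw [lintegral_const_mul' 2 _ (by norm_num : (2 : ℝ≥0∞) ≠ ∞)]
    rfl
  refine (nN_mono (by linarith) (by linarith) (by linarith) pt).trans (s7.trans ?_)
  rw [nN_one]
  calc _ ≤ (c * T) ^ l1 * (c * T) ^ l2 * (c * T) ^ l3 *
        (2 * (U ^ (1 / 2 : ℝ) * T ^ (1 / 2 : ℝ))) ^ n1 *
        (2 * (U ^ (1 / 2 : ℝ) * T ^ (1 / 2 : ℝ))) ^ n2 *
        (2 * (U ^ (1 / 2 : ℝ) * T ^ (1 / 2 : ℝ))) ^ n3 * U ^ n0 := by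
        gcongr
        refine s6.trans ?_
        gcongr
        refine s5.trans ?_
        gcongr
        refine s4.trans ?_
        gcongr
        refine s3.trans ?_
        gcongr
        refine s2.trans ?_
        rw [s1]
        gcongr
    _ = _ := by
        push_cast [ENNReal.coe_rpow_of_nonneg _ l1p.le, ENNReal.coe_rpow_of_nonneg _ l2p.le, ENNReal.coe_rpow_of_nonneg _ l3p.le,
          ENNReal.coe_rpow_of_nonneg _ a1, ENNReal.coe_rpow_of_nonneg _ a2, ENNReal.coe_rpow_of_nonneg _ a3]
        simp only [ENNReal.mul_rpow_of_nonneg _ _ l1p.le, ENNReal.mul_rpow_of_nonneg _ _ l2p.le,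
          ENNReal.mul_rpow_of_nonneg _ _ l3p.le, ENNReal.mul_rpow_of_nonneg _ _ a1,
          ENNReal.mul_rpow_of_nonneg _ _ a2, ENNReal.mul_rpow_of_nonneg _ _ a3,
          ← ENNReal.rpow_mul]
        have eT : T ^ ((y1 + y2 + y3) / 2) = T ^ l1 * T ^ l2 * T ^ l3 * T ^ (1 / 2 * n1) *
            T ^ (1 / 2 * n2) * T ^ (1 / 2 * n3) := by
          have : (y1 + y2 + y3) / 2 = l1 + l2 + l3 + 1 / 2 * n1 + 1 / 2 * n2 + 1 / 2 * n3 := by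
            have : 3 - (y1 + y2 + y3) = (l1 + l2 + l3) + 2 * (n1 + n2 + n3) + 3 * n0 := by
              have e4 : ((k : ℝ) + 1) / (k + 3) = 1 - 2 * (1 / (k + 3)) := by field_simp; ring
              rw [e4] at e1 e2 e3
              linarith
            linarith
          rw [this]
          rw [ENNReal.rpow_add_of_nonneg _ _ (by positivity) (by positivity),
            ENNReal.rpow_add_of_nonneg _ _ (by positivity) (by positivity),
            ENNReal.rpow_add_of_nonneg _ _ (by positivity) (by positivity),
            ENNReal.rpow_add_of_nonneg _ _ (by positivity) (by positivity),
            ENNReal.rpow_add_of_nonneg _ _ (by positivity) (by positivity)]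
        have eU : U ^ (1 - (y1 + y2 + y3) / 2) = U ^ n0 * U ^ (1 / 2 * n1) *
            U ^ (1 / 2 * n2) * U ^ (1 / 2 * n3) := by
          have : 1 - (y1 + y2 + y3) / 2 = n0 + 1 / 2 * n1 + 1 / 2 * n2 + 1 / 2 * n3 := by
            have : 3 - (y1 + y2 + y3) = (l1 + l2 + l3) + 2 * (n1 + n2 + n3) + 3 * n0 := by
              have e4 : ((k : ℝ) + 1) / (k + 3) = 1 - 2 * (1 / (k + 3)) := by field_simp; ring
              rw [e4] at e1 e2 e3
              linarith
            linarith
          rw [this]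
          rw [ENNReal.rpow_add_of_nonneg _ _ (by positivity) (by positivity),
            ENNReal.rpow_add_of_nonneg _ _ (by positivity) (by positivity),
            ENNReal.rpow_add_of_nonneg _ _ (by positivity) (by positivity)]
        rw [eT, eU]
        ring

lemma pt3_eq (x y z : ℝ) : pt3 x y z = !₂[x, y, z] := rfl

lemma meas_pt3 : Measurable (fun p : ℝ × ℝ × ℝ => pt3 p.1 p.2.1 p.2.2) := by
  have : Continuous (fun p : ℝ × ℝ × ℝ => pt3 p.1 p.2.1 p.2.2) := by
    simp_rw [pt3_eq]
    refine (PiLp.continuous_toLp 2 (fun _ : Fin 3 => ℝ)).comp ?_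
    refine continuous_pi fun i => ?_
    fin_cases i <;> simp <;> fun_prop
  exact this.measurable

lemma M3_of {G : E3 → ℝ≥0∞} (h : Measurable G) : M3 (fun x y z => G (pt3 x y z)) :=
  h.comp meas_pt3

lemma lintegral_pt3 {G : E3 → ℝ≥0∞} (h : Measurable G) :
    ∫⁻ x, G x = I3 (fun x y z => G (pt3 x y z)) := by
  have h0 := M3_of h
  rw [← (PiLp.volume_preserving_toLp (Fin 3)).lintegral_comp h]
  have h2 := (volume_preserving_piFinSuccAbove (fun _ : Fin 3 => ℝ) 0).symm
  have hk := h2.lintegral_comp (h.comp (PiLp.continuous_toLp 2 (fun _ : Fin 3 => ℝ)).measurable)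
  refine Eq.trans hk.symm ?_
  have h3 : MeasurePreserving (Prod.map id (MeasurableEquiv.finTwoArrow (α := ℝ)).symm)
    (volume : Measure (ℝ × ℝ × ℝ)) (volume : Measure (ℝ × (Fin 2 → ℝ))) :=
    (MeasurePreserving.id volume).prod (volume_preserving_finTwoArrow ℝ).symm
  have mc : Measurable (fun q => (G ∘ WithLp.toLp 2)
      ((MeasurableEquiv.piFinSuccAbove (fun _ : Fin 3 => ℝ) 0).symm q)) :=
    (h.comp (PiLp.continuous_toLp 2 (fun _ : Fin 3 => ℝ)).measurable).comp
      (MeasurableEquiv.measurable _)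
  refine Eq.trans (h3.lintegral_comp mc).symm ?_
  · rw [← I3_swap13 h0]
    unfold I3
    have e : ∀ p : ℝ × ℝ × ℝ, WithLp.toLp 2 ((MeasurableEquiv.piFinSuccAbove (fun _ : Fin 3 => ℝ) 0).symm (Prod.map id (MeasurableEquiv.finTwoArrow (α := ℝ)).symm p)) = pt3 p.1 p.2.1 p.2.2 := by
      intro p
      rw [pt3_eq]
      congr 1
      ext i
      fin_cases i <;> rfl
    simp_rw [Function.comp_def]
    simp_rw [e]
    rw [Measure.volume_eq_prod, lintegral_prod _ h0.aemeasurable]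
    refine lintegral_congr fun z => ?_
    have mz : Measurable (fun p : ℝ × ℝ => G (pt3 z p.1 p.2)) :=
      h0.comp (f := fun p : ℝ × ℝ => (z, p.1, p.2)) (by fun_prop)
    exact lintegral_prod (fun p : ℝ × ℝ => G (pt3 z p.1 p.2)) mz.aemeasurable

lemma line_ineq {f : E3 → ℝ} (hf : ContDiff ℝ 1 f) (hc : HasCompactSupport f) (k : ℕ) (a e : E3)
    (he : ‖e‖ = 1) (x : ℝ) : ‖f (a + x • e)‖ₑ ^ (k + 1) ≤
      (k + 1) * ∫⁻ t : ℝ, ‖f (a + t • e)‖ₑ ^ k * ‖fderiv ℝ f (a + t • e)‖ₑ := by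
  set g : ℝ → ℝ := fun t => f (a + t • e) ^ (k + 1) with hg
  have hemb : Topology.IsClosedEmbedding (fun t : ℝ => a + t • e) := by
    refine Isometry.isClosedEmbedding (Isometry.of_dist_eq fun s t => ?_)
    rw [dist_add_left, dist_eq_norm, ← sub_smul, norm_smul, he, mul_one]; rfl
  have hgc : ContDiff ℝ 1 g := by
    have : ContDiff ℝ 1 (fun t : ℝ => a + t • e) := by fun_prop
    exact (hf.comp this).pow _
  have hgs : HasCompactSupport g := by
    have h1 := hc.comp_isClosedEmbedding hemb
    exact h1.comp_left (g := fun y : ℝ => y ^ (k + 1)) (by simp)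
  have h := hgs.enorm_le_lintegral_Ici_deriv hgc x
  have hd : ∀ t, deriv g t = (k + 1) * f (a + t • e) ^ k * fderiv ℝ f (a + t • e) e := by
    intro t
    have h1 : HasDerivAt (fun t : ℝ => a + t • e) e t := by
      simpa using ((hasDerivAt_id t).smul_const e).const_add a
    have h2 := ((hf.differentiable (by norm_num) (a + t • e)).hasFDerivAt).comp_hasDerivAt t h1
    have h3 := h2.pow (k + 1)
    have h4 : deriv g t = _ := h3.deriv
    rw [h4]; simp
  have e1 : ‖g x‖ₑ = ‖f (a + x • e)‖ₑ ^ (k + 1) := by simp [hg, enorm_pow]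
  rw [← e1]
  refine h.trans ((setLIntegral_le_lintegral _ _).trans ?_)
  rw [← lintegral_const_mul' _ _ (by finiteness)]
  refine lintegral_mono fun t => ?_
  rw [hd, enorm_mul, enorm_mul, enorm_pow, mul_assoc]
  gcongr
  · rw [show (k : ℝ) + 1 = ((k + 1 : ℕ) : ℝ) by push_cast; rfl, Real.enorm_natCast]; push_cast; rfl
  · refine (ContinuousLinearMap.le_opENorm _ _).trans ?_
    rw [← ofReal_norm e, he]; simp

lemma pt3_l1 (x y z : ℝ) : pt3 x y z = pt3 0 y z + x • EuclideanSpace.single (0 : Fin 3) (1 : ℝ) := by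
  rw [pt3_eq, pt3_eq]; ext i; fin_cases i <;> simp
lemma pt3_l2 (x y z : ℝ) : pt3 x y z = pt3 x 0 z + y • EuclideanSpace.single (1 : Fin 3) (1 : ℝ) := by
  rw [pt3_eq, pt3_eq]; ext i; fin_cases i <;> simp
lemma pt3_l3 (x y z : ℝ) : pt3 x y z = pt3 x y 0 + z • EuclideanSpace.single (2 : Fin 3) (1 : ℝ) := by
  rw [pt3_eq, pt3_eq]; ext i; fin_cases i <;> simp

lemma GN_C1 : ∃ K : NNReal, ∀ f : E3 → ℝ, ContDiff ℝ 1 f → HasCompactSupport f →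
    GN K (fun x y z => ‖f (pt3 x y z)‖ₑ) (fun x y z => ‖fderiv ℝ f (pt3 x y z)‖ₑ) := by
  refine ⟨(eLpNormLESNormFDerivOfEqInnerConst (volume : Measure E3) 2) ^ 6, fun f hf hc => ?_⟩
  have m1 : Measurable (fun x => ‖f x‖ₑ) := hf.continuous.enorm.measurable
  have m2 : Measurable (fun x => ‖fderiv ℝ f x‖ₑ) :=
    (hf.continuous_fderiv (by norm_num)).enorm.measurable
  refine ⟨M3_of m1, M3_of m2, ?_, ?_, ?_, ?_⟩
  · intro k x y z
    have := line_ineq hf hc k (pt3 0 y z) (EuclideanSpace.single (0 : Fin 3) (1 : ℝ)) (by simp) x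
    simp_rw [← pt3_l1] at this
    exact this
  · intro k x y z
    have := line_ineq hf hc k (pt3 x 0 z) (EuclideanSpace.single (1 : Fin 3) (1 : ℝ)) (by simp) y
    simp_rw [← pt3_l2] at this
    exact this
  · intro k x y z
    have := line_ineq hf hc k (pt3 x y 0) (EuclideanSpace.single (2 : Fin 3) (1 : ℝ)) (by simp) z
    simp_rw [← pt3_l3] at this
    exact this
  · rw [← lintegral_pt3 (G := fun x => ‖f x‖ₑ ^ 6) (m1.pow_const _),
      ← lintegral_pt3 (G := fun x => ‖fderiv ℝ f x‖ₑ ^ 2) (m2.pow_const _)]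
    have h := eLpNorm_le_eLpNorm_fderiv_of_eq_inner (volume : Measure E3) hf hc (p := 2) (p' := 6)
      (by norm_num) (by simp) (by simp; norm_num)
    rw [eLpNorm_nnreal_eq_lintegral (by norm_num), eLpNorm_nnreal_eq_lintegral (by norm_num)] at h
    have h6 := pow_le_pow_left' h 6
    rw [mul_pow] at h6
    push_cast at h6 ⊢
    have e1 : ∀ a : ℝ≥0∞, (a ^ (1 / 6 : ℝ)) ^ 6 = a := by
      intro a; rw [← ENNReal.rpow_natCast, ← ENNReal.rpow_mul]; norm_num
    have e2 : ∀ a : ℝ≥0∞, (a ^ (1 / 2 : ℝ)) ^ 6 = a ^ 3 := by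
      intro a; rw [← ENNReal.rpow_natCast, ← ENNReal.rpow_mul, ← ENNReal.rpow_natCast]; norm_num
    rw [e1, e2] at h6
    have e3 : ∀ a : ℝ≥0∞, a ^ (6 : ℝ) = a ^ 6 := fun a => by exact_mod_cast ENNReal.rpow_natCast a 6
    have e4 : ∀ a : ℝ≥0∞, a ^ (2 : ℝ) = a ^ 2 := fun a => by exact_mod_cast ENNReal.rpow_natCast a 2
    simp_rw [e3, e4] at h6
    exact h6

lemma mixed_C1 {y1 y2 y3 : ℝ} (h1 : 0 < y1) (h2 : 0 < y2) (h3 : 0 < y3) (g1 : y1 < 1)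
    (g2 : y2 < 1) (g3 : y3 < 1) (hs : y1 + y2 + y3 ≤ 2) :
    ∃ c : NNReal, ∀ f : E3 → ℝ, ContDiff ℝ 1 f → HasCompactSupport f →
      ∀ A : E3 → ℝ≥0∞, Measurable A →
      ∫⁻ x, A x * ‖f x‖ₑ ^ 2 ≤ c * nN y1 y2 y3 (fun x y z => A (pt3 x y z)) *
        (∫⁻ x, ‖fderiv ℝ f x‖ₑ ^ 2) ^ ((y1 + y2 + y3) / 2) *
          (∫⁻ x, ‖f x‖ₑ ^ 2) ^ (1 - (y1 + y2 + y3) / 2) := by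
  obtain ⟨K, hK⟩ := GN_C1
  obtain ⟨c, hc⟩ := GN_main K h1 h2 h3 g1 g2 g3 hs
  refine ⟨c, fun f hf hcs A hA => ?_⟩
  have m1 : Measurable (fun x => ‖f x‖ₑ ^ 2) := hf.continuous.enorm.measurable.pow_const _
  have m2 : Measurable (fun x => ‖fderiv ℝ f x‖ₑ ^ 2) :=
    (hf.continuous_fderiv (by norm_num)).enorm.measurable.pow_const _
  have h := hc _ _ (hK f hf hcs)
  have hh := nN_holder h1 h2 h3 (sub_pos.2 g1) (sub_pos.2 g2) (sub_pos.2 g3) zero_le_one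
    (M3_of hA) (M3_of m1)
  simp only [one_mul, add_sub_cancel, ENNReal.rpow_one] at hh
  rw [nN_one] at hh
  have m3 : Measurable (fun x => A x * ‖f x‖ₑ ^ 2) := hA.mul m1
  rw [lintegral_pt3 m3, lintegral_pt3 m1, lintegral_pt3 m2]
  refine hh.trans ?_
  calc _ ≤ _ := mul_le_mul' le_rfl h
    _ = _ := by ring

lemma line_sq {v : E3 → ℝ} (hv : ContDiff ℝ 1 v) (x y : E3) :
    ‖v y - v x‖ₑ ^ 2 ≤ ‖y - x‖ₑ ^ 2 *
      ∫⁻ s : ℝ in Ioc 0 1, ‖fderiv ℝ v ((1 - s) • x + s • y)‖ₑ ^ 2 := by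
  have hcf := hv.continuous_fderiv (by norm_num : (1 : WithTop ℕ∞) ≠ 0)
  have hd : ∀ s : ℝ, HasDerivAt (fun s : ℝ => v ((1 - s) • x + s • y))
      (fderiv ℝ v ((1 - s) • x + s • y) (y - x)) s := by
    intro s
    have h1 : HasDerivAt (fun s : ℝ => (1 - s) • x + s • y) (y - x) s := by
      have := (((hasDerivAt_id s).const_sub 1).smul_const x).add ((hasDerivAt_id s).smul_const y)
      rw [show y - x = (-1 : ℝ) • x + (1 : ℝ) • y by simp [sub_eq_neg_add]]
      exact this
    exact ((hv.differentiable (by norm_num) _).hasFDerivAt).comp_hasDerivAt s h1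
  have cont : Continuous (fun s : ℝ => fderiv ℝ v ((1 - s) • x + s • y)) :=
    hcf.comp (by fun_prop)
  have ftc := intervalIntegral.integral_eq_sub_of_hasDerivAt (a := 0) (b := 1)
    (fun s _ => hd s) ((cont.clm_apply continuous_const).intervalIntegrable _ _)
  simp only [sub_self, zero_smul, one_smul, zero_add, sub_zero, add_zero] at ftc
  rw [← ftc, intervalIntegral.integral_of_le zero_le_one]
  have b1 : ‖∫ s : ℝ in Ioc 0 1, fderiv ℝ v ((1 - s) • x + s • y) (y - x)‖ₑ ≤
      ‖y - x‖ₑ * ∫⁻ s : ℝ in Ioc 0 1, ‖fderiv ℝ v ((1 - s) • x + s • y)‖ₑ := by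
    refine (enorm_integral_le_lintegral_enorm _).trans ?_
    rw [← lintegral_const_mul' _ _ (by finiteness)]
    refine lintegral_mono fun s => ?_
    rw [mul_comm]
    exact ContinuousLinearMap.le_opENorm _ _
  refine (pow_le_pow_left' b1 2).trans ?_
  rw [mul_pow]
  gcongr
  have := cs (volume.restrict (Ioc (0 : ℝ) 1)) (f := fun _ => 1)
    (g := fun s => ‖fderiv ℝ v ((1 - s) • x + s • y)‖ₑ) measurable_const cont.enorm.measurable
  simpa using this

lemma lintegral_affine {H : E3 → ℝ≥0∞} (hH : Measurable H) (a : E3) {s : ℝ} (hs : 1 / 2 ≤ s) :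
    ∫⁻ y, H (a + s • y) ≤ 8 * ∫⁻ y, H y := by
  have hs0 : 0 < s := by linarith
  have e1 : ∫⁻ y, H (a + s • y) = ∫⁻ z, H (a + z) ∂(Measure.map (fun y => s • y) volume) := by
    have mz : Measurable (fun z => H (a + z)) := hH.comp (measurable_const_add a)
    rw [lintegral_map mz (measurable_const_smul s)]
  rw [e1, Measure.map_addHaar_smul _ hs0.ne', lintegral_smul_measure,
    lintegral_add_left_eq_self (fun z => H z) a, smul_eq_mul]
  gcongr
  rw [show (8 : ℝ≥0∞) = ENNReal.ofReal 8 by norm_num]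
  apply ENNReal.ofReal_le_ofReal
  rw [abs_of_nonneg (by positivity)]
  simp only [finrank_euclideanSpace, Fintype.card_fin]
  rw [inv_le_comm₀ (by positivity) (by norm_num)]
  calc (8 : ℝ)⁻¹ = (1 / 2) ^ 3 := by norm_num
    _ ≤ s ^ 3 := by gcongr

lemma poinc_aux {h : E3 → ℝ≥0∞} (hh : Measurable h) (r : ℝ) {s : ℝ} (h0 : 0 ≤ s) (h1 : s ≤ 1) :
    ∫⁻ x in ball (0 : E3) r, ∫⁻ y in ball (0 : E3) r, h ((1 - s) • x + s • y) ≤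
      8 * volume (ball (0 : E3) r) * ∫⁻ x in ball (0 : E3) r, h x := by
  set B := ball (0 : E3) r with hB
  have mB : MeasurableSet B := measurableSet_ball
  set H := B.indicator h with hH
  have mH : Measurable H := hh.indicator mB
  have hcv : ∀ x ∈ B, ∀ y ∈ B, h ((1 - s) • x + s • y) = H ((1 - s) • x + s • y) := by
    intro x hx y hy
    rw [hH, indicator_of_mem]
    exact (convex_ball (0 : E3) r) hx hy (by linarith) h0 (by ring)
  have e0 : ∫⁻ x in B, ∫⁻ y in B, h ((1 - s) • x + s • y) =
      ∫⁻ x in B, ∫⁻ y in B, H ((1 - s) • x + s • y) := by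
    refine setLIntegral_congr_fun mB fun x hx => ?_
    exact setLIntegral_congr_fun mB fun y hy => hcv x hx y hy
  rw [e0, ← lintegral_indicator mB h, ← hH]
  rcases le_total (1 / 2) s with hs | hs
  · calc _ ≤ ∫⁻ x in B, 8 * ∫⁻ y, H y := by
          refine lintegral_mono fun x => ?_
          exact (setLIntegral_le_lintegral _ _).trans (lintegral_affine mH _ hs)
      _ = _ := by simp; ring
  · rw [lintegral_lintegral_swap]
    · calc _ ≤ ∫⁻ x in B, 8 * ∫⁻ y, H y := by
            refine lintegral_mono fun y => ?_
            refine (setLIntegral_le_lintegral _ _).trans ?_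
            simp_rw [add_comm ((1 - s) • _) (s • y)]
            exact lintegral_affine mH _ (by linarith)
        _ = _ := by simp; ring
    · refine Measurable.aemeasurable ?_
      exact mH.comp (by fun_prop : Measurable fun p : E3 × E3 => (1 - s) • p.1 + s • p.2)

lemma jens {v : E3 → ℝ} (hv : Continuous v) {r : ℝ} (hr : 0 < r) (x : E3) :
    volume (ball (0 : E3) r) * ‖v x - ⨍ y in ball (0 : E3) r, v y‖ₑ ^ 2 ≤
      ∫⁻ y in ball (0 : E3) r, ‖v x - v y‖ₑ ^ 2 := by
  set B := ball (0 : E3) r with hB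
  have fin : volume B ≠ ∞ := measure_ball_lt_top.ne
  have pos : volume B ≠ 0 := (measure_ball_pos volume _ hr).ne'
  have hi : IntegrableOn v B :=
    (hv.continuousOn.integrableOn_compact (isCompact_closedBall 0 r)).mono_set ball_subset_closedBall
  have e : (volume.real B) * (v x - ⨍ y in B, v y) = ∫ y in B, (v x - v y) := by
    have hc : IntegrableOn (fun _ : E3 => v x) B := integrableOn_const fin (by finiteness)
    rw [integral_sub hc hi, setAverage_eq]
    have : volume.real B ≠ 0 := (ENNReal.toReal_pos pos fin).ne'
    simp; field_simp
  have e2 : volume B * ‖v x - ⨍ y in B, v y‖ₑ ≤ ∫⁻ y in B, ‖v x - v y‖ₑ := by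
    refine le_trans (le_of_eq ?_) (enorm_integral_le_lintegral_enorm _)
    rw [← e, enorm_mul, Real.enorm_of_nonneg (measureReal_nonneg : 0 ≤ volume.real B),
      Measure.real, ENNReal.ofReal_toReal fin]
  have e3 := (pow_le_pow_left' e2 2).trans (by
    have := cs (volume.restrict B) (f := fun _ => 1)
      (g := fun y => ‖v x - v y‖ₑ) measurable_const (by fun_prop)
    simpa using this)
  rw [mul_pow, sq (volume B), mul_assoc] at e3
  exact (ENNReal.mul_le_mul_iff_right pos fin).1 e3

lemma swap_rot {α β γ : Type*} [MeasurableSpace α] [MeasurableSpace β] [MeasurableSpace γ]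
    (μ : Measure α) (ν : Measure β) (τ : Measure γ) [SFinite μ] [SFinite ν] [SFinite τ]
    {F : α → β → γ → ℝ≥0∞} (h : Measurable (fun q : (α × γ) × β => F q.1.1 q.2 q.1.2)) :
    ∫⁻ x, ∫⁻ y, ∫⁻ s, F x y s ∂τ ∂ν ∂μ = ∫⁻ s, ∫⁻ x, ∫⁻ y, F x y s ∂ν ∂μ ∂τ := by
  have sw : ∀ x, ∫⁻ y, ∫⁻ s, F x y s ∂τ ∂ν = ∫⁻ s, ∫⁻ y, F x y s ∂ν ∂τ := by
    intro x
    refine lintegral_lintegral_swap (Measurable.aemeasurable ?_)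
    exact h.comp (by fun_prop : Measurable fun p : β × γ => ((x, p.2), p.1))
  simp_rw [sw]
  refine lintegral_lintegral_swap (Measurable.aemeasurable ?_)
  exact h.lintegral_prod_right'

lemma poincare {v : E3 → ℝ} (hv : ContDiff ℝ 1 v) {r : ℝ} (hr : 0 < r) :
    ∫⁻ x in ball (0 : E3) r, ‖v x - ⨍ y in ball (0 : E3) r, v y‖ₑ ^ 2 ≤
      ENNReal.ofReal (32 * r ^ 2) * ∫⁻ x in ball (0 : E3) r, ‖fderiv ℝ v x‖ₑ ^ 2 := by
  set B := ball (0 : E3) r with hB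
  have mB : MeasurableSet B := measurableSet_ball
  have fin : volume B ≠ ∞ := measure_ball_lt_top.ne
  have pos : volume B ≠ 0 := (measure_ball_pos volume _ hr).ne'
  have hcf := hv.continuous_fderiv (by norm_num : (1 : WithTop ℕ∞) ≠ 0)
  have hvc := hv.continuous
  rw [← ENNReal.mul_le_mul_iff_right pos fin, ← lintegral_const_mul' _ _ fin]
  calc _ ≤ ∫⁻ x in B, ∫⁻ y in B, ENNReal.ofReal (4 * r ^ 2) *
          ∫⁻ s : ℝ in Ioc 0 1, ‖fderiv ℝ v ((1 - s) • x + s • y)‖ₑ ^ 2 := by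
        refine setLIntegral_mono' mB fun x hx => (jens hvc hr x).trans ?_
        refine setLIntegral_mono' mB fun y hy => ?_
        rw [← enorm_neg, neg_sub]
        refine (line_sq hv x y).trans ?_
        gcongr
        rw [← ofReal_norm, ← ENNReal.ofReal_pow (norm_nonneg _)]
        apply ENNReal.ofReal_le_ofReal
        have hx' : ‖x‖ < r := by simpa [hB] using hx
        have hy' : ‖y‖ < r := by simpa [hB] using hy
        have := norm_sub_le y x
        calc ‖y - x‖ ^ 2 ≤ (2 * r) ^ 2 := by gcongr; linarith
          _ = _ := by ring
    _ = ENNReal.ofReal (4 * r ^ 2) * ∫⁻ s : ℝ in Ioc 0 1, ∫⁻ x in B, ∫⁻ y in B,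
          ‖fderiv ℝ v ((1 - s) • x + s • y)‖ₑ ^ 2 := by
        simp_rw [lintegral_const_mul' _ _ ENNReal.ofReal_ne_top]
        congr 1
        have mm : Measurable (fun q : (E3 × ℝ) × E3 => ‖fderiv ℝ v ((1 - q.1.2) • q.1.1 + q.1.2 • q.2)‖ₑ ^ 2) := by
          refine Measurable.pow_const (Continuous.measurable ?_) _
          exact (hcf.comp (by fun_prop)).enorm
        exact swap_rot _ _ _ mm
    _ ≤ ENNReal.ofReal (4 * r ^ 2) * ∫⁻ s : ℝ in Ioc 0 1,
          (8 * volume B * ∫⁻ x in B, ‖fderiv ℝ v x‖ₑ ^ 2) := by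
        refine mul_le_mul' le_rfl ?_
        refine setLIntegral_mono' measurableSet_Ioc fun s hs => ?_
        exact poinc_aux (h := fun x => ‖fderiv ℝ v x‖ₑ ^ 2) (hcf.enorm.measurable.pow_const _) r hs.1.le hs.2
    _ = _ := by
        simp only [lintegral_const, Measure.restrict_apply_univ, Real.volume_Ioc]
        have e : ENNReal.ofReal (32 * r ^ 2) = ENNReal.ofReal (4 * r ^ 2) * 8 := by
          rw [show 32 * r ^ 2 = (4 * r ^ 2) * 8 by ring,
            ENNReal.ofReal_mul (p := 4 * r ^ 2) (by positivity), ENNReal.ofReal_ofNat]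
        rw [e]
        simp only [sub_zero, ENNReal.ofReal_one, mul_one, ENNReal.ofReal_ofNat]
        ring

lemma add_pow_le2 (a b : ℝ≥0∞) (n : ℕ) : (a + b) ^ n ≤ 2 ^ n * (a ^ n + b ^ n) := by
  wlog h : a ≤ b generalizing a b
  · rw [add_comm a b, add_comm (a ^ n)]
    exact this b a (le_of_not_ge h)
  calc (a + b) ^ n ≤ (2 * b) ^ n := by rw [two_mul]; gcongr
    _ = 2 ^ n * b ^ n := mul_pow _ _ _
    _ ≤ _ := by gcongr; exact le_add_self

lemma enorm_avg {F : Type*} [NormedAddCommGroup F] [NormedSpace ℝ F] {v : E3 → F} {r : ℝ} (hr : 0 < r) :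
    volume (ball (0 : E3) r) * ‖⨍ y in ball (0 : E3) r, v y‖ₑ ≤ ∫⁻ y in ball (0 : E3) r, ‖v y‖ₑ := by
  set B := ball (0 : E3) r with hB
  have fin : volume B ≠ ∞ := measure_ball_lt_top.ne
  have pos : volume B ≠ 0 := (measure_ball_pos volume _ hr).ne'
  refine le_trans (le_of_eq ?_) (enorm_integral_le_lintegral_enorm _)
  have hh : 0 < volume.real B := ENNReal.toReal_pos pos fin
  rw [setAverage_eq, enorm_smul, Real.enorm_of_nonneg (inv_nonneg.2 hh.le),
    ENNReal.ofReal_inv_of_pos hh, Measure.real, ENNReal.ofReal_toReal fin, ← mul_assoc,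
    ENNReal.mul_inv_cancel pos fin, one_mul]

lemma enorm_avg_sq {v : E3 → ℝ} (hv : Measurable v) {r : ℝ} (hr : 0 < r) :
    volume (ball (0 : E3) r) * ‖⨍ y in ball (0 : E3) r, v y‖ₑ ^ 2 ≤
      ∫⁻ y in ball (0 : E3) r, ‖v y‖ₑ ^ 2 := by
  set B := ball (0 : E3) r with hB
  have fin : volume B ≠ ∞ := measure_ball_lt_top.ne
  have pos : volume B ≠ 0 := (measure_ball_pos volume _ hr).ne'
  have e3 := (pow_le_pow_left' (enorm_avg (v := v) hr) 2).trans (by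
    have := cs (volume.restrict B) (f := fun _ => 1)
      (g := fun y => ‖v y‖ₑ) measurable_const (by fun_prop)
    simpa using this)
  rw [mul_pow, sq (volume B), mul_assoc] at e3
  exact (ENNReal.mul_le_mul_iff_right pos fin).1 e3

lemma var_le {v : E3 → ℝ} (hv : Measurable v) {r : ℝ} (hr : 0 < r) :
    ∫⁻ x in ball (0 : E3) r, ‖v x - ⨍ y in ball (0 : E3) r, v y‖ₑ ^ 2 ≤
      8 * ∫⁻ x in ball (0 : E3) r, ‖v x‖ₑ ^ 2 := by
  set m := ⨍ y in ball (0 : E3) r, v y with hm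
  calc _ ≤ ∫⁻ x in ball (0 : E3) r, 2 ^ 2 * (‖v x‖ₑ ^ 2 + ‖m‖ₑ ^ 2) :=
        lintegral_mono fun x => (pow_le_pow_left' (enorm_sub_le) 2).trans (add_pow_le2 _ _ 2)
    _ = 4 * ((∫⁻ x in ball (0 : E3) r, ‖v x‖ₑ ^ 2) + volume (ball (0 : E3) r) * ‖m‖ₑ ^ 2) := by
        rw [lintegral_const_mul' _ _ (by norm_num), lintegral_add_right _ measurable_const]
        simp only [lintegral_const, Measure.restrict_apply_univ]
        rw [mul_comm (‖m‖ₑ ^ 2)]; norm_num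
    _ ≤ 4 * ((∫⁻ x in ball (0 : E3) r, ‖v x‖ₑ ^ 2) + ∫⁻ x in ball (0 : E3) r, ‖v x‖ₑ ^ 2) := by
        gcongr; exact enorm_avg_sq hv hr
    _ = _ := by ring

lemma clm_add (a b : E3 →L[ℝ] ℝ) : ‖a + b‖ₑ ≤ ‖a‖ₑ + ‖b‖ₑ := by
  rw [← ofReal_norm, ← ofReal_norm, ← ofReal_norm, ← ENNReal.ofReal_add (norm_nonneg _) (norm_nonneg _)]
  exact ENNReal.ofReal_le_ofReal (norm_add_le a b)

lemma clm_smul (c : ℝ) (a : E3 →L[ℝ] ℝ) : ‖c • a‖ₑ = ‖c‖ₑ * ‖a‖ₑ := by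
  rw [← ofReal_norm, ← ofReal_norm, ← ofReal_norm, ← ENNReal.ofReal_mul (norm_nonneg _), norm_smul]

lemma clm_zero : ‖(0 : E3 →L[ℝ] ℝ)‖ₑ = 0 := by
  rw [← ofReal_norm, norm_zero, ENNReal.ofReal_zero]

lemma cutoff : ∃ K : NNReal, ∀ ρ : ℝ, 0 < ρ → ∃ φ : E3 → ℝ, ContDiff ℝ 1 φ ∧
    (∀ x ∈ ball (0 : E3) (ρ / 2), φ x = 1) ∧ (∀ x, ‖φ x‖ ≤ 1) ∧
    tsupport φ ⊆ closedBall (0 : E3) (5 / 8 * ρ) ∧ ∀ x, ‖fderiv ℝ φ x‖ ≤ K / ρ := by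
  let Φ : ContDiffBump (0 : E3) := ⟨1 / 2, 5 / 8, by norm_num, by norm_num⟩
  have hΦ : ContDiff ℝ 1 Φ := Φ.contDiff
  obtain ⟨C, hC⟩ := (Φ.hasCompactSupport.fderiv ℝ).exists_bound_of_continuous
    (hΦ.continuous_fderiv (by norm_num))
  have hC0 : 0 ≤ C := (norm_nonneg _).trans (hC 0)
  refine ⟨⟨C, hC0⟩, fun ρ hρ => ⟨fun x => Φ (ρ⁻¹ • x), hΦ.comp (contDiff_const_smul _), ?_, ?_, ?_, ?_⟩⟩
  · intro x hx
    apply Φ.one_of_mem_closedBall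
    have : ‖x‖ < ρ / 2 := by simpa using hx
    simp only [mem_closedBall, dist_zero_right, norm_smul, norm_inv, Real.norm_eq_abs, abs_of_pos hρ]
    rw [inv_mul_le_iff₀ hρ]; show ‖x‖ ≤ ρ * (1 / 2); linarith
  · intro x
    rw [Real.norm_eq_abs, abs_of_nonneg Φ.nonneg]; exact Φ.le_one
  · refine closure_minimal ?_ isClosed_closedBall
    intro x hx
    by_contra h
    apply hx
    apply Φ.zero_of_le_dist
    have : 5 / 8 * ρ < ‖x‖ := by simpa using h
    simp only [dist_zero_right, norm_smul, norm_inv, Real.norm_eq_abs, abs_of_pos hρ]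
    rw [le_inv_mul_iff₀ hρ]; show ρ * (5 / 8) ≤ ‖x‖; linarith
  · intro x
    have : fderiv ℝ (fun x => Φ (ρ⁻¹ • x)) x = ρ⁻¹ • fderiv ℝ Φ (ρ⁻¹ • x) := by
      exact fderiv_comp_smul ..
    rw [this, norm_smul, norm_inv, Real.norm_eq_abs, abs_of_pos hρ, div_eq_inv_mul]
    gcongr
    exact hC _

lemma lemA {y1 y2 y3 : ℝ} (h1 : 0 < y1) (h2 : 0 < y2) (h3 : 0 < y3) (g1 : y1 < 1)
    (g2 : y2 < 1) (g3 : y3 < 1) (hs : y1 + y2 + y3 ≤ 2) : ∃ c : NNReal, ∀ ρ : ℝ, 0 < ρ →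
    ∀ v : E3 → ℝ, ContDiff ℝ 1 v → ∀ A : E3 → ℝ≥0∞, Measurable A →
    ∫⁻ x in ball (0 : E3) (ρ / 2), A x * ‖v x - ⨍ y in ball (0 : E3) (3 / 4 * ρ), v y‖ₑ ^ 2 ≤
      c * nN y1 y2 y3 (fun x y z => (ball (0 : E3) ρ).indicator A (pt3 x y z)) *
      (∫⁻ x in ball (0 : E3) (3 / 4 * ρ), ‖fderiv ℝ v x‖ₑ ^ 2) ^ ((y1 + y2 + y3) / 2) *
      (∫⁻ x in ball (0 : E3) (3 / 4 * ρ), ‖v x‖ₑ ^ 2) ^ (1 - (y1 + y2 + y3) / 2) := by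
  obtain ⟨c, hc⟩ := mixed_C1 h1 h2 h3 g1 g2 g3 hs
  obtain ⟨K, hK⟩ := cutoff
  set θ := (y1 + y2 + y3) / 2 with hθ
  refine ⟨c * (4 * (1 + 18 * K ^ 2)) ^ θ * 8 ^ (1 - θ), fun ρ hρ v hv A hA => ?_⟩
  obtain ⟨φ, hφ, hφ1, hφle, hφs, hφd⟩ := hK ρ hρ
  set r := 3 / 4 * ρ with hr
  have hr0 : 0 < r := by positivity
  set m := ⨍ y in ball (0 : E3) r, v y with hm
  set f : E3 → ℝ := fun x => φ x * (v x - m) with hf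
  have hfs : tsupport f ⊆ closedBall (0 : E3) (5 / 8 * ρ) :=
    (tsupport_mul_subset_left (f := φ) (g := fun x => v x - m)).trans hφs
  have hsub : closedBall (0 : E3) (5 / 8 * ρ) ⊆ ball 0 r := closedBall_subset_ball (by rw [hr]; linarith)
  have hfc : HasCompactSupport f :=
    (isCompact_closedBall _ _).of_isClosed_subset (isClosed_tsupport _) hfs
  have hfC : ContDiff ℝ 1 f := hφ.mul (hv.sub contDiff_const)
  have key := hc f hfC hfc _ (hA.indicator measurableSet_ball : Measurable ((ball (0 : E3) ρ).indicator A))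
  have D : ∫⁻ x, ‖fderiv ℝ f x‖ₑ ^ 2 ≤
      (4 * (1 + 18 * (K : ℝ≥0∞) ^ 2)) * ∫⁻ x in ball (0 : E3) r, ‖fderiv ℝ v x‖ₑ ^ 2 := by
    have pt : ∀ x, ‖fderiv ℝ f x‖ₑ ^ 2 ≤ (ball (0 : E3) r).indicator (fun x => 2 ^ 2 *
        (‖fderiv ℝ v x‖ₑ ^ 2 + ENNReal.ofReal (K / ρ) ^ 2 * ‖v x - m‖ₑ ^ 2)) x := by
      intro x
      by_cases hx : x ∈ ball (0 : E3) r
      · rw [indicator_of_mem hx, ← mul_pow]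
        refine (pow_le_pow_left' ?_ 2).trans (add_pow_le2 _ _ 2)
        have e : fderiv ℝ f x = φ x • fderiv ℝ v x + (v x - m) • fderiv ℝ φ x := by
          rw [hf, fderiv_fun_mul (hφ.differentiable one_ne_zero x)
            ((hv.sub contDiff_const).differentiable one_ne_zero x), fderiv_sub_const]
        rw [e]
        refine le_trans (clm_add _ _) (add_le_add ?_ ?_)
        · rw [clm_smul]
          refine mul_le_of_le_one_left' ?_
          rw [← ofReal_norm]; exact ENNReal.ofReal_le_one.2 (hφle x)
        · rw [clm_smul, mul_comm]
          gcongr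
          rw [← ofReal_norm]; exact ENNReal.ofReal_le_ofReal (hφd x)
      · have : fderiv ℝ f x = 0 := by
          by_contra h
          exact hx (hsub (hfs (support_fderiv_subset ℝ h)))
        rw [this, clm_zero]
        simp
    calc _ ≤ ∫⁻ x, (ball (0 : E3) r).indicator (fun x => 2 ^ 2 *
        (‖fderiv ℝ v x‖ₑ ^ 2 + ENNReal.ofReal (K / ρ) ^ 2 * ‖v x - m‖ₑ ^ 2)) x := lintegral_mono pt
      _ = 4 * ((∫⁻ x in ball (0 : E3) r, ‖fderiv ℝ v x‖ₑ ^ 2) +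
          ENNReal.ofReal (K / ρ) ^ 2 * ∫⁻ x in ball (0 : E3) r, ‖v x - m‖ₑ ^ 2) := by
        have hcf := hv.continuous_fderiv (by norm_num : (1 : WithTop ℕ∞) ≠ 0)
        rw [lintegral_indicator measurableSet_ball, lintegral_const_mul' _ _ (by norm_num),
          lintegral_add_left (hcf.enorm.measurable.pow_const _),
          lintegral_const_mul' _ _ (by finiteness)]
        norm_num
      _ ≤ 4 * ((∫⁻ x in ball (0 : E3) r, ‖fderiv ℝ v x‖ₑ ^ 2) +
          ENNReal.ofReal (K / ρ) ^ 2 * (ENNReal.ofReal (32 * r ^ 2) *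
            ∫⁻ x in ball (0 : E3) r, ‖fderiv ℝ v x‖ₑ ^ 2)) := by
        gcongr
        exact poincare hv hr0
      _ = _ := by
        have : ENNReal.ofReal (K / ρ) ^ 2 * ENNReal.ofReal (32 * r ^ 2) = 18 * (K : ℝ≥0∞) ^ 2 := by
          rw [← ENNReal.ofReal_pow (by positivity), ← ENNReal.ofReal_mul (by positivity)]
          rw [show (K / ρ : ℝ) ^ 2 * (32 * r ^ 2) = 18 * K ^ 2 by rw [hr]; field_simp; ring]
          rw [ENNReal.ofReal_mul (by norm_num), ENNReal.ofReal_pow (by positivity)]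
          simp
        rw [← mul_assoc, this]; ring
  have U : ∫⁻ x, ‖f x‖ₑ ^ 2 ≤ 8 * ∫⁻ x in ball (0 : E3) r, ‖v x‖ₑ ^ 2 := by
    refine le_trans ?_ (var_le hv.continuous.measurable hr0)
    rw [← lintegral_indicator measurableSet_ball]
    refine lintegral_mono fun x => ?_
    by_cases hx : x ∈ ball (0 : E3) r
    · rw [indicator_of_mem hx]
      gcongr
      rw [hf]; simp only [enorm_mul]
      refine mul_le_of_le_one_left' ?_
      rw [← ofReal_norm]; exact ENNReal.ofReal_le_one.2 (hφle x)
    · have : f x = 0 := by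
        by_contra h
        exact hx (hsub (hfs (subset_tsupport _ h)))
      simp [this]
  have hθ0 : 0 ≤ θ := by positivity
  have hθ1 : 0 ≤ 1 - θ := by rw [hθ]; linarith
  calc _ ≤ ∫⁻ x, (ball (0 : E3) ρ).indicator A x * ‖f x‖ₑ ^ 2 := by
        rw [← lintegral_indicator measurableSet_ball]
        refine lintegral_mono (indicator_le fun x hx => ?_)
        rw [indicator_of_mem (ball_subset_ball (by linarith) hx), hf]
        simp [hφ1 x hx]
    _ ≤ _ := key
    _ ≤ c * nN y1 y2 y3 (fun x y z => (ball (0 : E3) ρ).indicator A (pt3 x y z)) *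
      ((4 * (1 + 18 * (K : ℝ≥0∞) ^ 2)) * ∫⁻ x in ball (0 : E3) r, ‖fderiv ℝ v x‖ₑ ^ 2) ^ θ *
      (8 * ∫⁻ x in ball (0 : E3) r, ‖v x‖ₑ ^ 2) ^ (1 - θ) := by gcongr
    _ = _ := by
        rw [ENNReal.mul_rpow_of_nonneg _ _ hθ0, ENNReal.mul_rpow_of_nonneg _ _ hθ1]
        push_cast [ENNReal.coe_rpow_of_nonneg _ hθ0, ENNReal.coe_rpow_of_nonneg _ hθ1]
        ring

/-- Convolution of scalar functions on `E3`. -/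
def cv (η W : E3 → ℝ) : E3 → ℝ :=
  MeasureTheory.convolution η W (ContinuousLinearMap.lsmul ℝ ℝ) volume

lemma cv_eq (η W : E3 → ℝ) (x : E3) : cv η W x = ∫ t, η t * W (x - t) := rfl

lemma cv_swap (η W : E3 → ℝ) (x : E3) : cv η W x = ∫ t, η (x - t) * W t := by
  rw [cv, convolution_lsmul_swap]; rfl

/-- Mollifier. -/
structure Moll (η : E3 → ℝ) : Prop where
  smooth : ContDiff ℝ (⊤ : ℕ∞) η
  supp : HasCompactSupport η
  mass : ∫⁻ x, ‖η x‖ₑ = 1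

lemma cv_enorm {η W : E3 → ℝ} (h : Moll η) (x : E3) :
    ‖cv η W x‖ₑ ≤ ∫⁻ t, ‖W (x - t)‖ₑ ∂(volume.withDensity fun t => ‖η t‖ₑ) := by
  rw [cv_eq]
  refine (enorm_integral_le_lintegral_enorm _).trans ?_
  rw [lintegral_withDensity_eq_lintegral_mul_non_measurable _ h.smooth.continuous.enorm.measurable
    (by simp)]
  simp [enorm_mul]

lemma cv_one {η W : E3 → ℝ} (h : Moll η) (hW : Measurable W) :
    ∫⁻ x, ‖cv η W x‖ₑ ≤ ∫⁻ x, ‖W x‖ₑ := by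
  have pr : (volume.withDensity fun t => ‖η t‖ₑ) univ = 1 := by
    rw [withDensity_apply _ MeasurableSet.univ]; simp [h.mass]
  have : IsProbabilityMeasure (volume.withDensity fun t => ‖η t‖ₑ) := ⟨pr⟩
  refine (lintegral_mono fun x => cv_enorm h x).trans ?_
  rw [lintegral_lintegral_swap (by
    refine (Measurable.aemeasurable ?_)
    exact (hW.comp (by fun_prop : Measurable fun p : E3 × E3 => p.1 - p.2)).enorm)]
  have : ∀ t, ∫⁻ x, ‖W (x - t)‖ₑ = ∫⁻ x, ‖W x‖ₑ := fun t =>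
    lintegral_sub_right_eq_self (fun x => ‖W x‖ₑ) t
  simp only [this, lintegral_const, pr, mul_one, le_refl]

lemma cv_two {η W : E3 → ℝ} (h : Moll η) (hW : Measurable W) :
    ∫⁻ x, ‖cv η W x‖ₑ ^ 2 ≤ ∫⁻ x, ‖W x‖ₑ ^ 2 := by
  have pr : (volume.withDensity fun t => ‖η t‖ₑ) univ = 1 := by
    rw [withDensity_apply _ MeasurableSet.univ]; simp [h.mass]
  have : IsProbabilityMeasure (volume.withDensity fun t => ‖η t‖ₑ) := ⟨pr⟩
  have pt : ∀ x, ‖cv η W x‖ₑ ^ 2 ≤ ∫⁻ t, ‖W (x - t)‖ₑ ^ 2 ∂(volume.withDensity fun t => ‖η t‖ₑ) := by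
    intro x
    refine (pow_le_pow_left' (cv_enorm h x) 2).trans ?_
    have := cs (volume.withDensity fun t => ‖η t‖ₑ) (f := fun _ => 1)
      (g := fun t => ‖W (x - t)‖ₑ) measurable_const (by fun_prop)
    simpa [pr] using this
  refine (lintegral_mono pt).trans ?_
  rw [lintegral_lintegral_swap (by
    refine (Measurable.aemeasurable ?_)
    exact ((hW.comp (by fun_prop : Measurable fun p : E3 × E3 => p.1 - p.2)).enorm).pow_const _)]
  have : ∀ t, ∫⁻ x, ‖W (x - t)‖ₑ ^ 2 = ∫⁻ x, ‖W x‖ₑ ^ 2 := fun t =>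
    lintegral_sub_right_eq_self (fun x => ‖W x‖ₑ ^ 2) t
  simp only [this, lintegral_const, pr, mul_one, le_refl]

lemma cv_smooth {η W : E3 → ℝ} (h : Moll η) (hW : LocallyIntegrable W) : ContDiff ℝ 1 (cv η W) :=
  h.supp.contDiff_convolution_left _ (h.smooth.of_le (by exact_mod_cast le_top)) hW

lemma cv_cont {η W : E3 → ℝ} (h : Moll η) (hW : LocallyIntegrable W) : Continuous (cv η W) :=
  (cv_smooth h hW).continuous

lemma cv_fderiv {η W : E3 → ℝ} (h : Moll η) (hW : LocallyIntegrable W) (x e : E3) :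
    fderiv ℝ (cv η W) x e = ∫ t, fderiv ℝ η (x - t) e * W t := by
  have h1 : ContDiff ℝ 1 η := h.smooth.of_le (by exact_mod_cast le_top)
  have := (h.supp.hasFDerivAt_convolution_left (ContinuousLinearMap.lsmul ℝ ℝ) h1 hW x).fderiv
  rw [cv, this]
  rw [convolution_eq_swap]
  have ex := (h.supp.fderiv ℝ).convolutionExists_left
    ((ContinuousLinearMap.lsmul ℝ ℝ : ℝ →L[ℝ] ℝ →L[ℝ] ℝ).precompL E3) (h1.continuous_fderiv (by norm_num)) hW x
  rw [ContinuousLinearMap.integral_apply ex.integrable_swap]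
  rfl

lemma pd_refl {η : E3 → ℝ} (h : Moll η) (j : Fin 3) (x z : E3) :
    pd j (fun z => η (x - z)) z = - fderiv ℝ η (x - z) (EuclideanSpace.single j 1) := by
  have h1 : HasFDerivAt η (fderiv ℝ η (x - z)) (x - z) :=
    ((h.smooth.differentiable (by simp)) (x - z)).hasFDerivAt
  have h2 : HasFDerivAt (fun z => x - z) (-ContinuousLinearMap.id ℝ E3) z :=
    (hasFDerivAt_id z).const_sub x
  have := (h1.comp z h2).fderiv
  rw [pd]
  have e : (fun z => η (x - z)) = η ∘ (fun z => x - z) := rfl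
  rw [e, this]; simp

lemma clm_norm_sq (L : E3 →L[ℝ] ℝ) :
    ‖L‖ₑ ^ 2 ≤ ∑ j : Fin 3, ‖L (EuclideanSpace.single j 1)‖ₑ ^ 2 := by
  have e : ∑ j : Fin 3, ‖L (EuclideanSpace.single j 1)‖ₑ ^ 2 =
      ENNReal.ofReal (∑ j : Fin 3, (L (EuclideanSpace.single j 1)) ^ 2) := by
    rw [ENNReal.ofReal_sum_of_nonneg (fun _ _ => sq_nonneg _)]
    refine Finset.sum_congr rfl fun j _ => ?_
    rw [← ofReal_norm, ← ENNReal.ofReal_pow (norm_nonneg _), Real.norm_eq_abs, sq_abs]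
  rw [e, ← ofReal_norm, ← ENNReal.ofReal_pow (norm_nonneg _)]
  apply ENNReal.ofReal_le_ofReal
  set S := ∑ j : Fin 3, (L (EuclideanSpace.single j 1)) ^ 2 with hS
  have hS0 : 0 ≤ S := Finset.sum_nonneg fun _ _ => sq_nonneg _
  have : ‖L‖ ≤ √S := by
    refine L.opNorm_le_bound (Real.sqrt_nonneg _) fun x => ?_
    have hx : L x = ∑ j : Fin 3, x j * L (EuclideanSpace.single j 1) := by
      conv_lhs => rw [← (EuclideanSpace.basisFun (Fin 3) ℝ).sum_repr x]
      simp [map_sum]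
    rw [hx, Real.norm_eq_abs]
    apply abs_le_of_sq_le_sq ?_ (by positivity)
    rw [mul_pow, Real.sq_sqrt hS0, EuclideanSpace.norm_sq_eq, mul_comm]
    simpa using Finset.sum_mul_sq_le_sq_mul_sq Finset.univ (fun j => x j) (fun j => L (EuclideanSpace.single j 1))
  calc ‖L‖ ^ 2 ≤ √S ^ 2 := by gcongr
    _ = S := Real.sq_sqrt hS0

/-- Shrinking bumps. -/
def bmp (ρ : ℝ) (hρ : 0 < ρ) (n : ℕ) : ContDiffBump (0 : E3) :=
  ⟨ρ / (8 * (n + 2)), ρ / (4 * (n + 2)), by positivity, by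
    apply div_lt_div_of_pos_left hρ <;> nlinarith [(Nat.cast_nonneg n : (0 : ℝ) ≤ n)]⟩

/-- Normalized shrinking bumps. -/
def et (ρ : ℝ) (hρ : 0 < ρ) (n : ℕ) : E3 → ℝ := (bmp ρ hρ n).normed volume

lemma et_moll (ρ : ℝ) (hρ : 0 < ρ) (n : ℕ) : Moll (et ρ hρ n) where
  smooth := (bmp ρ hρ n).contDiff_normed
  supp := (bmp ρ hρ n).hasCompactSupport_normed
  mass := by
    have h0 : 0 ≤ᵐ[volume] et ρ hρ n := .of_forall fun x => (bmp ρ hρ n).nonneg_normed x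
    have hi : Integrable (et ρ hρ n) := (bmp ρ hρ n).integrable_normed
    have := ofReal_integral_eq_lintegral_ofReal hi h0
    have e : ∫ x, et ρ hρ n x = 1 := (bmp ρ hρ n).integral_normed
    rw [e, ENNReal.ofReal_one] at this
    rw [this]
    exact lintegral_congr fun x => Real.enorm_of_nonneg ((bmp ρ hρ n).nonneg_normed x)

lemma et_tsupp (ρ : ℝ) (hρ : 0 < ρ) (n : ℕ) : tsupport (et ρ hρ n) ⊆ closedBall 0 (ρ / 8) := by
  rw [et, (bmp ρ hρ n).tsupport_normed_eq]
  apply closedBall_subset_closedBall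
  show ρ / (4 * (n + 2)) ≤ ρ / 8
  apply div_le_div_of_nonneg_left hρ.le <;> nlinarith [(Nat.cast_nonneg n : (0 : ℝ) ≤ n)]

lemma et_conv (ρ : ℝ) (hρ : 0 < ρ) {W : E3 → ℝ} (hW : LocallyIntegrable W) :
    ∀ᵐ x, Tendsto (fun n => cv (et ρ hρ n) W x) atTop (nhds (W x)) := by
  refine ContDiffBump.ae_convolution_tendsto_right_of_locallyIntegrable (φ := bmp ρ hρ) (K := 2)
    ?_ ?_ hW
  · show Tendsto (fun n : ℕ => ρ / (4 * ((n : ℝ) + 2))) atTop (nhds 0)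
    refine Tendsto.div_atTop tendsto_const_nhds ?_
    refine Tendsto.const_mul_atTop (by norm_num) ?_
    exact tendsto_atTop_add_const_right _ _ tendsto_natCast_atTop_atTop
  · refine .of_forall fun n => ?_
    show ρ / (4 * ((n : ℝ) + 2)) ≤ 2 * (ρ / (8 * (n + 2)))
    have : (0 : ℝ) < n + 2 := by positivity
    apply le_of_eq; field_simp; norm_num

lemma grad_cv {ρ : ℝ} {η w : E3 → ℝ} (h : Moll η) {g : Fin 3 → E3 → ℝ}
    (iw : IntegrableOn w (ball (0 : E3) ρ)) (ig : ∀ j, IntegrableOn (g j) (ball (0 : E3) ρ))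
    {D : Set E3} (hD : Dense D)
    (H : ∀ x ∈ D, x ∈ ball (0 : E3) (3 / 4 * ρ) → ∀ j,
      ∫ z in ball (0 : E3) ρ, w z * pd j (fun z => η (x - z)) z =
        - ∫ z in ball (0 : E3) ρ, g j z * η (x - z)) :
    ∀ x ∈ ball (0 : E3) (3 / 4 * ρ), ∀ j,
      fderiv ℝ (cv η ((ball (0 : E3) ρ).indicator w)) x (EuclideanSpace.single j 1) =
        cv η ((ball (0 : E3) ρ).indicator (g j)) x := by
  intro x hx j
  have mB : MeasurableSet (ball (0 : E3) ρ) := measurableSet_ball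
  have lW : LocallyIntegrable ((ball (0 : E3) ρ).indicator w) :=
    (iw.integrable_indicator mB).locallyIntegrable
  have lG : LocallyIntegrable ((ball (0 : E3) ρ).indicator (g j)) :=
    ((ig j).integrable_indicator mB).locallyIntegrable
  have c1 : Continuous fun x => fderiv ℝ (cv η ((ball (0 : E3) ρ).indicator w)) x
      (EuclideanSpace.single j 1) :=
    ((cv_smooth h lW).continuous_fderiv (by norm_num)).clm_apply continuous_const
  have c2 := cv_cont h lG
  have cl : IsClosed {x | fderiv ℝ (cv η ((ball (0 : E3) ρ).indicator w)) x
      (EuclideanSpace.single j 1) = cv η ((ball (0 : E3) ρ).indicator (g j)) x} := isClosed_eq c1 c2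
  have sub : ball (0 : E3) (3 / 4 * ρ) ∩ D ⊆ {x | fderiv ℝ (cv η ((ball (0 : E3) ρ).indicator w)) x
      (EuclideanSpace.single j 1) = cv η ((ball (0 : E3) ρ).indicator (g j)) x} := by
    rintro x ⟨hx, hxD⟩
    have := H x hxD hx j
    simp only [pd_refl h, mul_neg, integral_neg, neg_inj] at this
    rw [← integral_indicator mB, ← integral_indicator mB] at this
    show fderiv ℝ (cv η ((ball (0 : E3) ρ).indicator w)) x (EuclideanSpace.single j 1) = cv η ((ball (0 : E3) ρ).indicator (g j)) x
    rw [cv_fderiv h lW, cv_swap]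
    refine (integral_congr_ae (.of_forall fun z => ?_)).trans
      (this.trans (integral_congr_ae (.of_forall fun z => ?_)))
    · by_cases hz : z ∈ ball (0 : E3) ρ <;> simp only [indicator_of_mem, indicator_of_notMem, hz,
        not_false_eq_true, zero_mul, mul_comm]
    · by_cases hz : z ∈ ball (0 : E3) ρ <;> simp only [indicator_of_mem, indicator_of_notMem, hz,
        not_false_eq_true, zero_mul, mul_comm]
  exact (closure_minimal sub cl) (hD.open_subset_closure_inter isOpen_ball hx)

lemma ind_lint {B : Set E3} (hB : MeasurableSet B) (w : E3 → ℝ) (k : ℕ) (hk : k ≠ 0) :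
    ∫⁻ x, ‖B.indicator w x‖ₑ ^ k = ∫⁻ x in B, ‖w x‖ₑ ^ k := by
  rw [← lintegral_indicator hB]
  refine lintegral_congr fun x => ?_
  by_cases hx : x ∈ B <;> simp [hx, hk]

lemma lemS {y1 y2 y3 : ℝ} (h1 : 0 < y1) (h2 : 0 < y2) (h3 : 0 < y3) (g1 : y1 < 1)
    (g2 : y2 < 1) (g3 : y3 < 1) (hs : y1 + y2 + y3 ≤ 2) : ∃ c : NNReal, ∀ ρ : ℝ, ∀ hρ : 0 < ρ,
    ∀ (w : E3 → ℝ) (g : Fin 3 → E3 → ℝ), Measurable w → (∀ j, Measurable (g j)) →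
    IntegrableOn w (ball (0 : E3) ρ) → (∀ j, IntegrableOn (g j) (ball (0 : E3) ρ)) →
    ∀ D : Set E3, Dense D →
    (∀ n, ∀ x ∈ D, x ∈ ball (0 : E3) (3 / 4 * ρ) → ∀ j,
      ∫ z in ball (0 : E3) ρ, w z * pd j (fun z => et ρ hρ n (x - z)) z =
        - ∫ z in ball (0 : E3) ρ, g j z * et ρ hρ n (x - z)) →
    ∃ m : ℝ, volume (ball (0 : E3) (3 / 4 * ρ)) * ‖m‖ₑ ≤ ∫⁻ x in ball (0 : E3) ρ, ‖w x‖ₑ ∧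
    ∀ A : E3 → ℝ≥0∞, Measurable A → (∀ x, A x ≠ ∞) →
    ∫⁻ x in ball (0 : E3) (ρ / 2), A x * ‖w x - m‖ₑ ^ 2 ≤
      c * nN y1 y2 y3 (fun x y z => (ball (0 : E3) ρ).indicator A (pt3 x y z)) *
      (∑ j, ∫⁻ x in ball (0 : E3) ρ, ‖g j x‖ₑ ^ 2) ^ ((y1 + y2 + y3) / 2) *
      (∫⁻ x in ball (0 : E3) ρ, ‖w x‖ₑ ^ 2) ^ (1 - (y1 + y2 + y3) / 2) := by
  obtain ⟨c, hc⟩ := lemA h1 h2 h3 g1 g2 g3 hs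
  refine ⟨c, fun ρ hρ w g mw mg iw ig D hD H => ?_⟩
  set B := ball (0 : E3) ρ with hB
  set r := 3 / 4 * ρ with hr
  have hr0 : 0 < r := by positivity
  have mB : MeasurableSet B := measurableSet_ball
  set W := B.indicator w with hW
  have lW : LocallyIntegrable W := (iw.integrable_indicator mB).locallyIntegrable
  have mW : Measurable W := mw.indicator mB
  set v : ℕ → E3 → ℝ := fun n => cv (et ρ hρ n) W with hv
  have hη := et_moll ρ hρ
  have vC : ∀ n, ContDiff ℝ 1 (v n) := fun n => cv_smooth (hη n) lW
  set cc : ℕ → ℝ := fun n => ⨍ y in ball (0 : E3) r, v n y with hcc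
  have W1 : ∫⁻ x, ‖W x‖ₑ = ∫⁻ x in B, ‖w x‖ₑ := by simpa using ind_lint mB w 1 one_ne_zero
  have W2 : ∫⁻ x, ‖W x‖ₑ ^ 2 = ∫⁻ x in B, ‖w x‖ₑ ^ 2 := ind_lint mB w 2 two_ne_zero
  have cb : ∀ n, volume (ball (0 : E3) r) * ‖cc n‖ₑ ≤ ∫⁻ x in B, ‖w x‖ₑ := fun n => by
    refine (enorm_avg hr0).trans ((setLIntegral_le_lintegral _ _).trans ?_)
    rw [← W1]
    exact cv_one (hη n) mW
  have Vp : volume (ball (0 : E3) r) ≠ 0 := (measure_ball_pos volume _ hr0).ne'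
  have Vf : volume (ball (0 : E3) r) ≠ ∞ := measure_ball_lt_top.ne
  have fin : ∫⁻ x in B, ‖w x‖ₑ ≠ ∞ := iw.2.ne
  obtain ⟨m, -, φ, hφ, hm⟩ := tendsto_subseq_of_bounded (x := cc)
    (isBounded_closedBall (x := (0 : ℝ)) (r := ((∫⁻ x in B, ‖w x‖ₑ) / volume (ball (0 : E3) r)).toReal))
    (fun n => by
      rw [mem_closedBall, dist_zero_right, ← toReal_enorm]
      apply ENNReal.toReal_mono (ENNReal.div_lt_top fin Vp).ne
      rw [ENNReal.le_div_iff_mul_le (.inl Vp) (.inl Vf), mul_comm]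
      exact cb n)
  refine ⟨m, ?_, fun A mA fA => ?_⟩
  · have : Tendsto (fun n => volume (ball (0 : E3) r) * ‖(cc ∘ φ) n‖ₑ) atTop
        (nhds (volume (ball (0 : E3) r) * ‖m‖ₑ)) :=
      ENNReal.Tendsto.const_mul ((continuous_enorm.tendsto m).comp hm) (.inr Vf)
    exact le_of_tendsto' this fun n => cb _
  set θ := (y1 + y2 + y3) / 2 with hθ
  have hθ0 : 0 ≤ θ := by positivity
  have hθ1 : 0 ≤ 1 - θ := by rw [hθ]; linarith
  set R := c * nN y1 y2 y3 (fun x y z => (ball (0 : E3) ρ).indicator A (pt3 x y z)) *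
      (∑ j, ∫⁻ x in ball (0 : E3) ρ, ‖g j x‖ₑ ^ 2) ^ θ *
      (∫⁻ x in ball (0 : E3) ρ, ‖w x‖ₑ ^ 2) ^ (1 - θ) with hR
  have bd : ∀ n, ∫⁻ x in ball (0 : E3) (ρ / 2), A x * ‖v n x - cc n‖ₑ ^ 2 ≤ R := by
    intro n
    refine (hc ρ hρ (v n) (vC n) A mA).trans ?_
    rw [hR]
    refine mul_le_mul' (mul_le_mul' le_rfl (ENNReal.rpow_le_rpow ?_ hθ0)) (ENNReal.rpow_le_rpow ?_ hθ1)
    · have gr := grad_cv (hη n) iw ig hD (H n)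
      calc _ ≤ ∫⁻ x in ball (0 : E3) r, ∑ j : Fin 3, ‖cv (et ρ hρ n) (B.indicator (g j)) x‖ₑ ^ 2 := by
            refine setLIntegral_mono' measurableSet_ball fun x hx => ?_
            refine (clm_norm_sq _).trans (le_of_eq (Finset.sum_congr rfl fun j _ => ?_))
            rw [← gr x hx j]
        _ ≤ ∫⁻ x, ∑ j : Fin 3, ‖cv (et ρ hρ n) (B.indicator (g j)) x‖ₑ ^ 2 :=
            setLIntegral_le_lintegral _ _
        _ = ∑ j : Fin 3, ∫⁻ x, ‖cv (et ρ hρ n) (B.indicator (g j)) x‖ₑ ^ 2 := by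
            refine lintegral_finsetSum _ fun j _ => ?_
            exact (cv_cont (hη n) ((ig j).integrable_indicator mB).locallyIntegrable).enorm.measurable.pow_const _
        _ ≤ _ := by
            refine Finset.sum_le_sum fun j _ => ?_
            rw [← ind_lint mB (g j) 2 two_ne_zero]
            exact cv_two (hη n) ((mg j).indicator mB)
    · refine (setLIntegral_le_lintegral _ _).trans ?_
      rw [← W2]
      exact cv_two (hη n) mW
  have lim : ∀ᵐ x ∂(volume.restrict (ball (0 : E3) (ρ / 2))),
      A x * ‖w x - m‖ₑ ^ 2 = liminf (fun n => A x * ‖v (φ n) x - cc (φ n)‖ₑ ^ 2) atTop := by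
    filter_upwards [ae_restrict_of_ae (et_conv ρ hρ lW), ae_restrict_mem measurableSet_ball] with x hx hxb
    have e : W x = w x := indicator_of_mem (ball_subset_ball (by linarith) hxb) _
    rw [e] at hx
    refine (Tendsto.liminf_eq ?_).symm
    refine ENNReal.Tendsto.const_mul ?_ (.inr (fA x))
    refine ENNReal.Tendsto.pow ?_
    exact (continuous_enorm.tendsto _).comp ((hx.comp hφ.tendsto_atTop).sub hm)
  rw [lintegral_congr_ae lim]
  refine (lintegral_liminf_le fun n => ?_).trans ?_
  · exact mA.mul (((vC (φ n)).continuous.sub continuous_const).enorm.measurable.pow_const _)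
  · exact liminf_le_of_le (by isBoundedDefault) fun b hb => by
      obtain ⟨n, hn⟩ := hb.exists
      exact hn.trans (bd _)

lemma test_ok {ρ : ℝ} {η : E3 → ℝ} (h : Moll η) (hs : tsupport η ⊆ closedBall 0 (ρ / 8))
    {x : E3} (hx : x ∈ ball (0 : E3) (3 / 4 * ρ)) {χ : ℝ → ℝ} (hχ : ContDiff ℝ (⊤ : ℕ∞) χ)
    (hc : HasCompactSupport χ) (hI : tsupport χ ⊆ Ioo (-(ρ ^ 2)) 0) :
    IsTest ρ (fun z t => η (x - z) * χ t) := by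
  have sub : tsupport (fun z : E3 × ℝ => η (x - z.1) * χ z.2) ⊆ closedBall x (ρ / 8) ×ˢ tsupport χ := by
    refine closure_minimal ?_ (isClosed_closedBall.prod (isClosed_tsupport _))
    rintro ⟨z, t⟩ hz
    simp only [Function.mem_support, ne_eq, mul_eq_zero, not_or] at hz
    refine ⟨?_, subset_tsupport _ hz.2⟩
    have := hs (subset_tsupport _ hz.1)
    rw [mem_closedBall, dist_zero_right] at this
    rw [mem_closedBall, dist_comm, dist_eq_norm]; exact this
  refine ⟨?_, ?_, sub.trans (prod_mono ?_ hI)⟩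
  · exact (h.smooth.comp (contDiff_const.sub contDiff_fst)).mul (hχ.comp contDiff_snd)
  · exact ((isCompact_closedBall x (ρ / 8)).prod hc).of_isClosed_subset (isClosed_tsupport _) sub
  · intro z hz
    rw [mem_closedBall, dist_eq_norm] at hz
    rw [mem_ball, dist_zero_right] at hx ⊢
    have : ‖z‖ ≤ ‖z - x‖ + ‖x‖ := by simpa using norm_add_le (z - x) x
    have hp : 0 ≤ ‖x‖ := norm_nonneg x
    nlinarith

lemma slice_id {ρ : ℝ} {F G : E3 → ℝ → ℝ} (j : Fin 3)
    (iF : Integrable (fun q : ℝ × E3 => F q.2 q.1)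
      ((volume.restrict (Ioo (-(ρ ^ 2)) 0)).prod (volume.restrict (ball (0 : E3) ρ))))
    (iG : Integrable (fun q : ℝ × E3 => G q.2 q.1)
      ((volume.restrict (Ioo (-(ρ ^ 2)) 0)).prod (volume.restrict (ball (0 : E3) ρ))))
    (H : ∀ φ : E3 → ℝ → ℝ, IsTest ρ φ →
      (∫ t in Ioo (-(ρ^2)) 0, ∫ x in ball (0 : E3) ρ, F x t * pd j (fun y => φ y t) x)
        = - ∫ t in Ioo (-(ρ^2)) 0, ∫ x in ball (0 : E3) ρ, G x t * φ x t)
    {η : E3 → ℝ} (h : Moll η) (hs : tsupport η ⊆ closedBall 0 (ρ / 8))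
    {x : E3} (hx : x ∈ ball (0 : E3) (3 / 4 * ρ)) :
    ∀ᵐ t ∂(volume.restrict (Ioo (-(ρ ^ 2)) 0)),
      ∫ z in ball (0 : E3) ρ, F z t * pd j (fun z => η (x - z)) z =
        - ∫ z in ball (0 : E3) ρ, G z t * η (x - z) := by
  set I := Ioo (-(ρ ^ 2)) 0 with hI
  set B := ball (0 : E3) ρ with hB
  have hη1 : ContDiff ℝ 1 η := h.smooth.of_le (by exact_mod_cast le_top)
  have hηf := hη1.continuous_fderiv (by norm_num : (1 : WithTop ℕ∞) ≠ 0)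
  have cpd : Continuous fun z => pd j (fun z => η (x - z)) z := by
    simp only [pd_refl h]
    exact ((hηf.comp (continuous_const.sub continuous_id)).clm_apply continuous_const).neg
  obtain ⟨C1, hC1⟩ := h.supp.exists_bound_of_continuous h.smooth.continuous
  obtain ⟨C2, hC2⟩ := (h.supp.fderiv ℝ).exists_bound_of_continuous hηf
  have bpd : ∀ z, ‖pd j (fun z => η (x - z)) z‖ ≤ C2 := by
    intro z
    rw [pd_refl h, norm_neg]
    refine (ContinuousLinearMap.le_opNorm _ _).trans ?_
    simpa using hC2 (x - z)
  have i1 : Integrable (fun q : ℝ × E3 => F q.2 q.1 * pd j (fun z => η (x - z)) q.2)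
      ((volume.restrict I).prod (volume.restrict B)) :=
    iF.mul_bdd (c := C2) ((cpd.comp continuous_snd).aestronglyMeasurable) (.of_forall fun q => bpd _)
  have i2 : Integrable (fun q : ℝ × E3 => G q.2 q.1 * η (x - q.2))
      ((volume.restrict I).prod (volume.restrict B)) :=
    iG.mul_bdd (c := C1) ((h.smooth.continuous.comp
      (continuous_const.sub continuous_snd)).aestronglyMeasurable) (.of_forall fun q => hC1 _)
  have j1 := i1.integral_prod_left
  have j2 := i2.integral_prod_left
  have key := isOpen_Ioo.ae_eq_zero_of_integral_contDiff_smul_eq_zero (μ := volume)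
    (U := I) (f := fun t => (∫ z in B, F z t * pd j (fun z => η (x - z)) z) + ∫ z in B, G z t * η (x - z))
    (IntegrableOn.locallyIntegrableOn (j1.add j2)) (by
      intro χ hχ hc hsupp
      have t := H _ (test_ok h hs hx hχ hc hsupp)
      have e1 : ∀ t z, pd j (fun y => η (x - y) * χ t) z = pd j (fun z => η (x - z)) z * χ t := by
        intro t z
        have hd : DifferentiableAt ℝ (fun y => η (x - y)) z :=
          (hη1.comp (contDiff_const.sub contDiff_id)).differentiable (by norm_num) z
        rw [pd, pd, fderiv_mul_const hd]; simp [mul_comm]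
      simp only [e1, ← mul_assoc, integral_mul_const] at t
      have hz : ∀ t, t ∉ I → χ t = 0 := fun t ht => by
        by_contra hne; exact ht (hsupp (subset_tsupport _ hne))
      obtain ⟨C3, hC3⟩ := hc.exists_bound_of_continuous hχ.continuous
      rw [← setIntegral_eq_integral_of_forall_compl_eq_zero (s := I) (fun t ht => by simp [hz t ht])]
      simp only [smul_eq_mul, mul_add]
      have k1 := j1.bdd_mul (c := C3) hχ.continuous.aestronglyMeasurable (.of_forall hC3)
      have k2 := j2.bdd_mul (c := C3) hχ.continuous.aestronglyMeasurable (.of_forall hC3)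
      rw [integral_add k1 k2]
      simp only [mul_comm (χ _)]
      rw [t]; simp)
  rw [ae_restrict_iff' measurableSet_Ioo]
  filter_upwards [key] with t ht htI
  linarith [ht htI]

lemma slices {ρ : ℝ} (hρ : 0 < ρ) {u : E3 → ℝ → E3} {P : E3 → ℝ → ℝ}
    (sol : SuitableWeakSolution ρ u P) : ∃ D : Set E3, Dense D ∧
    ∀ᵐ t ∂(volume.restrict (Ioo (-(ρ ^ 2)) 0)),
      (∀ i, IntegrableOn (fun x => u x t i) (ball (0 : E3) ρ)) ∧
      (∀ i j, IntegrableOn (fun x => sol.gu x t i j) (ball (0 : E3) ρ)) ∧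
      ∀ i, ∀ n, ∀ x ∈ D, x ∈ ball (0 : E3) (3 / 4 * ρ) → ∀ j,
      ∫ z in ball (0 : E3) ρ, u z t i * pd j (fun z => et ρ hρ n (x - z)) z =
        - ∫ z in ball (0 : E3) ρ, sol.gu z t i j * et ρ hρ n (x - z) := by
  obtain ⟨D, hDc, hD⟩ := TopologicalSpace.exists_countable_dense E3
  refine ⟨D, hD, ?_⟩
  set I := Ioo (-(ρ ^ 2)) 0 with hI
  set B := ball (0 : E3) ρ with hB
  have fB : volume B ≠ ∞ := measure_ball_lt_top.ne
  have fI : volume I ≠ ∞ := measure_Ioo_lt_top.ne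
  have gen : ∀ (F : ℝ × E3 → ℝ) (K : ℝ → E3 → ℝ≥0∞), Measurable F →
      (∀ t x, ‖F (t, x)‖ₑ ^ 2 ≤ K t x) → (∫⁻ t in I, ∫⁻ x in B, K t x) ≠ ∞ →
      Integrable F ((volume.restrict I).prod (volume.restrict B)) := by
    intro F K mF hF hK
    refine ⟨mF.aestronglyMeasurable, ?_⟩
    rw [hasFiniteIntegral_iff_enorm, lintegral_prod _ mF.enorm.aemeasurable]
    have : ∀ a : ℝ≥0∞, a ≤ 1 + a ^ 2 := by
      intro a
      rcases le_total a 1 with h | h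
      · exact h.trans le_self_add
      · refine le_trans ?_ le_add_self
        rw [sq]; exact le_mul_of_one_le_left' h
    calc _ ≤ ∫⁻ t in I, ∫⁻ x in B, (1 + K t x) :=
          lintegral_mono fun t => lintegral_mono fun x => (this _).trans (by gcongr; exact hF t x)
      _ = volume B * volume I + ∫⁻ t in I, ∫⁻ x in B, K t x := by
          have : ∀ t, ∫⁻ x in B, (1 + K t x) = volume B + ∫⁻ x in B, K t x := fun t => by
            rw [lintegral_add_left measurable_const]
            simp only [lintegral_const, Measure.restrict_apply_univ, one_mul]
          simp only [this]
          rw [lintegral_add_left measurable_const]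
          simp only [lintegral_const, Measure.restrict_apply_univ]
      _ < ∞ := ENNReal.add_lt_top.2 ⟨ENNReal.mul_lt_top fB.lt_top fI.lt_top, hK.lt_top⟩
  have iu : ∀ i, Integrable (fun q : ℝ × E3 => u q.2 q.1 i)
      ((volume.restrict I).prod (volume.restrict B)) := by
    intro i
    refine gen _ (fun t x => ‖u x t‖ₑ ^ 2) ?_ (fun t x => ?_) ?_
    · have := sol.meas_u.comp (measurable_swap : Measurable (Prod.swap : ℝ × E3 → E3 × ℝ))
      exact (by fun_prop : Measurable fun y : E3 => y i).comp this
    · gcongr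
      rw [← ofReal_norm, ← ofReal_norm]
      exact ENNReal.ofReal_le_ofReal (PiLp.norm_apply_le _ _)
    · have := ENNReal.ae_le_essSup (μ := volume.restrict I) (fun t => ∫⁻ x in B, ((‖u x t‖₊ : ℝ≥0∞)) ^ 2)
      refine ne_top_of_le_ne_top ?_ (lintegral_mono_ae this)
      rw [lintegral_const]
      simp only [Measure.restrict_apply_univ]
      exact ENNReal.mul_ne_top sol.bdd_L2.ne fI
  have ig : ∀ i j, Integrable (fun q : ℝ × E3 => sol.gu q.2 q.1 i j)
      ((volume.restrict I).prod (volume.restrict B)) := by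
    intro i j
    refine gen _ (fun t x => ENNReal.ofReal (∑ i : Fin 3, ∑ j : Fin 3, (sol.gu x t i j) ^ 2)) ?_
      (fun t x => ?_) sol.grad_L2.ne
    · have := sol.meas_gu.comp (measurable_swap : Measurable (Prod.swap : ℝ × E3 → E3 × ℝ))
      exact (by fun_prop : Measurable fun y : Fin 3 → Fin 3 → ℝ => y i j).comp this
    · simp only
      rw [← ofReal_norm, ← ENNReal.ofReal_pow (norm_nonneg _), Real.norm_eq_abs, sq_abs]
      apply ENNReal.ofReal_le_ofReal
      refine le_trans ?_ (Finset.single_le_sum (f := fun i => ∑ j : Fin 3, (sol.gu x t i j) ^ 2)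
        (fun _ _ => Finset.sum_nonneg fun _ _ => sq_nonneg _) (Finset.mem_univ i))
      exact Finset.single_le_sum (f := fun j => (sol.gu x t i j) ^ 2)
        (fun _ _ => sq_nonneg _) (Finset.mem_univ j)
  have A1 := ae_all_iff.2 fun i => (iu i).prod_right_ae
  have A2 := ae_all_iff.2 fun i => ae_all_iff.2 fun j => (ig i j).prod_right_ae
  have A3 : ∀ᵐ t ∂(volume.restrict I), ∀ i, ∀ n, ∀ x ∈ D, x ∈ ball (0 : E3) (3 / 4 * ρ) → ∀ j,
      ∫ z in B, u z t i * pd j (fun z => et ρ hρ n (x - z)) z =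
        - ∫ z in B, sol.gu z t i j * et ρ hρ n (x - z) := by
    refine ae_all_iff.2 fun i => ae_all_iff.2 fun n => (ae_ball_iff hDc).2 fun x hxD => ?_
    by_cases hx : x ∈ ball (0 : E3) (3 / 4 * ρ)
    · simp only [hx, forall_true_left]
      exact ae_all_iff.2 fun j => slice_id (F := fun x t => u x t i) (G := fun x t => sol.gu x t i j) j (iu i) (ig i j)
        (fun φ hφ => sol.is_grad φ hφ i j) (et_moll ρ hρ n) (et_tsupp ρ hρ n) hx
    · exact .of_forall fun t h => absurd h hx
  filter_upwards [A1, A2, A3] with t h1 h2 h3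
  exact ⟨h1, h2, h3⟩

lemma vol_scale {a b : ℝ} (ha : 0 ≤ a) (hb : 0 < b) :
    volume (ball (0 : E3) a) = ENNReal.ofReal (a / b) ^ 3 * volume (ball (0 : E3) b) := by
  rw [Measure.addHaar_ball volume _ ha, Measure.addHaar_ball volume _ hb.le, ← mul_assoc]
  congr 1
  rw [← ENNReal.ofReal_pow (by positivity), ← ENNReal.ofReal_mul (by positivity)]
  congr 1
  simp
  field_simp

lemma jensen3 {B : Set E3} {f : E3 → ℝ≥0∞} (hf : Measurable f) :
    (∫⁻ x in B, f x) ^ 3 ≤ volume B ^ 2 * ∫⁻ x in B, f x ^ 3 := by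
  have hpq : Real.HolderConjugate 3 (3 / 2) := by
    rw [Real.holderConjugate_iff]; norm_num
  have := ENNReal.lintegral_mul_le_Lp_mul_Lq (volume.restrict B) hpq hf.aemeasurable
    (measurable_const (a := (1 : ℝ≥0∞))).aemeasurable
  simp only [Pi.mul_apply, mul_one, ENNReal.one_rpow, lintegral_const, Measure.restrict_apply_univ,
    one_mul] at this
  refine (pow_le_pow_left' this 3).trans (le_of_eq ?_)
  rw [mul_pow, ← ENNReal.rpow_natCast _ 3, ← ENNReal.rpow_natCast _ 3, rp1 _ _ _ 1 (by norm_num),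
    rp1 _ _ _ 2 (by norm_num), ENNReal.rpow_one, mul_comm]
  congr 1
  · exact_mod_cast ENNReal.rpow_natCast _ 2
  · refine lintegral_congr fun x => ?_
    exact_mod_cast ENNReal.rpow_natCast _ 3

lemma cube_split {X A B s : ℝ≥0∞} (h1 : X ≤ A + s) (h2 : X ≤ B + s) :
    X ^ 3 ≤ 8 * (A * B ^ 2) + 8 * s ^ 3 := by
  have h : X ≤ min A B + s := by
    rcases le_total A B with h | h
    · rwa [min_eq_left h]
    · rwa [min_eq_right h]
  calc X ^ 3 ≤ (min A B + s) ^ 3 := by gcongr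
    _ ≤ 2 ^ 3 * ((min A B) ^ 3 + s ^ 3) := add_pow_le2 _ _ 3
    _ = 8 * (min A B * (min A B) ^ 2) + 8 * s ^ 3 := by ring
    _ ≤ _ := by gcongr <;> simp

lemma e3_sq (x : E3) : ‖x‖ₑ ^ 2 = ∑ i : Fin 3, ‖x i‖ₑ ^ 2 := by
  rw [← ofReal_norm, ← ENNReal.ofReal_pow (norm_nonneg _), EuclideanSpace.norm_sq_eq,
    ENNReal.ofReal_sum_of_nonneg (fun _ _ => by positivity)]
  refine Finset.sum_congr rfl fun i _ => ?_
  rw [ENNReal.ofReal_pow (norm_nonneg _), ofReal_norm]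

lemma e3_le (x : E3) : ‖x‖ₑ ≤ ∑ i : Fin 3, ‖x i‖ₑ := by
  have : x = ∑ i : Fin 3, EuclideanSpace.single i (x i) := by
    ext j; simp [Finset.sum_apply]
  conv_lhs => rw [this]
  refine (enorm_sum_le _ _).trans (Finset.sum_le_sum fun i _ => ?_)
  rw [← ofReal_norm, ← ofReal_norm]; simp

lemma e3_comp (x : E3) (i : Fin 3) : ‖x i‖ₑ ≤ ‖x‖ₑ := by
  rw [← ofReal_norm, ← ofReal_norm]
  exact ENNReal.ofReal_le_ofReal (PiLp.norm_apply_le _ _)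

lemma lemT {y1 y2 y3 : ℝ} (h1 : 0 < y1) (h2 : 0 < y2) (h3 : 0 < y3) (g1 : y1 < 1)
    (g2 : y2 < 1) (g3 : y3 < 1) (hs : y1 + y2 + y3 ≤ 2) : ∃ c : NNReal, ∀ ρ : ℝ, ∀ hρ : 0 < ρ,
    ∀ (w : E3 → E3) (g : E3 → Fin 3 → Fin 3 → ℝ), Measurable w → Measurable g →
    (∀ i, IntegrableOn (fun x => w x i) (ball (0 : E3) ρ)) →
    (∀ i j, IntegrableOn (fun x => g x i j) (ball (0 : E3) ρ)) →
    ∀ D : Set E3, Dense D →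
    (∀ i, ∀ n, ∀ x ∈ D, x ∈ ball (0 : E3) (3 / 4 * ρ) → ∀ j,
      ∫ z in ball (0 : E3) ρ, w z i * pd j (fun z => et ρ hρ n (x - z)) z =
        - ∫ z in ball (0 : E3) ρ, g z i j * et ρ hρ n (x - z)) →
    ∀ μ : ℝ, 0 < μ → μ ≤ ρ / 2 →
    ∫⁻ x in ball (0 : E3) μ, ‖w x‖ₑ ^ 3 ≤
      c * (nN y1 y2 y3 (fun x y z => (ball (0 : E3) ρ).indicator
        (fun x => ‖w x - ⨍ y in ball (0 : E3) ρ, w y‖ₑ) (pt3 x y z)) *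
      (∫⁻ x in ball (0 : E3) ρ, ENNReal.ofReal (∑ i : Fin 3, ∑ j : Fin 3, (g x i j) ^ 2)) ^ ((y1 + y2 + y3) / 2) *
      (∫⁻ x in ball (0 : E3) ρ, ‖w x‖ₑ ^ 2) ^ (1 - (y1 + y2 + y3) / 2)) +
      c * (ENNReal.ofReal (μ / ρ) ^ 3 * ∫⁻ x in ball (0 : E3) ρ, ‖w x‖ₑ ^ 3) := by
  obtain ⟨c, hc⟩ := lemS h1 h2 h3 g1 g2 g3 hs
  set θ := (y1 + y2 + y3) / 2 with hθ
  have hθ0 : 0 ≤ θ := by positivity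
  have hθ1 : 0 ≤ 1 - θ := by rw [hθ]; linarith
  refine ⟨max (24 * c) (8 * 13 ^ 3), fun ρ hρ w g mw mg iw ig D hD H μ hμ hμρ => ?_⟩
  set B := ball (0 : E3) ρ with hB
  set a := ⨍ y in B, w y with ha
  set A : E3 → ℝ≥0∞ := fun x => ‖w x - a‖ₑ with hA
  have mwi : ∀ i, Measurable fun x => w x i := fun i =>
    (by fun_prop : Measurable fun y : E3 => y i).comp mw
  have mgi : ∀ i j, Measurable fun x => g x i j := fun i j =>
    (by fun_prop : Measurable fun y : Fin 3 → Fin 3 → ℝ => y i j).comp mg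
  have mA : Measurable A := (mw.sub measurable_const).enorm
  have hS := fun i => hc ρ hρ (fun x => w x i) (fun j x => g x i j) (mwi i) (mgi i)
    (iw i) (ig i) D hD (H i)
  choose m hm1 hm2 using hS
  set M : E3 := WithLp.toLp 2 m with hM
  set s := ‖a‖ₑ + ‖M‖ₑ with hs'
  set N := nN y1 y2 y3 (fun x y z => B.indicator A (pt3 x y z)) with hN
  set G := ∫⁻ x in B, ENNReal.ofReal (∑ i : Fin 3, ∑ j : Fin 3, (g x i j) ^ 2) with hG
  set V := ∫⁻ x in B, ‖w x‖ₑ ^ 2 with hV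
  set T := ∫⁻ x in B, ‖w x‖ₑ ^ 3 with hT
  have Vp : volume B ≠ 0 := (measure_ball_pos volume _ hρ).ne'
  have Vf : volume B ≠ ∞ := measure_ball_lt_top.ne
  -- the constants
  have sb : volume B * s ≤ 13 * ∫⁻ x in B, ‖w x‖ₑ := by
    have b1 : volume B * ‖a‖ₑ ≤ ∫⁻ x in B, ‖w x‖ₑ := enorm_avg hρ
    have b2 : ∀ i, volume B * ‖m i‖ₑ ≤ 4 * ∫⁻ x in B, ‖w x‖ₑ := by
      intro i
      have := (hm1 i).trans (lintegral_mono fun x => e3_comp (w x) i)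
      have e : volume B ≤ 4 * volume (ball (0 : E3) (3 / 4 * ρ)) := by
        rw [vol_scale (a := 3 / 4 * ρ) (b := ρ) (by positivity) hρ, mul_div_assoc, div_self hρ.ne',
          mul_one, ← ENNReal.ofReal_pow (by norm_num), ← mul_assoc]
        refine le_mul_of_one_le_left' ?_
        rw [show (4 : ℝ≥0∞) = ENNReal.ofReal 4 by simp, ← ENNReal.ofReal_mul (by norm_num),
          ENNReal.one_le_ofReal]
        norm_num
      calc volume B * ‖m i‖ₑ ≤ 4 * volume (ball (0 : E3) (3 / 4 * ρ)) * ‖m i‖ₑ := by gcongr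
        _ = 4 * (volume (ball (0 : E3) (3 / 4 * ρ)) * ‖m i‖ₑ) := by ring
        _ ≤ _ := by gcongr
    calc volume B * s ≤ volume B * (‖a‖ₑ + ∑ i : Fin 3, ‖m i‖ₑ) := by
          rw [hs']; gcongr; exact e3_le M
      _ = volume B * ‖a‖ₑ + ∑ i : Fin 3, volume B * ‖m i‖ₑ := by rw [mul_add, Finset.mul_sum]
      _ ≤ (∫⁻ x in B, ‖w x‖ₑ) + ∑ i : Fin 3, 4 * ∫⁻ x in B, ‖w x‖ₑ := by
          exact add_le_add b1 (Finset.sum_le_sum fun i _ => b2 i)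
      _ = _ := by simp; ring
  have s3 : volume B * s ^ 3 ≤ 13 ^ 3 * T := by
    have := pow_le_pow_left' sb 3
    rw [mul_pow, mul_pow] at this
    have j3 := jensen3 (B := B) mw.enorm
    have t2 : volume B ^ 2 * (volume B * s ^ 3) ≤ volume B ^ 2 * (13 ^ 3 * T) := by
      calc _ = volume B ^ 3 * s ^ 3 := by ring
        _ ≤ _ := this
        _ ≤ 13 ^ 3 * (volume B ^ 2 * T) := by gcongr
        _ = _ := by ring
    exact (ENNReal.mul_le_mul_iff_right (pow_ne_zero 2 Vp) (ENNReal.pow_ne_top Vf)).1 t2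
  -- main term
  have main : ∫⁻ x in ball (0 : E3) μ, A x * ‖w x - M‖ₑ ^ 2 ≤ 3 * (c * (N * G ^ θ * V ^ (1 - θ))) := by
    calc _ ≤ ∫⁻ x in ball (0 : E3) (ρ / 2), A x * ‖w x - M‖ₑ ^ 2 :=
          lintegral_mono_set (ball_subset_ball hμρ)
      _ = ∑ i : Fin 3, ∫⁻ x in ball (0 : E3) (ρ / 2), A x * ‖w x i - m i‖ₑ ^ 2 := by
          have mm : ∀ i ∈ (Finset.univ : Finset (Fin 3)),
              Measurable (fun x => A x * ‖w x i - m i‖ₑ ^ 2) := fun i _ =>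
            mA.mul (((mwi i).sub measurable_const).enorm.pow_const _)
          rw [← lintegral_finsetSum _ mm]
          refine lintegral_congr fun x => ?_
          rw [e3_sq, Finset.mul_sum]; rfl
      _ ≤ ∑ i : Fin 3, c * (N * G ^ θ * V ^ (1 - θ)) := by
          refine Finset.sum_le_sum fun i _ => ?_
          refine (hm2 i A mA (fun x => enorm_ne_top)).trans ?_
          rw [← mul_assoc, ← mul_assoc]
          refine mul_le_mul' (mul_le_mul' le_rfl (ENNReal.rpow_le_rpow ?_ hθ0)) (ENNReal.rpow_le_rpow ?_ hθ1)
          · rw [← lintegral_finsetSum _ fun j _ => (mgi i j).enorm.pow_const _]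
            refine lintegral_mono fun x => ?_
            have : ∀ i j, ‖g x i j‖ₑ ^ 2 = ENNReal.ofReal (g x i j ^ 2) := fun i j => by
              rw [← ofReal_norm, ← ENNReal.ofReal_pow (norm_nonneg _), Real.norm_eq_abs, sq_abs]
            simp only [this]
            rw [← ENNReal.ofReal_sum_of_nonneg fun _ _ => sq_nonneg _]
            exact ENNReal.ofReal_le_ofReal (Finset.single_le_sum (f := fun i => ∑ j : Fin 3, (g x i j) ^ 2)
              (fun _ _ => Finset.sum_nonneg fun _ _ => sq_nonneg _) (Finset.mem_univ i))
          · exact lintegral_mono fun x => pow_le_pow_left' (e3_comp (w x) i) 2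
      _ = _ := by simp
  calc _ ≤ ∫⁻ x in ball (0 : E3) μ, (8 * (A x * ‖w x - M‖ₑ ^ 2) + 8 * s ^ 3) := by
        refine lintegral_mono fun x => cube_split ?_ ?_
        · calc ‖w x‖ₑ = ‖(w x - a) + a‖ₑ := by simp
            _ ≤ ‖w x - a‖ₑ + ‖a‖ₑ := enorm_add_le _ _
            _ ≤ _ := by rw [hs']; gcongr; exact le_self_add
        · calc ‖w x‖ₑ = ‖(w x - M) + M‖ₑ := by simp
            _ ≤ ‖w x - M‖ₑ + ‖M‖ₑ := enorm_add_le _ _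
            _ ≤ _ := by rw [hs']; gcongr; exact le_add_self
    _ = 8 * (∫⁻ x in ball (0 : E3) μ, A x * ‖w x - M‖ₑ ^ 2) + 8 * (volume (ball (0 : E3) μ) * s ^ 3) := by
        rw [lintegral_add_right _ measurable_const, lintegral_const_mul' _ _ (by norm_num), lintegral_const]
        simp only [Measure.restrict_apply_univ]
        ring
    _ ≤ 8 * (3 * (c * (N * G ^ θ * V ^ (1 - θ)))) + 8 * (ENNReal.ofReal (μ / ρ) ^ 3 * (13 ^ 3 * T)) := by
        gcongr 8 * ?_ + 8 * ?_
        rw [vol_scale hμ.le hρ, mul_assoc]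
        gcongr
    _ = ((24 * c : NNReal) : ℝ≥0∞) * (N * G ^ θ * V ^ (1 - θ)) +
        ((8 * 13 ^ 3 : NNReal) : ℝ≥0∞) * (ENNReal.ofReal (μ / ρ) ^ 3 * T) := by
        push_cast; ring
    _ ≤ _ := by
        gcongr
        · exact le_max_left _ _
        · exact le_max_right _ _

lemma aniso_eq {q1 q2 q3 : ℝ} (h1 : 0 < q1) (h2 : 0 < q2) (h3 : 0 < q3) (Ω : Set E3) (f : E3 → E3) :
    anisoNorm q1 q2 q3 Ω (fun x => ‖f x‖) =
      nN (1 / q1) (1 / q2) (1 / q3) (fun x y z => Ω.indicator (fun x => ‖f x‖ₑ) (pt3 x y z)) := by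
  have e : ∀ x, ENNReal.ofReal |Ω.indicator (fun x => ‖f x‖) x| = Ω.indicator (fun x => ‖f x‖ₑ) x := by
    intro x
    by_cases hx : x ∈ Ω
    · simp [hx]
    · simp [hx]
  unfold anisoNorm nN nP
  simp only [e, one_div_one_div]
  congr 1
  refine lintegral_congr fun x3 => ?_
  rw [rp1 _ _ _ (q3 / q2) (by ring)]
  congr 1
  refine lintegral_congr fun x2 => ?_
  rw [rp1 _ _ _ (q2 / q1) (by ring)]

lemma nN_meas {q1 q2 q3 : ℝ} {F : ℝ → E3 → ℝ≥0∞} (hF : Measurable fun z : ℝ × E3 => F z.1 z.2) :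
    Measurable fun t => nN q1 q2 q3 (fun x y z => F t (pt3 x y z)) := by
  unfold nN
  apply meas_nP (F := fun t x3 => nP q2 (fun x2 => nP q1 (fun x1 => F t (pt3 x1 x2 x3))))
  apply meas_nP (F := fun (s : ℝ × ℝ) x2 => nP q1 (fun x1 => F s.1 (pt3 x1 x2 s.2)))
  apply meas_nP (F := fun (s : (ℝ × ℝ) × ℝ) x1 => F s.1.1 (pt3 x1 s.2 s.1.2))
  have h2 : Measurable (fun s : ((ℝ × ℝ) × ℝ) × ℝ => pt3 s.2 s.1.2 s.1.1.2) :=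
    meas_pt3.comp (f := fun s : ((ℝ × ℝ) × ℝ) × ℝ => (s.2, s.1.2, s.1.1.2)) (by fun_prop)
  have h3 : Measurable (fun s : ((ℝ × ℝ) × ℝ) × ℝ => s.1.1.1) := by fun_prop
  exact hF.comp (h3.prodMk h2)

lemma time_hold {ν : Measure ℝ} {p : ℝ≥0∞} {θ : ℝ} (hp : 1 < p) (hθ : θ = 1 - 1 / p.toReal)
    {N G V : ℝ → ℝ≥0∞} (mN : Measurable N) (mG : Measurable G) {K : ℝ≥0∞} (hV : ∀ᵐ t ∂ν, V t ≤ K) :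
    ∫⁻ t, N t * G t ^ θ * V t ^ (1 - θ) ∂ν ≤
      (if p = ∞ then essSup N ν else (∫⁻ t, N t ^ p.toReal ∂ν) ^ (1 / p.toReal)) *
        (∫⁻ t, G t ∂ν) ^ θ * K ^ (1 - θ) := by
  by_cases h : p = ∞
  · subst h
    have hθ' : θ = 1 := by rw [hθ]; simp
    clear hθ
    subst hθ'
    simp only [ENNReal.rpow_one, _root_.sub_self, ENNReal.rpow_zero, mul_one, if_true]
    calc _ ≤ ∫⁻ t, essSup N ν * G t ∂ν := by
          refine lintegral_mono_ae ?_
          filter_upwards [ENNReal.ae_le_essSup (μ := ν) N] with t ht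
          gcongr
      _ = _ := lintegral_const_mul _ mG
  · rw [if_neg h]
    have hr : 1 < p.toReal := by
      rw [← ENNReal.toReal_one]; exact (ENNReal.toReal_lt_toReal (by simp) h).2 hp
    set r := p.toReal
    have hr0 : 0 < r := by linarith
    have hi : 1 / r < 1 := by rw [div_lt_one hr0]; exact hr
    have hθ0 : 0 < θ := by rw [hθ]; linarith
    have hθ1 : 0 ≤ 1 - θ := by rw [hθ]; simp; positivity
    have hc : Real.HolderConjugate r (1 / θ) := by
      rw [Real.holderConjugate_iff]; refine ⟨hr, ?_⟩; simp [hθ]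
    calc _ ≤ ∫⁻ t, K ^ (1 - θ) * (N t * G t ^ θ) ∂ν := by
          refine lintegral_mono_ae ?_
          filter_upwards [hV] with t ht
          rw [mul_comm]
          gcongr
      _ = K ^ (1 - θ) * ∫⁻ t, N t * G t ^ θ ∂ν := lintegral_const_mul _ (mN.mul (mG.pow_const _))
      _ ≤ K ^ (1 - θ) * ((∫⁻ t, N t ^ r ∂ν) ^ (1 / r) * (∫⁻ t, (G t ^ θ) ^ (1 / θ) ∂ν) ^ (1 / (1 / θ))) := by
          gcongr
          exact ENNReal.lintegral_mul_le_Lp_mul_Lq ν hc mN.aemeasurable (mG.pow_const θ).aemeasurable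
      _ = _ := by
          rw [one_div_one_div, mul_comm]
          congr 3
          refine lintegral_congr fun t => ?_
          rw [rp1 _ _ _ 1 (by field_simp), ENNReal.rpow_one]

lemma scale_fin {c m r M S K T X : ℝ≥0∞} {θ : ℝ} (h0 : 0 ≤ θ) (h1 : 0 ≤ 1 - θ) (m0 : m ≠ 0)
    (mt : m ≠ ∞) (r0 : r ≠ 0) (rt : r ≠ ∞)
    (hX : X ≤ c * (M * S ^ θ * (r * K) ^ (1 - θ)) + c * ((m / r) ^ 3 * T)) :
    (m ^ 2)⁻¹ * X ≤ c * (r / m) ^ 2 * (r⁻¹ * M) * (r⁻¹ * S) ^ θ * K ^ (1 - θ) +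
      c * (m / r) * ((r ^ 2)⁻¹ * T) := by
  have ri : r * r⁻¹ = 1 := ENNReal.mul_inv_cancel r0 rt
  have mi : m * m⁻¹ = 1 := ENNReal.mul_inv_cancel m0 mt
  have i2 : ∀ a : ℝ≥0∞, (a ^ 2)⁻¹ = a⁻¹ ^ 2 := fun a => ENNReal.inv_pow
  have k : r⁻¹ ^ θ * r ^ θ = 1 := by
    rw [← ENNReal.mul_rpow_of_nonneg _ _ h0, mul_comm, ri, ENNReal.one_rpow]
  have k2 : r = r ^ θ * r ^ (1 - θ) := by
    rw [← ENNReal.rpow_add _ _ r0 rt]; simp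
  refine (mul_le_mul_right hX _).trans (le_of_eq ?_)
  rw [mul_add, i2, i2, ENNReal.mul_rpow_of_nonneg _ _ h0, ENNReal.mul_rpow_of_nonneg _ _ h1,
    div_eq_mul_inv, div_eq_mul_inv]
  congr 1
  · calc _ = c * m⁻¹ ^ 2 * M * S ^ θ * K ^ (1 - θ) * r ^ (1 - θ) * 1 := by ring
      _ = c * m⁻¹ ^ 2 * M * S ^ θ * K ^ (1 - θ) * r⁻¹ ^ θ * (r ^ θ * r ^ (1 - θ)) := by
        rw [← k]; ring
      _ = c * m⁻¹ ^ 2 * M * S ^ θ * K ^ (1 - θ) * r⁻¹ ^ θ * r * (r * r⁻¹) := by rw [← k2, ri, mul_one]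
      _ = _ := by ring
  · calc _ = c * (m * r⁻¹) * (r⁻¹ ^ 2 * T) * (m * m⁻¹) ^ 2 := by ring
      _ = _ := by rw [mi]; ring

/-- Lemma 3.1: for `0 < √6 μ ≤ ρ`,
`E₃(μ) ≤ C (ρ/μ)² E_{p,q⃗}(ρ) E_*(ρ)^{1−1/p} E(ρ)^{1/p} + C (μ/ρ) E₃(ρ)`,
with `C` depending only on `p`, `q⃗` satisfying `2/p + 1/q̄ = 2`, `q_j > 1`. -/
theorem lemma_E3_decay
    (p : ℝ≥0∞) (q1 q2 q3 : ℝ) (hp : 1 ≤ p)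
    (hq1 : 1 < q1) (hq2 : 1 < q2) (hq3 : 1 < q3)
    (hpq : 2 / p.toReal + (1/q1 + 1/q2 + 1/q3) = 2) :
    ∃ C : ℝ, 0 < C ∧
      ∀ (ρ μ : ℝ) (u : E3 → ℝ → E3) (P : E3 → ℝ → ℝ)
        (sol : SuitableWeakSolution ρ u P), 0 < μ → Real.sqrt 6 * μ ≤ ρ →
        energyE3 μ u
          ≤ ENNReal.ofReal C * (ENNReal.ofReal (ρ/μ)) ^ 2
              * energyEpq p q1 q2 q3 ρ u
              * (energyEstar ρ sol.gu) ^ ((1 : ℝ) - 1/p.toReal)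
              * (energyE ρ u) ^ ((1 : ℝ)/p.toReal)
            + ENNReal.ofReal C * ENNReal.ofReal (μ/ρ) * energyE3 ρ u := by
  have p1 : 0 < 1 / q1 := by positivity
  have p2 : 0 < 1 / q2 := by positivity
  have p3 : 0 < 1 / q3 := by positivity
  have l1 : 1 / q1 < 1 := by rw [div_lt_one (by linarith)]; exact hq1
  have l2 : 1 / q2 < 1 := by rw [div_lt_one (by linarith)]; exact hq2
  have l3 : 1 / q3 < 1 := by rw [div_lt_one (by linarith)]; exact hq3
  have hip : 0 ≤ 1 / p.toReal := by positivity
  have h2p : 2 / p.toReal = 2 * (1 / p.toReal) := by ring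
  have hs : 1 / q1 + 1 / q2 + 1 / q3 ≤ 2 := by linarith
  have hp1 : 1 < p := by
    refine lt_of_le_of_ne hp fun h => ?_
    rw [← h] at hpq
    rw [ENNReal.toReal_one] at hpq
    linarith
  obtain ⟨c, hc⟩ := lemT p1 p2 p3 l1 l2 l3 hs
  set θ := (1 / q1 + 1 / q2 + 1 / q3) / 2 with hθ
  have hθp : θ = 1 - 1 / p.toReal := by rw [hθ]; linarith
  have hθ0 : 0 ≤ θ := by positivity
  have hθ1 : 0 ≤ 1 - θ := by rw [hθ]; linarith
  have hθq : 1 / p.toReal = 1 - θ := by rw [hθp]; ring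
  refine ⟨c + 1, by positivity, fun ρ μ u P sol hμ hμρ => ?_⟩
  have s6 : 2 ≤ Real.sqrt 6 := by
    exact Real.le_sqrt_of_sq_le (by norm_num)
  have hμ2 : μ ≤ ρ / 2 := by nlinarith
  have hρ : 0 < ρ := by linarith
  set B := ball (0 : E3) ρ with hB
  set ν := volume.restrict (Ioo (-(ρ ^ 2)) 0) with hν
  set A : ℝ → E3 → ℝ≥0∞ := fun t x => ‖u x t - ⨍ y in B, u y t‖ₑ with hA
  set N : ℝ → ℝ≥0∞ := fun t =>
    nN (1 / q1) (1 / q2) (1 / q3) (fun x y z => B.indicator (A t) (pt3 x y z)) with hN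
  set G : ℝ → ℝ≥0∞ := fun t => ∫⁻ x in B,
    ENNReal.ofReal (∑ i : Fin 3, ∑ j : Fin 3, (sol.gu x t i j) ^ 2) with hG
  set V : ℝ → ℝ≥0∞ := fun t => ∫⁻ x in B, ‖u x t‖ₑ ^ 2 with hV
  set T : ℝ → ℝ≥0∞ := fun t => ∫⁻ x in B, ‖u x t‖ₑ ^ 3 with hT
  have mus : Measurable fun z : ℝ × E3 => u z.2 z.1 := sol.meas_u.comp measurable_swap
  have mgs : Measurable fun z : ℝ × E3 => sol.gu z.2 z.1 := sol.meas_gu.comp measurable_swap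
  have mgij : ∀ i j, Measurable fun z : ℝ × E3 => sol.gu z.2 z.1 i j := fun i j =>
    (by fun_prop : Measurable fun y : Fin 3 → Fin 3 → ℝ => y i j).comp mgs
  have mav : Measurable fun t => ⨍ y in B, u y t := by
    simp only [setAverage_eq]
    have h0 : Measurable fun t => ∫ y in B, u y t :=
      (mus.stronglyMeasurable.integral_prod_right' (ν := volume.restrict B)).measurable
    exact h0.const_smul (volume.real B)⁻¹
  have mA : Measurable fun z : ℝ × E3 => A z.1 z.2 :=
    (mus.sub (mav.comp measurable_fst)).enorm
  have mN : Measurable N := by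
    refine nN_meas (F := fun t => B.indicator (A t)) ?_
    have : (fun z : ℝ × E3 => B.indicator (A z.1) z.2) =
        (Prod.snd ⁻¹' B).indicator (fun z : ℝ × E3 => A z.1 z.2) := by
      ext z; by_cases hz : z.2 ∈ B <;> simp [hz]
    rw [this]
    exact mA.indicator (measurable_snd measurableSet_ball)
  have mG : Measurable G := by
    refine Measurable.lintegral_prod_right' (ν := volume.restrict B)
      (f := fun z : ℝ × E3 => ENNReal.ofReal (∑ i : Fin 3, ∑ j : Fin 3, (sol.gu z.2 z.1 i j) ^ 2)) ?_
    exact ENNReal.measurable_ofReal.comp (Finset.measurable_sum _ fun i _ =>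
      Finset.measurable_sum _ fun j _ => (mgij i j).pow_const 2)
  have mT : Measurable T :=
    Measurable.lintegral_prod_right' (ν := volume.restrict B)
      (f := fun z : ℝ × E3 => ‖u z.2 z.1‖ₑ ^ 3) (mus.enorm.pow_const 3)
  have r0 : ENNReal.ofReal ρ ≠ 0 := by simpa using hρ
  have rt : ENNReal.ofReal ρ ≠ ∞ := ENNReal.ofReal_ne_top
  have m0 : ENNReal.ofReal μ ≠ 0 := by simpa using hμ
  have hVK : ∀ᵐ t ∂ν, V t ≤ ENNReal.ofReal ρ * energyE ρ u := by
    filter_upwards [ENNReal.ae_le_essSup (μ := ν) (fun t => (ENNReal.ofReal ρ)⁻¹ * V t)] with t ht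
    calc V t = ENNReal.ofReal ρ * ((ENNReal.ofReal ρ)⁻¹ * V t) := by
          rw [← mul_assoc, ENNReal.mul_inv_cancel r0 rt, one_mul]
      _ ≤ _ := by gcongr; exact ht
  obtain ⟨D, hD, hsl⟩ := slices hρ sol
  have hae : ∀ᵐ t ∂ν, ∫⁻ x in ball (0 : E3) μ, ‖u x t‖ₑ ^ 3 ≤
      c * (N t * G t ^ θ * V t ^ (1 - θ)) + c * (ENNReal.ofReal (μ / ρ) ^ 3 * T t) := by
    filter_upwards [hsl] with t ht
    exact hc ρ hρ (fun x => u x t) (fun x => sol.gu x t) (mus.comp measurable_prodMk_left)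
      (mgs.comp measurable_prodMk_left) ht.1 ht.2.1 D hD ht.2.2 μ hμ hμ2
  have hth := time_hold hp1 hθp mN mG hVK
  set M := (if p = ∞ then essSup N ν else (∫⁻ t, N t ^ p.toReal ∂ν) ^ (1 / p.toReal)) with hM
  have hX : ∫⁻ t in Ioo (-(μ ^ 2)) 0, ∫⁻ x in ball (0 : E3) μ, ‖u x t‖ₑ ^ 3 ≤
      c * (M * (∫⁻ t, G t ∂ν) ^ θ * (ENNReal.ofReal ρ * energyE ρ u) ^ (1 - θ)) +
      c * ((ENNReal.ofReal μ / ENNReal.ofReal ρ) ^ 3 * ∫⁻ t, T t ∂ν) := by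
    calc _ ≤ ∫⁻ t, (∫⁻ x in ball (0 : E3) μ, ‖u x t‖ₑ ^ 3) ∂ν :=
          lintegral_mono_set (Ioo_subset_Ioo (by nlinarith) le_rfl)
      _ ≤ ∫⁻ t, (c * (N t * G t ^ θ * V t ^ (1 - θ)) +
            c * (ENNReal.ofReal (μ / ρ) ^ 3 * T t)) ∂ν := lintegral_mono_ae hae
      _ = c * (∫⁻ t, N t * G t ^ θ * V t ^ (1 - θ) ∂ν) +
            c * (ENNReal.ofReal (μ / ρ) ^ 3 * ∫⁻ t, T t ∂ν) := by
          rw [lintegral_add_right _ ((mT.const_mul _).const_mul _),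
            lintegral_const_mul' _ _ ENNReal.coe_ne_top, lintegral_const_mul' _ _ ENNReal.coe_ne_top,
            lintegral_const_mul _ mT]
      _ ≤ _ := by
          rw [ENNReal.ofReal_div_of_pos hρ]
          exact add_le_add (mul_le_mul_right hth _) le_rfl
  have hfin := scale_fin hθ0 hθ1 m0 ENNReal.ofReal_ne_top r0 rt hX
  have hMM : mixedNorm p q1 q2 q3 ρ (fun x t => ‖u x t - ⨍ y in B, u y t‖) = M := by
    have : ∀ t, anisoNorm q1 q2 q3 B (fun x => ‖u x t - ⨍ y in B, u y t‖) = N t := fun t =>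
      aniso_eq (by linarith) (by linarith) (by linarith) B (fun x => u x t - ⨍ y in B, u y t)
    unfold mixedNorm
    simp only [← hB, this]
    rfl
  have hcC : (c : ℝ≥0∞) ≤ ENNReal.ofReal ((c : ℝ) + 1) := by
    rw [← ENNReal.ofReal_coe_nnreal]; exact ENNReal.ofReal_le_ofReal (by linarith)
  have e1 : energyEpq p q1 q2 q3 ρ u = (ENNReal.ofReal ρ)⁻¹ * M := by
    rw [← hMM]; rfl
  have e2 : energyEstar ρ sol.gu = (ENNReal.ofReal ρ)⁻¹ * ∫⁻ t, G t ∂ν := rfl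
  have e3 : energyE3 ρ u = (ENNReal.ofReal ρ ^ 2)⁻¹ * ∫⁻ t, T t ∂ν := rfl
  rw [← hθp, hθq, e1, e2, e3, ENNReal.ofReal_div_of_pos hρ, ENNReal.ofReal_div_of_pos hμ]
  refine le_trans (le_of_eq ?_) (hfin.trans ?_)
  · rfl
  · gcongr
end
end

section
/- There exists an absolute constant C such that: if R > 0, h : B(R) → ℝ is harmonic on B(R) (twice continuously differentiable with Δh = 0), and 0 < μ ≤ R/2, then ∫_{B(μ)} |h − h̄_μ|^{3/2} dx ≤ C (μ/R)^{9/2} ∫_{B(R)} |h|^{3/2} dx, where h̄_μ denotes the average of h over B(μ). -/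
open MeasureTheory ENNReal Set Metric Filter

noncomputable section

lemma hasDerivAt_maxsq (t : ℝ) : HasDerivAt (fun s : ℝ => (max 0 s)^2) (2 * max 0 t) t := by
  rcases lt_trichotomy t 0 with ht | ht | ht
  · have : (fun s : ℝ => (max 0 s)^2) =ᶠ[nhds t] fun _ => 0 := by
      filter_upwards [Iio_mem_nhds ht] with s hs
      simp [max_eq_left (le_of_lt (show s < 0 from hs))]
    rw [max_eq_left ht.le, mul_zero]
    exact (hasDerivAt_const t (0:ℝ)).congr_of_eventuallyEq this
  · subst ht
    simp only [max_self, mul_zero]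
    rw [hasDerivAt_iff_isLittleO_nhds_zero]
    simp only [zero_add, max_self, smul_zero, sub_zero, ne_eq, OfNat.ofNat_ne_zero, not_false_eq_true, zero_pow]
    have h1 : (fun s : ℝ => (max 0 s)^2) =O[nhds 0] fun s : ℝ => s^2 := by
      apply Asymptotics.isBigO_of_le
      intro s
      rw [Real.norm_of_nonneg (by positivity), Real.norm_of_nonneg (by positivity)]
      rcases le_total 0 s with h | h
      · simp [h]
      · simp [h]; positivity
    refine h1.trans_isLittleO ?_
    simpa using (Asymptotics.isLittleO_pow_pow (𝕜 := ℝ) (show 1 < 2 by norm_num))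
  · have : (fun s : ℝ => (max 0 s)^2) =ᶠ[nhds t] fun s => s^2 := by
      filter_upwards [Ioi_mem_nhds ht] with s hs
      simp [max_eq_right (le_of_lt (show 0 < s from hs))]
    rw [max_eq_right ht.le]
    simpa using (hasDerivAt_pow 2 t).congr_of_eventuallyEq this

def psi (z : E3) : ℝ := max 0 (1 - ‖z‖^2)
def Psi (z : E3) : ℝ := -(1/4) * (max 0 (1 - ‖z‖^2))^2

lemma psi_nonneg (z : E3) : 0 ≤ psi z := le_max_left _ _

lemma psi_cont : Continuous psi := by unfold psi; fun_prop
lemma psi_zero {z : E3} (hz : z ∉ ball (0:E3) 1) : psi z = 0 := by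
  simp only [mem_ball_zero_iff, not_lt] at hz
  unfold psi; rw [max_eq_left]; nlinarith
lemma Psi_zero {z : E3} (hz : z ∉ ball (0:E3) 1) : Psi z = 0 := by
  simp only [mem_ball_zero_iff, not_lt] at hz
  unfold Psi; rw [max_eq_left]; simp; nlinarith
lemma psi_cs : HasCompactSupport psi :=
  HasCompactSupport.intro (isCompact_closedBall (0:E3) 1) fun _ hz => psi_zero fun h => hz (ball_subset_closedBall h)
lemma Psi_cs : HasCompactSupport Psi :=
  HasCompactSupport.intro (isCompact_closedBall (0:E3) 1) fun _ hz => Psi_zero fun h => hz (ball_subset_closedBall h)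
lemma psi_int_pos : 0 < ∫ z, psi z :=
  psi_cont.integral_pos_of_hasCompactSupport_nonneg_nonzero psi_cs psi_nonneg (x := 0) (by simp [psi])

lemma Psi_hasFDerivAt (z : E3) : HasFDerivAt Psi (psi z • innerSL ℝ z) z := by
  have h1 : HasFDerivAt (fun z : E3 => 1 - ‖z‖^2) (-(2 • innerSL ℝ z)) z :=
    (hasStrictFDerivAt_norm_sq z).hasFDerivAt.const_sub 1
  have h2 := ((hasDerivAt_maxsq (1 - ‖z‖^2)).comp_hasFDerivAt z h1).const_mul (-(1/4))
  refine HasFDerivAt.congr_fderiv h2 ?_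
  ext v
  simp [psi]
  ring

lemma psi_lip (a b : E3) : |psi a - psi b| ≤ 2 * ‖a - b‖ := by
  have key : ∀ s t : ℝ, 0 ≤ s → 0 ≤ t → max 0 (1-s^2) - max 0 (1-t^2) ≤ 2 * |s - t| := by
    intro s t hs ht
    have h1 := le_abs_self (s-t)
    have h2 := neg_abs_le (s-t)
    rcases le_total s 1 with h | h <;> rcases le_total t 1 with h' | h'
    · rw [max_eq_right (by nlinarith), max_eq_right (by nlinarith)]
      nlinarith [abs_nonneg (s-t)]
    · rw [max_eq_right (by nlinarith), max_eq_left (by nlinarith)]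
      nlinarith [abs_nonneg (s-t)]
    · rw [max_eq_left (by nlinarith), max_eq_right (by nlinarith)]
      nlinarith [abs_nonneg (s-t)]
    · rw [max_eq_left (by nlinarith), max_eq_left (by nlinarith)]
      nlinarith [abs_nonneg (s-t)]
  have k := abs_norm_sub_norm_le a b
  have k1 := key _ _ (norm_nonneg a) (norm_nonneg b)
  have k2 := key _ _ (norm_nonneg b) (norm_nonneg a)
  rw [abs_sub_comm] at k2
  rw [abs_le]; unfold psi
  constructor <;> linarith

lemma dirDeriv_int (H : E3 → ℝ) (hH : ContDiff ℝ 2 H) (x : E3) (r : ℝ) (i : Fin 3) :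
    ∫ z, psi z * (z i * pd i H (x + r • z)) = - (r * ∫ z, Psi z * pd i (fun y => pd i H y) (x + r • z)) := by
  set v : E3 := EuclideanSpace.single i 1 with hv
  have hpd : ContDiff ℝ 1 (fun y => pd i H y) := by
    unfold pd
    exact (hH.fderiv_right (m := 1) (by norm_num)).clm_apply contDiff_const
  have hpdc : Continuous (fun y => pd i H y) := hpd.continuous
  have hpdd : Continuous (fun y => pd i (fun y => pd i H y) y) := by
    have := (hpd.continuous_fderiv (by norm_num)).clm_apply (continuous_const (y := v))
    exact this
  have hPc : Continuous Psi := continuous_iff_continuousAt.2 fun z => (Psi_hasFDerivAt z).continuousAt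
  have hf : ∀ z, fderiv ℝ Psi z v = psi z * z i := by
    intro z
    rw [(Psi_hasFDerivAt z).fderiv]
    simp [hv, EuclideanSpace.inner_single_right]
  have hg : ∀ z, HasFDerivAt (fun z => pd i H (x + r • z)) (r • fderiv ℝ (fun y => pd i H y) (x + r • z)) z := by
    intro z
    have h1 : HasFDerivAt (fun z : E3 => x + r • z) (r • ContinuousLinearMap.id ℝ E3) z :=
      ((hasFDerivAt_id z).const_smul r).const_add x
    have h2 := ((hpd.differentiable (by norm_num)) (x + r • z)).hasFDerivAt.comp z h1
    refine h2.congr_fderiv ?_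
    ext w; simp
  have hg' : ∀ z, fderiv ℝ (fun z => pd i H (x + r • z)) z v = r * pd i (fun y => pd i H y) (x + r • z) := by
    intro z; rw [(hg z).fderiv]; simp [pd, hv]
  have key := integral_mul_fderiv_eq_neg_fderiv_mul_of_integrable (μ := volume) (f := Psi)
    (g := fun z => pd i H (x + r • z)) (v := v) ?_ ?_ ?_ (fun z _ => (Psi_hasFDerivAt z).differentiableAt)
    (fun z _ => (hg z).differentiableAt)
  · simp only [hf, hg'] at key
    rw [← integral_const_mul]
    simp only [mul_left_comm _ r] at key
    rw [key]
    simp [mul_assoc]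
  · simp only [hf]
    apply Continuous.integrable_of_hasCompactSupport
    · have := psi_cont; fun_prop
    · exact (psi_cs.mul_right).mul_right
  · simp only [hg']
    apply Continuous.integrable_of_hasCompactSupport
    · have := hPc; fun_prop
    · exact Psi_cs.mul_right
  · apply Continuous.integrable_of_hasCompactSupport
    · have := hPc; fun_prop
    · exact Psi_cs.mul_right

lemma fderiv_eq_sum (H : E3 → ℝ) (y z : E3) : fderiv ℝ H y z = ∑ i, z i * pd i H y := by
  conv_lhs => rw [← (EuclideanSpace.basisFun (Fin 3) ℝ).sum_repr z]
  simp [pd]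

lemma mean_global (H : E3 → ℝ) (hH : ContDiff ℝ 2 H) (hc : HasCompactSupport H) (x : E3) (ρ : ℝ)
    (hρ : 0 ≤ ρ) (hl : ∀ y ∈ closedBall x ρ, lap H y = 0) :
    ∫ z, psi z * H (x + ρ • z) = (∫ z, psi z) * H x := by
  have hfc : Continuous (fderiv ℝ H) := hH.continuous_fderiv (by norm_num)
  obtain ⟨D, hD⟩ := hfc.bounded_above_of_compact_support (hc.fderiv ℝ)
  have hHc := hH.continuous
  have hpc := psi_cont
  have hder : ∀ r : ℝ, HasDerivAt (fun r : ℝ => ∫ z, psi z * H (x + r • z))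
      (∫ z, psi z * fderiv ℝ H (x + r • z) z) r := by
    intro r
    refine (hasDerivAt_integral_of_dominated_loc_of_deriv_le (s := univ) (bound := fun z => psi z * (D * ‖z‖))
      (F' := fun r z => psi z * fderiv ℝ H (x + r • z) z)
      univ_mem ?_ ?_ ?_ ?_ ?_ ?_).2
    · refine Eventually.of_forall fun s => ?_
      exact (by fun_prop : Continuous fun z : E3 => psi z * H (x + s • z)).aestronglyMeasurable
    · apply Continuous.integrable_of_hasCompactSupport
      · fun_prop
      · exact psi_cs.mul_right
    · exact (by fun_prop : Continuous fun z : E3 => psi z * fderiv ℝ H (x + r • z) z).aestronglyMeasurable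
    · refine Eventually.of_forall fun z s _ => ?_
      rw [norm_mul, Real.norm_of_nonneg (psi_nonneg z)]
      refine mul_le_mul_of_nonneg_left ?_ (psi_nonneg z)
      exact (ContinuousLinearMap.le_opNorm _ _).trans (mul_le_mul_of_nonneg_right (hD _) (norm_nonneg _))
    · apply Continuous.integrable_of_hasCompactSupport
      · fun_prop
      · exact psi_cs.mul_right
    · refine Eventually.of_forall fun z s _ => ?_
      have h1 : HasDerivAt (fun s : ℝ => x + s • z) z s := by
        simpa using ((hasDerivAt_id s).smul_const z).const_add x
      exact (((hH.differentiable (by norm_num)) (x + s • z)).hasFDerivAt.comp_hasDerivAt s h1).const_mul _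
  have hzero : ∀ r ∈ Icc 0 ρ, ∫ z, psi z * fderiv ℝ H (x + r • z) z = 0 := by
    intro r hr
    have hpd : ∀ i, ContDiff ℝ 1 (fun y => pd i H y) := by
      intro i
      unfold pd
      exact (hH.fderiv_right (m := 1) (by norm_num)).clm_apply contDiff_const
    have hpdc : ∀ i, Continuous (fun y => pd i H y) := fun i => (hpd i).continuous
    have hpdd : ∀ i, Continuous (fun y => pd i (fun y => pd i H y) y) := fun i =>
      ((hpd i).continuous_fderiv (by norm_num)).clm_apply continuous_const
    have hPc : Continuous Psi := continuous_iff_continuousAt.2 fun z => (Psi_hasFDerivAt z).continuousAt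
    simp only [fderiv_eq_sum, Finset.mul_sum]
    rw [integral_finsetSum]
    · simp only [dirDeriv_int H hH]
      rw [Finset.sum_neg_distrib, ← Finset.mul_sum, ← integral_finsetSum]
      · have : ∀ z, ∑ i, Psi z * pd i (fun y => pd i H y) (x + r • z) = 0 := by
          intro z
          rw [← Finset.mul_sum]
          by_cases hz : z ∈ ball (0:E3) 1
          · have := hl (x + r • z) (by
              rw [mem_ball_zero_iff] at hz
              rw [mem_closedBall, dist_eq_norm, add_sub_cancel_left, norm_smul, Real.norm_of_nonneg hr.1]
              nlinarith [hr.1, hr.2, norm_nonneg z])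
            unfold lap at this
            rw [this, mul_zero]
          · rw [Psi_zero hz, zero_mul]
        simp [this]
      · intro i _
        have := hpdd i
        apply Continuous.integrable_of_hasCompactSupport
        · fun_prop
        · exact Psi_cs.mul_right
    · intro i _
      have := hpdc i
      apply Continuous.integrable_of_hasCompactSupport
      · fun_prop
      · exact psi_cs.mul_right
  have := constant_of_has_deriv_right_zero (a := 0) (b := ρ)
    (fun r _ => (hder r).continuousAt.continuousWithinAt)
    (fun r hr => by
      have := (hder r).hasDerivWithinAt (s := Ici r)
      rwa [hzero r ⟨hr.1, hr.2.le⟩] at this) ρ ⟨hρ, le_rfl⟩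
  simp only [zero_smul, add_zero] at this
  rw [this, integral_mul_const]

lemma mean_local (h : E3 → ℝ) (R : ℝ) (hh : ContDiffOn ℝ 2 h (ball (0:E3) R))
    (hl : ∀ x ∈ ball (0 : E3) R, lap h x = 0) (x : E3) (ρ : ℝ) (hρ : 0 < ρ) (hx : ‖x‖ + ρ < R) :
    ∫ z, psi z * h (x + ρ • z) = (∫ z, psi z) * h x := by
  obtain ⟨s, hs1, hs2⟩ := exists_between hx
  obtain ⟨t, ht1, ht2⟩ := exists_between hs2
  let b : ContDiffBump (0 : E3) := ⟨s, t, by linarith [norm_nonneg x], ht1⟩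
  have hs0 : 0 < s := by linarith [norm_nonneg x]
  have heq : ∀ y ∈ ball (0:E3) s, (fun y => b y * h y) =ᶠ[nhds y] h := by
    intro y hy
    filter_upwards [isOpen_ball.mem_nhds hy] with w hw
    rw [b.one_of_mem_closedBall (ball_subset_closedBall hw), one_mul]
  have hcs : HasCompactSupport (fun y => b y * h y) := b.hasCompactSupport.mul_right
  have hsm : ContDiff ℝ 2 (fun y => b y * h y) := by
    rw [contDiff_iff_contDiffAt]
    intro y
    by_cases hy : y ∈ tsupport (fun y => b y * h y)
    swap
    · exact contDiffAt_const.congr_of_eventuallyEq (notMem_tsupport_iff_eventuallyEq.1 hy)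
    have : y ∈ closedBall (0:E3) t := by
      have := closure_mono (Function.support_mul_subset_left (b : E3 → ℝ) h) hy
      rwa [← tsupport, b.tsupport_eq] at this
    have hyR : y ∈ ball (0:E3) R := closedBall_subset_ball ht2 this
    exact b.contDiff.contDiffAt.mul (hh.contDiffAt (isOpen_ball.mem_nhds hyR))
  have hin : ∀ y ∈ closedBall x ρ, y ∈ ball (0:E3) s := by
    intro y hy
    rw [mem_ball_zero_iff]
    rw [mem_closedBall, dist_eq_norm] at hy
    have := norm_add_le x (y - x)
    rw [add_sub_cancel] at this
    linarith
  have := mean_global _ hsm hcs x ρ hρ.le (by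
    intro y hy
    have hy' := hin y hy
    rw [← hl y (ball_subset_ball hs2.le hy')]
    unfold lap
    refine Finset.sum_congr rfl fun i _ => ?_
    have e1 : (fun y => pd i (fun y => b y * h y) y) =ᶠ[nhds y] fun y => pd i h y := by
      filter_upwards [isOpen_ball.mem_nhds hy'] with w hw
      unfold pd; rw [(heq w hw).fderiv_eq]
    conv_lhs => unfold pd
    rw [show fderiv ℝ (fun y => fderiv ℝ (fun y => b y * h y) y (EuclideanSpace.single i 1)) y = _ from e1.fderiv_eq]
    rfl)
  rw [← (heq x (hin x (mem_closedBall_self hρ.le))).eq_of_nhds, ← this]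
  congr 1; ext z
  by_cases hz : z ∈ ball (0:E3) 1
  · rw [(heq (x + ρ • z) (hin _ ?_)).eq_of_nhds]
    rw [mem_ball_zero_iff] at hz
    rw [mem_closedBall, dist_eq_norm, add_sub_cancel_left, norm_smul, Real.norm_of_nonneg hρ.le]
    nlinarith [norm_nonneg z]
  · rw [psi_zero hz, zero_mul, zero_mul]

lemma psi_le_one (z : E3) : psi z ≤ 1 := by
  unfold psi; apply max_le zero_le_one; nlinarith [sq_nonneg ‖z‖]

lemma rep (h : E3 → ℝ) (R : ℝ) (hR : 0 < R) (hh : ContDiffOn ℝ 2 h (ball (0:E3) R))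
    (hl : ∀ x ∈ ball (0 : E3) R, lap h x = 0) (x : E3) (hx : x ∈ ball (0:E3) (R/2)) :
    (∫ z, psi z) * h x = ((R/2)^3)⁻¹ * ∫ y in ball (0:E3) R, psi ((R/2)⁻¹ • (y - x)) * h y := by
  have hρ : 0 < R/2 := by positivity
  rw [mem_ball_zero_iff] at hx
  rw [← mean_local h R hh hl x (R/2) hρ (by linarith)]
  have h1 := Measure.integral_comp_smul (volume : Measure E3)
    (fun w => psi ((R/2)⁻¹ • w) * h (x + w)) (R/2)
  simp only [smul_smul, inv_mul_cancel₀ hρ.ne', one_smul] at h1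
  rw [h1]
  have h2 := integral_add_left_eq_self (μ := (volume : Measure E3))
    (fun y => psi ((R/2)⁻¹ • (y - x)) * h y) x
  simp only [add_sub_cancel_left] at h2
  rw [h2, setIntegral_eq_integral_of_forall_compl_eq_zero]
  · rw [abs_of_pos (by positivity)]; simp
  · intro y hy
    rw [psi_zero, zero_mul]
    intro hc
    apply hy
    rw [mem_ball_zero_iff, norm_smul, norm_inv, Real.norm_of_nonneg hρ.le, inv_mul_lt_one₀ hρ] at hc
    rw [mem_ball_zero_iff]
    have := norm_add_le x (y - x)
    rw [add_sub_cancel] at this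
    linarith

lemma osc (h : E3 → ℝ) (R : ℝ) (hR : 0 < R) (hh : ContDiffOn ℝ 2 h (ball (0:E3) R))
    (hl : ∀ x ∈ ball (0 : E3) R, lap h x = 0) (hi : IntegrableOn h (ball (0:E3) R))
    (x x' : E3) (hx : x ∈ ball (0:E3) (R/2)) (hx' : x' ∈ ball (0:E3) (R/2)) :
    (∫ z, psi z) * |h x - h x'| ≤ 32 / R^4 * ‖x - x'‖ * ∫ y in ball (0:E3) R, |h y| := by
  have hρ : 0 < R/2 := by positivity
  have hI : ∀ w : E3, IntegrableOn (fun y => psi ((R/2)⁻¹ • (y - w)) * h y) (ball (0:E3) R) := by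
    intro w
    refine Integrable.bdd_mul hi (c := 1) ?_ (Eventually.of_forall fun y => ?_)
    · have := psi_cont
      exact (by fun_prop : Continuous fun y => psi ((R/2)⁻¹ • (y - w))).aestronglyMeasurable
    · rw [Real.norm_of_nonneg (psi_nonneg _)]; exact psi_le_one _
  have e : (∫ z, psi z) * (h x - h x') = ((R/2)^3)⁻¹ * ∫ y in ball (0:E3) R,
      (psi ((R/2)⁻¹ • (y - x)) * h y - psi ((R/2)⁻¹ • (y - x')) * h y) := by
    rw [integral_sub (hI x) (hI x'), mul_sub, mul_sub, rep h R hR hh hl x hx, rep h R hR hh hl x' hx']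
  have e2 : (∫ z, psi z) * |h x - h x'| = |(∫ z, psi z) * (h x - h x')| := by
    rw [abs_mul, abs_of_pos psi_int_pos]
  rw [e2, e, abs_mul, abs_of_pos (by positivity)]
  have b : |∫ y in ball (0:E3) R,
      (psi ((R/2)⁻¹ • (y - x)) * h y - psi ((R/2)⁻¹ • (y - x')) * h y)| ≤
      ∫ y in ball (0:E3) R, (4 / R * ‖x - x'‖) * |h y| := by
    refine norm_integral_le_of_norm_le (f := fun y => psi ((R/2)⁻¹ • (y - x)) * h y - psi ((R/2)⁻¹ • (y - x')) * h y) (hi.abs.const_mul _) (Eventually.of_forall fun y => ?_)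
    rw [← sub_mul, norm_mul, Real.norm_eq_abs, Real.norm_eq_abs]
    refine mul_le_mul_of_nonneg_right ((psi_lip _ _).trans_eq ?_) (abs_nonneg _)
    rw [← smul_sub, norm_smul, show y - x - (y - x') = x' - x by abel, norm_inv, Real.norm_of_nonneg hρ.le,
      norm_sub_rev x' x]
    field_simp; ring
  rw [integral_const_mul] at b
  refine (mul_le_mul_of_nonneg_left b (by positivity)).trans_eq ?_
  field_simp; ring

lemma real_id (K m R V : ℝ) (hK : 0 ≤ K) (hm : 0 ≤ m) (hR : 0 < R) (hV : 0 ≤ V) :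
    (K * m / R^4)^((3:ℝ)/2) * (R^3 * V)^((1:ℝ)/2) * (m^3 * V) =
      (K^((3:ℝ)/2) * V^((3:ℝ)/2)) * (m/R)^((9:ℝ)/2) := by
  have q3 : ∀ x : ℝ, 0 ≤ x → (x^2)^((3:ℝ)/2) = x^3 := by
    intro x hx; rw [← Real.rpow_natCast, ← Real.rpow_mul hx, ← Real.rpow_natCast]; norm_num
  have q9 : ∀ x : ℝ, 0 ≤ x → (x^2)^((9:ℝ)/2) = x^9 := by
    intro x hx; rw [← Real.rpow_natCast, ← Real.rpow_mul hx, ← Real.rpow_natCast]; norm_num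
  have q1 : ∀ x : ℝ, 0 ≤ x → (x^2)^((1:ℝ)/2) = x := by
    intro x hx; rw [← Real.rpow_natCast, ← Real.rpow_mul hx]; norm_num
  obtain ⟨k, hk, rfl⟩ : ∃ k, 0 ≤ k ∧ K = k^2 := ⟨√K, by positivity, (Real.sq_sqrt hK).symm⟩
  obtain ⟨n, hn, rfl⟩ : ∃ k, 0 ≤ k ∧ m = k^2 := ⟨√m, by positivity, (Real.sq_sqrt hm).symm⟩
  obtain ⟨s, hs, rfl⟩ : ∃ k, 0 < k ∧ R = k^2 := ⟨√R, by positivity, (Real.sq_sqrt hR.le).symm⟩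
  obtain ⟨v, hv, rfl⟩ : ∃ k, 0 ≤ k ∧ V = k^2 := ⟨√V, by positivity, (Real.sq_sqrt hV).symm⟩
  rw [show k^2*n^2/(s^2)^4 = (k*n/s^4)^2 by ring, show (s^2)^3*v^2 = (s^3*v)^2 by ring,
    show n^2/s^2 = (n/s)^2 by ring, q3 _ (by positivity), q1 _ (by positivity), q3 _ hk, q3 _ hv,
    q9 _ (by positivity)]
  field_simp

lemma holder_ball (h : E3 → ℝ) (S : Set E3) (hm : AEMeasurable h (volume.restrict S)) :
    ∫⁻ x in S, ENNReal.ofReal |h x| ≤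
      (∫⁻ x in S, (ENNReal.ofReal |h x|)^((3:ℝ)/2))^((2:ℝ)/3) * (volume S)^((1:ℝ)/3) := by
  have := ENNReal.lintegral_mul_le_Lp_mul_Lq (volume.restrict S) (p := 3/2) (q := 3)
    (f := fun x => ENNReal.ofReal |h x|) (g := fun _ => 1)
    (Real.holderConjugate_iff.2 ⟨by norm_num, by norm_num⟩)
    (by fun_prop) (by fun_prop)
  simpa using this

/-- Interior estimate (2.18)-type decay for harmonic functions: if `h` is harmonic on
`B(R)` and `0 < μ ≤ R/2`, then
`∫_{B(μ)} |h − h̄_μ|^{3/2} ≤ C (μ/R)^{9/2} ∫_{B(R)} |h|^{3/2}` with `C` absolute. -/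
theorem harmonic_mean_oscillation_decay :
    ∃ C : ℝ, 0 < C ∧
      ∀ (R : ℝ) (h : E3 → ℝ) (μ : ℝ), 0 < R →
        ContDiffOn ℝ 2 h (ball (0 : E3) R) →
        (∀ x ∈ ball (0 : E3) R, lap h x = 0) →
        0 < μ → μ ≤ R/2 →
        (∫⁻ x in ball (0 : E3) μ,
            (ENNReal.ofReal |h x - ⨍ y in ball (0 : E3) μ, h y|) ^ ((3:ℝ)/2))
          ≤ ENNReal.ofReal C * (ENNReal.ofReal (μ/R)) ^ ((9:ℝ)/2)
              * ∫⁻ x in ball (0 : E3) R, (ENNReal.ofReal |h x|) ^ ((3:ℝ)/2) := by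
  set c := ∫ z, psi z with hc
  have hc0 : 0 < c := psi_int_pos
  set V := (volume (ball (0:E3) 1)).toReal with hVdef
  have hvt : volume (ball (0:E3) 1) ≠ ⊤ := measure_ball_lt_top.ne
  have hV : 0 < V := ENNReal.toReal_pos (measure_ball_pos _ _ one_pos).ne' hvt
  have hvol : ∀ r : ℝ, 0 ≤ r → volume (ball (0:E3) r) = ENNReal.ofReal (r^3 * V) := by
    intro r hr
    rw [Measure.addHaar_ball _ _ hr, ENNReal.ofReal_mul (by positivity), hVdef, ENNReal.ofReal_toReal hvt]
    simp
  refine ⟨(64/c)^((3:ℝ)/2) * V^((3:ℝ)/2), by positivity, ?_⟩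
  intro R h μ hR hh hl hμ hμR
  set I := ∫⁻ x in ball (0 : E3) R, (ENNReal.ofReal |h x|) ^ ((3:ℝ)/2) with hI
  by_cases hItop : I = ⊤
  · rw [hItop, ENNReal.mul_top]
    · exact le_top
    · rw [mul_ne_zero_iff]
      constructor
      · simp only [ne_eq, ENNReal.ofReal_eq_zero, not_le]; positivity
      · have : 0 < ENNReal.ofReal (μ/R) := ENNReal.ofReal_pos.2 (by positivity)
        exact (ENNReal.rpow_pos this ENNReal.ofReal_ne_top).ne'
  have hmeas : AEMeasurable h (volume.restrict (ball (0:E3) R)) :=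
    hh.continuousOn.aemeasurable measurableSet_ball
  have hol := holder_ball h (ball (0:E3) R) hmeas
  rw [← hI] at hol
  have hJ : ∫⁻ x in ball (0:E3) R, ENNReal.ofReal |h x| ≠ ⊤ := by
    refine ne_top_of_le_ne_top ?_ hol
    refine ENNReal.mul_ne_top (ENNReal.rpow_ne_top_of_nonneg (by norm_num) hItop)
      (ENNReal.rpow_ne_top_of_nonneg (by norm_num) measure_ball_lt_top.ne)
  have hint : IntegrableOn h (ball (0:E3) R) := by
    refine ⟨hmeas.aestronglyMeasurable, ?_⟩
    rw [hasFiniteIntegral_iff_norm]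
    exact hJ.lt_top
  have hsub : ball (0:E3) μ ⊆ ball (0:E3) R := ball_subset_ball (by linarith)
  have hsub2 : ball (0:E3) μ ⊆ ball (0:E3) (R/2) := ball_subset_ball hμR
  set J := ∫ y in ball (0:E3) R, |h y| with hJdef
  have hJ0 : 0 ≤ J := integral_nonneg fun _ => abs_nonneg _
  have hJof : ENNReal.ofReal J = ∫⁻ x in ball (0:E3) R, ENNReal.ofReal |h x| :=
    ofReal_integral_eq_lintegral_ofReal hint.abs (Eventually.of_forall fun _ => abs_nonneg _)
  have hpt : ∀ x ∈ ball (0:E3) μ, |h x - ⨍ y in ball (0 : E3) μ, h y| ≤ 64/c * μ / R^4 * J := by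
    intro x hx
    have : (⨍ y in ball (0 : E3) μ, h y) ∈ closedBall (h x) (64/c * μ / R^4 * J) := by
      refine (convex_closedBall _ _).set_average_mem isClosed_closedBall (measure_ball_pos _ _ hμ).ne'
        measure_ball_lt_top.ne ?_ (hint.mono_set hsub)
      refine (ae_restrict_iff' measurableSet_ball).2 (Eventually.of_forall fun y hy => ?_)
      rw [mem_closedBall, Real.dist_eq]
      have o := osc h R hR hh hl hint y x (hsub2 hy) (hsub2 hx)
      have n : ‖y - x‖ ≤ 2 * μ := by
        rw [mem_ball_zero_iff] at hx hy
        linarith [norm_sub_le y x]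
      have o2 : c * |h y - h x| ≤ 32/R^4 * (2*μ) * J := o.trans (by gcongr)
      rw [mul_comm, ← le_div_iff₀ hc0] at o2
      refine o2.trans_eq ?_
      field_simp; ring
    rwa [mem_closedBall, Real.dist_eq, abs_sub_comm] at this
  have hA : 0 ≤ 64/c * μ / R^4 := by positivity
  calc (∫⁻ x in ball (0 : E3) μ,
            (ENNReal.ofReal |h x - ⨍ y in ball (0 : E3) μ, h y|) ^ ((3:ℝ)/2))
      ≤ ∫⁻ x in ball (0 : E3) μ, (ENNReal.ofReal (64/c * μ / R^4 * J)) ^ ((3:ℝ)/2) := by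
        refine setLIntegral_mono measurable_const fun x hx => ?_
        exact ENNReal.rpow_le_rpow (ENNReal.ofReal_le_ofReal (hpt x hx)) (by norm_num)
    _ = (ENNReal.ofReal (64/c * μ / R^4) * ENNReal.ofReal J) ^ ((3:ℝ)/2) * ENNReal.ofReal (μ^3 * V) := by
        rw [setLIntegral_const, hvol μ hμ.le, ENNReal.ofReal_mul hA]
    _ ≤ (ENNReal.ofReal (64/c * μ / R^4) * (I^((2:ℝ)/3) * (ENNReal.ofReal (R^3 * V))^((1:ℝ)/3))) ^ ((3:ℝ)/2)
          * ENNReal.ofReal (μ^3 * V) := by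
        rw [← hvol R hR.le, hJof]
        gcongr
    _ = (ENNReal.ofReal (64/c * μ / R^4))^((3:ℝ)/2) * (ENNReal.ofReal (R^3 * V))^((1:ℝ)/2)
          * ENNReal.ofReal (μ^3 * V) * I := by
        rw [ENNReal.mul_rpow_of_nonneg _ _ (by norm_num), ENNReal.mul_rpow_of_nonneg _ _ (by norm_num),
          ← ENNReal.rpow_mul, ← ENNReal.rpow_mul]
        norm_num
        ring
    _ = ENNReal.ofReal ((64/c)^((3:ℝ)/2) * V^((3:ℝ)/2)) * (ENNReal.ofReal (μ/R)) ^ ((9:ℝ)/2) * I := by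
        congr 1
        rw [ENNReal.ofReal_rpow_of_nonneg hA (by norm_num),
          ENNReal.ofReal_rpow_of_nonneg (by positivity) (by norm_num),
          ENNReal.ofReal_rpow_of_nonneg (by positivity) (by norm_num),
          ← ENNReal.ofReal_mul (by positivity), ← ENNReal.ofReal_mul (by positivity),
          ← ENNReal.ofReal_mul (by positivity),
          real_id (64/c) μ R V (by positivity) hμ.le hR hV.le]
end
end
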